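/- Let G be a finite group satisfying the two-prime hypothesis with normal subgroups N ≤ M such that M/N ≅ PSL_2(7) and the centralizer of M/N in G/N is trivial. Then |cd(G)| ≤ 18. -/

import Mathlib

open CategoryTheory

/-- The set of degrees of the complex irreducible characters of `G`. -/
def charDegrees (G : Type) [Group G] : Set ℕ :=
  {n | ∃ V : FDRep ℂ G, Simple V ∧ Module.finrank ℂ V = n}

/-- `G` satisfies the two-prime hypothesis: for any distinct irreducible character degrees
`a`, `b`, the gcd `gcd a b` has at most two prime divisors counted with multiplicity. -/
def TwoPrimeHypothesis (G : Type) [Group G] : Prop :=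
  ∀ a ∈ charDegrees G, ∀ b ∈ charDegrees G, a ≠ b →
    (Nat.gcd a b).primeFactorsList.length ≤ 2

/-- `PSL₂(F)`: the quotient of `SL₂(F)` by its center. -/
abbrev PSL2 (F : Type) [Field F] : Type :=
  Matrix.SpecialLinearGroup (Fin 2) F ⧸
    Subgroup.center (Matrix.SpecialLinearGroup (Fin 2) F)

open CategoryTheory
set_option linter.unusedSectionVars false
set_option linter.style.haveILetI false

namespace CT
noncomputable section

open Matrix ComplexConjugate
open scoped ComplexOrder MatrixOrder Matrix.Norms.L2Operator

/-- `f` is the character of a finite dimensional complex representation. -/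
def IsChar {G : Type} [Group G] (f : G → ℂ) : Prop :=
  ∃ (V : Type) (_ : AddCommGroup V) (_ : Module ℂ V) (_ : FiniteDimensional ℂ V)
    (ρ : Representation ℂ G V), ρ.character = f

/-- `f` is an irreducible character. -/
def IsIrr {G : Type} [Group G] (f : G → ℂ) : Prop :=
  ∃ (V : Type) (_ : AddCommGroup V) (_ : Module ℂ V) (_ : FiniteDimensional ℂ V)
    (ρ : Representation ℂ G V), ρ.IsIrreducible ∧ ρ.character = f

theorem IsIrr.isChar {G : Type} [Group G] {f : G → ℂ} (h : IsIrr f) : IsChar f := by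
  obtain ⟨V, i1, i2, i3, ρ, _, h⟩ := h
  exact ⟨V, i1, i2, i3, ρ, h⟩

variable {G : Type} [Group G] [Finite G]

/-- sum over a finite group -/
def gs {X : Type} [Finite X] (f : X → ℂ) : ℂ := letI := Fintype.ofFinite X; ∑ x, f x

theorem gs_eq {X : Type} [Finite X] [inst : Fintype X] (f : X → ℂ) : gs f = ∑ x, f x := by
  unfold gs
  congr!

/-- The inner product of class functions -/
def ip (f h : G → ℂ) : ℂ := (Nat.card G : ℂ)⁻¹ * gs (fun g => f g * conj (h g))

theorem exists_unitary {V : Type} [AddCommGroup V] [Module ℂ V] [FiniteDimensional ℂ V]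
    (ρ : Representation ℂ G V) : ∃ n, n = Module.finrank ℂ V ∧
      ∃ A : G →* Matrix (Fin n) (Fin n) ℂ, (∀ g, (A g)ᴴ * A g = 1) ∧ (∀ g, (A g).trace = ρ.character g) ∧
      (∀ g (c : ℂ), A g = c • 1 → ρ g = c • 1) := by
  classical
  refine ⟨_, rfl, ?_⟩
  let := Fintype.ofFinite G
  let b := Module.finBasis ℂ V
  let B : G → Matrix (Fin (Module.finrank ℂ V)) (Fin (Module.finrank ℂ V)) ℂ :=
    fun g => LinearMap.toMatrix b b (ρ g)
  have hB1 : B 1 = 1 := by simp [B]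
  have hBm : ∀ g h, B (g * h) = B g * B h := by
    intro g h; simp only [B, map_mul]; exact LinearMap.toMatrix_mul b _ _
  let H := ∑ g, (B g)ᴴ * B g
  have hH : H.PosDef := by
    have h1 : H = (B 1)ᴴ * B 1 + ∑ g ∈ Finset.univ.erase 1, (B g)ᴴ * B g := by
      exact (Finset.add_sum_erase _ (fun g => (B g)ᴴ * B g) (Finset.mem_univ (1:G))).symm
    rw [h1, hB1]
    apply Matrix.PosDef.add_posSemidef
    · simpa using Matrix.PosDef.one
    · exact Matrix.posSemidef_sum _ (fun g _ => Matrix.posSemidef_conjTranspose_mul_self _)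
  obtain ⟨P, hP⟩ := CStarAlgebra.nonneg_iff_eq_star_mul_self.mp hH.posSemidef.nonneg
  rw [Matrix.star_eq_conjTranspose] at hP
  have hPu : IsUnit P.det := by
    have h2 := hH.isUnit
    rw [hP, Matrix.isUnit_iff_isUnit_det, Matrix.det_mul] at h2
    exact isUnit_of_mul_isUnit_right h2
  have hinv : ∀ g, (B g)ᴴ * H * B g = H := by
    intro g
    simp only [H, Finset.mul_sum, Finset.sum_mul]
    rw [← Equiv.sum_comp (Equiv.mulRight g) (fun x => (B x)ᴴ * B x)]
    apply Finset.sum_congr rfl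
    intro x _
    simp only [Equiv.coe_mulRight, hBm, Matrix.conjTranspose_mul, Matrix.mul_assoc]
  have hPP : P⁻¹ * P = 1 := Matrix.nonsing_inv_mul P hPu
  have hPP' : P * P⁻¹ = 1 := Matrix.mul_nonsing_inv P hPu
  refine ⟨⟨⟨fun g => P * B g * P⁻¹, by simp [hB1, hPP']⟩, ?_⟩, ?_, ?_, ?_⟩
  · intro g h
    simp only [hBm]
    calc P * (B g * B h) * P⁻¹ = P * B g * 1 * B h * P⁻¹ := by simp [Matrix.mul_assoc]
      _ = _ := by rw [← hPP]; simp [Matrix.mul_assoc]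
  · intro g
    change (P * B g * P⁻¹)ᴴ * (P * B g * P⁻¹) = 1
    have h3 : (P⁻¹)ᴴ * Pᴴ = 1 := by rw [← Matrix.conjTranspose_mul, hPP', Matrix.conjTranspose_one]
    calc (P * B g * P⁻¹)ᴴ * (P * B g * P⁻¹) = (P⁻¹)ᴴ * ((B g)ᴴ * (Pᴴ * P) * B g) * P⁻¹ := by
          simp [Matrix.conjTranspose_mul, Matrix.mul_assoc]
      _ = (P⁻¹)ᴴ * Pᴴ * (P * P⁻¹) := by rw [← hP, hinv, hP]; simp [Matrix.mul_assoc]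
      _ = 1 := by rw [h3, hPP', Matrix.one_mul]
  · intro g
    change (P * B g * P⁻¹).trace = _
    rw [Matrix.trace_mul_cycle, hPP, Matrix.one_mul]
    exact (LinearMap.trace_eq_matrix_trace ℂ b (ρ g)).symm
  · intro g c h
    change P * B g * P⁻¹ = _ at h
    have h4 : B g = c • 1 := by
      calc B g = (P⁻¹ * P) * B g * (P⁻¹ * P) := by rw [hPP]; simp
        _ = P⁻¹ * (P * B g * P⁻¹) * P := by simp [Matrix.mul_assoc]
        _ = _ := by rw [h]; simp [hPP]
    apply (LinearMap.toMatrix b b).injective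
    change B g = _
    rw [h4]
    simp

theorem IsChar.conj_inv {f : G → ℂ} (hf : IsChar f) (g : G) : f g⁻¹ = conj (f g) := by
  obtain ⟨V, _, _, _, ρ, rfl⟩ := hf
  obtain ⟨n, -, A, h1, h2, -⟩ := exists_unitary ρ
  have h3 : A g⁻¹ = (A g)ᴴ := by
    calc A g⁻¹ = (A g)ᴴ * A g * A g⁻¹ := by rw [h1, Matrix.one_mul]
      _ = _ := by rw [Matrix.mul_assoc, ← map_mul]; simp
  rw [← h2, ← h2, h3, Matrix.trace_conjTranspose]; rfl

/-- value bound, and scalar criterion -/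
theorem rep_norm_le {V : Type} [AddCommGroup V] [Module ℂ V] [FiniteDimensional ℂ V]
    (ρ : Representation ℂ G V) (g : G) : ‖ρ.character g‖ ≤ Module.finrank ℂ V ∧
    (‖ρ.character g‖ = Module.finrank ℂ V → 
      ∃ c : ℂ, ρ g = c • 1) := by
  obtain ⟨n, hn, A, h1, h2, h3⟩ := exists_unitary ρ
  rw [← hn]
  rcases Nat.eq_zero_or_pos n with h0 | h0
  · have : Subsingleton V := Module.finrank_zero_iff.mp (hn.symm.trans h0)
    have hz : ρ.character g = 0 := by
      have : ρ g = 0 := Subsingleton.elim _ _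
      simp [Representation.character, this]
    rw [hz]
    refine ⟨by simp, fun _ => ⟨1, ?_⟩⟩
    exact Subsingleton.elim _ _
  set χ := ρ.character g with hχ
  have hn0 : (n : ℂ) ≠ 0 := by exact_mod_cast h0.ne'
  set c : ℂ := χ / n with hc
  let B := A g - c • (1 : Matrix (Fin n) (Fin n) ℂ)
  have key : (Bᴴ * B).trace = ((n - ‖χ‖ ^ 2 / n : ℝ) : ℂ) := by
    have e : Bᴴ * B = 1 - c • (A g)ᴴ - (conj c) • A g + (conj c * c) • 1 := by
      simp only [B, Matrix.conjTranspose_sub, Matrix.conjTranspose_smul, Matrix.conjTranspose_one,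
        Matrix.sub_mul, Matrix.mul_sub, h1, Matrix.smul_mul, Matrix.mul_smul, Matrix.one_mul,
        Matrix.mul_one]
      simp only [RCLike.star_def]
      rw [smul_sub, smul_smul, mul_comm]
      abel
    rw [e]
    simp only [Matrix.trace_add, Matrix.trace_sub, Matrix.trace_smul, Matrix.trace_one,
      Matrix.trace_conjTranspose, h2, Fintype.card_fin, smul_eq_mul]
    have e2 : (χ * conj χ) = ((‖χ‖ ^ 2 : ℝ) : ℂ) := by
      rw [Complex.mul_conj, Complex.normSq_eq_norm_sq]
    change _ - c * conj χ - conj c * χ + _ = _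
    rw [hc]
    push_cast at e2 ⊢
    rw [← e2]
    simp only [map_div₀, Complex.conj_natCast]
    field_simp
    ring
  have hps : (0 : ℂ) ≤ (Bᴴ * B).trace := (Matrix.posSemidef_conjTranspose_mul_self B).trace_nonneg
  rw [key] at hps
  have hps' : (0 : ℝ) ≤ n - ‖χ‖ ^ 2 / n := by exact_mod_cast hps
  have hnr : (0 : ℝ) < n := by exact_mod_cast h0
  constructor
  · have : ‖χ‖ ^ 2 ≤ (n : ℝ) ^ 2 := by
      rw [sub_nonneg, div_le_iff₀ hnr] at hps'; nlinarith
    exact le_of_sq_le_sq this hnr.le |> fun h => h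
  · intro h
    refine ⟨c, h3 g c ?_⟩
    have : (Bᴴ * B).trace = 0 := by
      rw [key, h]; norm_cast; field_simp; simp
    rw [Matrix.trace_conjTranspose_mul_self_eq_zero_iff] at this
    exact sub_eq_zero.mp this

end
end CT

open CategoryTheory
set_option linter.unusedSectionVars false
set_option linter.style.haveILetI false

namespace CT
noncomputable section
open ComplexConjugate

variable {G : Type} [Group G] [Finite G]

section gs
variable {X Y : Type} [Finite X] [Finite Y]
theorem gs_add (f h : X → ℂ) : gs (fun x => f x + h x) = gs f + gs h := Finset.sum_add_distrib
theorem gs_mul (c : ℂ) (f : X → ℂ) : gs (fun x => c * f x) = c * gs f := Finset.mul_sum _ _ _ |>.symm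
theorem gs_mul_right (c : ℂ) (f : X → ℂ) : gs (fun x => f x * c) = gs f * c := Finset.sum_mul _ _ _ |>.symm
theorem gs_conj (f : X → ℂ) : conj (gs f) = gs (fun x => conj (f x)) := map_sum _ _ _
theorem gs_sum {ι : Type*} (s : Finset ι) (f : ι → X → ℂ) :
    gs (fun x => ∑ i ∈ s, f i x) = ∑ i ∈ s, gs (f i) := Finset.sum_comm
theorem gs_comm (f : X → Y → ℂ) : gs (fun x => gs (fun y => f x y)) = gs (fun y => gs (fun x => f x y)) :=
  Finset.sum_comm
theorem gs_equiv (e : X ≃ Y) (f : Y → ℂ) : gs (fun x => f (e x)) = gs f := by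
  let := Fintype.ofFinite X; let := Fintype.ofFinite Y; rw [gs_eq, gs_eq]; exact Equiv.sum_comp e f
theorem gs_const (c : ℂ) : gs (fun _ : X => c) = Nat.card X * c := by
  let := Fintype.ofFinite X; rw [gs_eq]; simp
theorem gs_congr {f h : X → ℂ} (H : ∀ x, f x = h x) : gs f = gs h := by rw [funext H]
end gs

theorem card_ne : (Nat.card G : ℂ) ≠ 0 := by exact_mod_cast Nat.card_pos.ne'

theorem ip_add_left (f f' h : G → ℂ) : ip (f + f') h = ip f h + ip f' h := by
  simp only [ip, Pi.add_apply, add_mul, gs_add]; ring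
theorem ip_smul_left (c : ℂ) (f h : G → ℂ) : ip (c • f) h = c * ip f h := by
  simp only [ip, Pi.smul_apply, smul_eq_mul, mul_assoc, gs_mul]; ring
theorem ip_conj (f h : G → ℂ) : conj (ip f h) = ip h f := by
  simp only [ip, map_mul, gs_conj, map_inv₀, Complex.conj_natCast, Complex.conj_conj, mul_comm]
theorem ip_add_right (f h h' : G → ℂ) : ip f (h + h') = ip f h + ip f h' := by
  rw [← ip_conj, ip_add_left, map_add, ip_conj, ip_conj]
theorem ip_smul_right (c : ℂ) (f h : G → ℂ) : ip f (c • h) = conj c * ip f h := by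
  rw [← ip_conj, ip_smul_left, map_mul, ip_conj]
theorem ip_zero_left (h : G → ℂ) : ip 0 h = 0 := by
  have := ip_smul_left 0 0 h; simpa using this
theorem ip_zero_right (h : G → ℂ) : ip h 0 = 0 := by
  have := ip_smul_right 0 h 0; simpa using this
theorem ip_sum_left {ι : Type*} (s : Finset ι) (f : ι → G → ℂ) (h : G → ℂ) :
    ip (∑ i ∈ s, f i) h = ∑ i ∈ s, ip (f i) h := by
  classical
  induction s using Finset.induction_on with
  | empty => simp [ip_zero_left]
  | insert a s ha ih => rw [Finset.sum_insert ha, Finset.sum_insert ha, ip_add_left, ih]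
theorem ip_sum_right {ι : Type*} (s : Finset ι) (f : ι → G → ℂ) (h : G → ℂ) :
    ip h (∑ i ∈ s, f i) = ∑ i ∈ s, ip h (f i) := by
  classical
  induction s using Finset.induction_on with
  | empty => simp [ip_zero_right]
  | insert a s ha ih => rw [Finset.sum_insert ha, Finset.sum_insert ha, ip_add_right, ih]

theorem ip_self_real (f : G → ℂ) : ip f f = (((Nat.card G : ℝ)⁻¹ * ∑ᶠ g, ‖f g‖ ^ 2 : ℝ) : ℂ) := by
  let := Fintype.ofFinite G
  rw [ip, gs_eq, finsum_eq_sum_of_fintype]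
  push_cast
  congr 1
  apply Finset.sum_congr rfl
  intro x _
  rw [Complex.mul_conj, Complex.normSq_eq_norm_sq]; push_cast; rfl

theorem ip_self_re_nonneg (f : G → ℂ) : 0 ≤ (ip f f).re := by
  rw [ip_self_real, Complex.ofReal_re]
  exact mul_nonneg (by positivity) (finsum_nonneg (fun _ => by positivity))

theorem ip_self_eq_zero {f : G → ℂ} (h : ip f f = 0) : f = 0 := by
  rw [ip_self_real] at h
  have h1 : (Nat.card G : ℝ)⁻¹ ≠ 0 := by
    have : (Nat.card G : ℝ) ≠ 0 := by exact_mod_cast Nat.card_pos.ne'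
    exact inv_ne_zero this
  have h2 : ∑ᶠ g, ‖f g‖ ^ 2 = 0 := by
    have := Complex.ofReal_eq_zero.mp h
    exact (mul_eq_zero.mp this).resolve_left h1
  let := Fintype.ofFinite G
  rw [finsum_eq_sum_of_fintype, Finset.sum_eq_zero_iff_of_nonneg (fun _ _ => by positivity)] at h2
  ext g
  simpa using h2 g (Finset.mem_univ g)

theorem ip_orth {χ ψ : G → ℂ} (h1 : IsIrr χ) (h2 : IsIrr ψ) [Decidable (χ = ψ)] :
    ip χ ψ = if χ = ψ then 1 else 0 := by
  classical
  let := Fintype.ofFinite G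
  have hc := h2.isChar
  obtain ⟨V, _, _, _, ρ, hρ, rfl⟩ := h1
  obtain ⟨W, _, _, _, σ, hσ, rfl⟩ := h2
  have := invertibleOfNonzero (card_ne (G := G))
  have key := Representation.char_orthonormal ρ σ
  have e : ip ρ.character σ.character =
      (Nat.card G : ℂ)⁻¹ * ∑ g : G, ρ.character g * σ.character g⁻¹ := by
    rw [ip, gs_eq]; congr 1; apply Finset.sum_congr rfl; intro g _; rw [IsChar.conj_inv hc]
  rw [e, key]
  by_cases h : Nonempty (σ.Equiv ρ)
  · rw [if_pos h, if_pos (Representation.char_iso h.some).symm]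
  · rw [if_neg h, if_neg]
    intro h3
    rw [if_neg h] at key
    rw [← e, h3] at key
    have h4 := ip_self_eq_zero key
    have h5 := congrFun h4 1
    rw [Representation.char_one] at h5
    have h6 : Nontrivial W := by
      by_contra hn
      rw [not_nontrivial_iff_subsingleton] at hn
      have : (⊥ : Subrepresentation σ) = ⊤ := by ext x; simp [Subsingleton.elim x 0]
      exact bot_ne_top this
    have h7 : 0 < Module.finrank ℂ W := Module.finrank_pos
    simp at h5
    omega

theorem ip_irr_self {χ : G → ℂ} (h : IsIrr χ) : ip χ χ = 1 := by
  classical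
  rw [ip_orth h h, if_pos rfl]

theorem ip_irr_ne {χ ψ : G → ℂ} (h : IsIrr χ) (h' : IsIrr ψ) (hne : χ ≠ ψ) : ip χ ψ = 0 := by
  classical
  rw [ip_orth h h', if_neg hne]

theorem Irr_finite (G : Type) [Group G] [Finite G] : {f : G → ℂ | IsIrr f}.Finite := by
  classical
  let := Fintype.ofFinite G
  have h : LinearIndependent ℂ (fun χ : {f : G → ℂ | IsIrr f} => (χ : G → ℂ)) := by
    rw [linearIndependent_iff']
    intro s c hs i hi
    have := congrArg (fun f => ip f i.1) hs
    simp only [ip_sum_left, ip_smul_left, ip_zero_left] at this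
    rw [Finset.sum_eq_single i] at this
    · simpa [ip_irr_self i.2] using this
    · intro b _ hb
      rw [ip_irr_ne b.2 i.2 (fun h => hb (Subtype.ext h)), mul_zero]
    · exact fun h => absurd hi h
  exact h.setFinite

/-- the finset of irreducible characters -/
def IrrF (G : Type) [Group G] [Finite G] : Finset (G → ℂ) := (Irr_finite G).toFinset

@[simp] theorem mem_IrrF {χ : G → ℂ} : χ ∈ IrrF G ↔ IsIrr χ := by simp [IrrF]

theorem char_compl {V : Type} [AddCommGroup V] [Module ℂ V] [FiniteDimensional ℂ V]
    (ρ : Representation ℂ G V) (p q : Subrepresentation ρ)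
    (h : IsCompl p.toSubmodule q.toSubmodule) :
    ρ.character = p.toRepresentation.character + q.toRepresentation.character := by
  ext g
  let e := Submodule.prodEquivOfIsCompl _ _ h
  have : ρ g = e.conj (LinearMap.prodMap (p.toRepresentation g) (q.toRepresentation g)) := by
    apply LinearMap.ext
    intro v
    obtain ⟨⟨a, b⟩, rfl⟩ := e.surjective v
    rw [LinearEquiv.conj_apply_apply, LinearEquiv.symm_apply_apply]
    simp only [e, Submodule.coe_prodEquivOfIsCompl', LinearMap.prodMap_apply, map_add]
    rfl
  rw [Representation.character, this, LinearMap.trace_conj', LinearMap.trace_prodMap']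
  rfl

theorem rep_induction {P : ∀ (V : Type) [AddCommGroup V] [Module ℂ V] [FiniteDimensional ℂ V],
      Representation ℂ G V → Prop}
    (zero : ∀ (V : Type) [AddCommGroup V] [Module ℂ V] [FiniteDimensional ℂ V]
      (ρ : Representation ℂ G V), Subsingleton V → P V ρ)
    (irr : ∀ (V : Type) [AddCommGroup V] [Module ℂ V] [FiniteDimensional ℂ V]
      (ρ : Representation ℂ G V), ρ.IsIrreducible → P V ρ)
    (sum : ∀ (V : Type) [AddCommGroup V] [Module ℂ V] [FiniteDimensional ℂ V]
      (ρ : Representation ℂ G V) (p q : Subrepresentation ρ),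
      IsCompl p.toSubmodule q.toSubmodule → P _ p.toRepresentation → P _ q.toRepresentation →
        P V ρ) : ∀ (n : ℕ) (V : Type) [AddCommGroup V] [Module ℂ V] [FiniteDimensional ℂ V]
      (ρ : Representation ℂ G V), Module.finrank ℂ V = n → P V ρ := by
  have : NeZero (Nat.card G : ℂ) := ⟨card_ne⟩
  intro n
  induction n using Nat.strong_induction_on with
  | _ n ih =>
  intro V _ _ _ ρ hn
  by_cases hs : Subsingleton V
  · exact zero V ρ hs
  by_cases hi : ρ.IsIrreducible
  · exact irr V ρ hi
  rw [not_subsingleton_iff_nontrivial] at hs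
  have hnt : (⊥ : Subrepresentation ρ) ≠ ⊤ := by
    intro h
    have h' : (⊥ : Submodule ℂ V) = ⊤ := congrArg Subrepresentation.toSubmodule h
    exact bot_ne_top h'
  have hnt' : Nontrivial (Subrepresentation ρ) := ⟨_, _, hnt⟩
  have : ∃ p : Subrepresentation ρ, p ≠ ⊥ ∧ p ≠ ⊤ := by
    by_contra hcon
    push Not at hcon
    exact hi ⟨fun a => or_iff_not_imp_left.mpr (hcon a)⟩
  obtain ⟨p, hp1, hp2⟩ := this
  obtain ⟨q, hq⟩ := exists_isCompl p
  have hpq : IsCompl p.toSubmodule q.toSubmodule := by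
    constructor
    · rw [disjoint_iff]
      exact congrArg Subrepresentation.toSubmodule (disjoint_iff.mp hq.1)
    · rw [codisjoint_iff]
      exact congrArg Subrepresentation.toSubmodule (codisjoint_iff.mp hq.2)
  have hq2 : q ≠ ⊤ := by
    rintro rfl
    exact hp1 (by simpa using hq.1)
  have lt : ∀ r : Subrepresentation ρ, r ≠ ⊤ → Module.finrank ℂ r.toSubmodule < n := by
    intro r hr
    rw [← hn]
    apply Submodule.finrank_lt
    intro h
    exact hr (Subrepresentation.toSubmodule_injective h)
  exact sum V ρ p q hpq (ih _ (lt p hp2) _ _ rfl) (ih _ (lt q hq2) _ _ rfl)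

theorem IsChar.decomp {f : G → ℂ} (hf : IsChar f) :
    ∃ m : (G → ℂ) → ℕ, f = ∑ χ ∈ IrrF G, (m χ : ℂ) • χ := by
  classical
  obtain ⟨V, _, _, _, ρ, rfl⟩ := hf
  refine rep_induction (P := fun V _ _ _ ρ => ∃ m : (G → ℂ) → ℕ,
    ρ.character = ∑ χ ∈ IrrF G, (m χ : ℂ) • χ) ?_ ?_ ?_ _ V ρ rfl
  · intro V _ _ _ ρ h
    refine ⟨0, ?_⟩
    ext g
    have : ρ g = 0 := Subsingleton.elim _ _
    simp [Representation.character, this]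
  · intro V _ _ _ ρ h
    have hm : IsIrr ρ.character := ⟨V, inferInstance, inferInstance, inferInstance, ρ, h, rfl⟩
    refine ⟨Pi.single ρ.character 1, ?_⟩
    rw [Finset.sum_eq_single_of_mem ρ.character (mem_IrrF.mpr hm)]
    · simp
    · intro b _ hb; simp [hb]
  · rintro V _ _ _ ρ p q h ⟨m, hm⟩ ⟨m', hm'⟩
    refine ⟨m + m', ?_⟩
    rw [char_compl ρ p q h, hm, hm', ← Finset.sum_add_distrib]
    apply Finset.sum_congr rfl
    intro χ _
    simp [add_smul]

theorem IsChar.ip_nat {f χ : G → ℂ} (hf : IsChar f) (h : IsIrr χ) : ∃ n : ℕ, ip f χ = n := by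
  obtain ⟨m, rfl⟩ := hf.decomp
  refine ⟨m χ, ?_⟩
  rw [ip_sum_left, Finset.sum_eq_single_of_mem χ (mem_IrrF.mpr h)]
  · simp [ip_smul_left, ip_irr_self h]
  · intro b hb hne
    rw [ip_smul_left, ip_irr_ne (mem_IrrF.mp hb) h hne, mul_zero]

/-- class functions -/
def IsCl {G : Type} [Group G] (f : G → ℂ) : Prop := ∀ g h, f (h * g * h⁻¹) = f g

theorem IsChar.isCl {f : G → ℂ} (hf : IsChar f) : IsCl f := by
  obtain ⟨V, _, _, _, ρ, rfl⟩ := hf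
  intro g h; simp

theorem schur {V : Type} [AddCommGroup V] [Module ℂ V] [FiniteDimensional ℂ V]
    (ρ : Representation ℂ G V) (hρ : ρ.IsIrreducible) (T : V →ₗ[ℂ] V)
    (h : ∀ g, T ∘ₗ ρ g = ρ g ∘ₗ T) : ∃ c : ℂ, T = c • 1 := by
  let T' : Representation.IntertwiningMap ρ ρ := ⟨T, h⟩
  obtain ⟨c, hc⟩ := (Representation.IsIrreducible.algebraMap_intertwiningMap_bijective_of_isAlgClosed
    (ρ := ρ)).2 T'
  refine ⟨c, ?_⟩
  have := congrArg Representation.IntertwiningMap.toLinearMap hc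
  rw [← show T'.toLinearMap = T from rfl, ← this]
  ext v
  rfl

theorem irr_finrank_pos {V : Type} [AddCommGroup V] [Module ℂ V] [FiniteDimensional ℂ V]
    (σ : Representation ℂ G V) (hσ : σ.IsIrreducible) : 0 < Module.finrank ℂ V := by
  have h6 : Nontrivial V := by
    by_contra hn
    rw [not_nontrivial_iff_subsingleton] at hn
    have : (⊥ : Subrepresentation σ) = ⊤ := by ext x; simp [Subsingleton.elim x 0]
    exact bot_ne_top this
  exact Module.finrank_pos

theorem sum_comm_rep {V : Type} [AddCommGroup V] [Module ℂ V] [Fintype G]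
    (ρ : Representation ℂ G V) {f : G → ℂ} (hf : IsCl f) (h : G) :
    (∑ g, f g • ρ g⁻¹) ∘ₗ ρ h = ρ h ∘ₗ (∑ g, f g • ρ g⁻¹) := by
  simp only [← Module.End.mul_eq_comp]
  rw [Finset.sum_mul, Finset.mul_sum, ← Equiv.sum_comp (MulAut.conj h).toEquiv]
  apply Finset.sum_congr rfl
  intro g _
  simp only [MulEquiv.toEquiv_eq_coe, MulEquiv.coe_toEquiv, MulAut.conj_apply, hf g h,
    smul_mul_assoc, mul_smul_comm]
  congr 1
  rw [← map_mul, ← map_mul]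
  congr 1
  group

theorem eq_zero_of_orth {f : G → ℂ} (hf : IsCl f) (h : ∀ χ, IsIrr χ → ip f χ = 0) : f = 0 := by
  let := Fintype.ofFinite G
  have key : ∀ (V : Type) [AddCommGroup V] [Module ℂ V] [FiniteDimensional ℂ V]
      (ρ : Representation ℂ G V), ∑ g, f g • ρ g⁻¹ = 0 := by
    intro V _ _ _ ρ
    refine rep_induction (P := fun V _ _ _ ρ => ∑ g, f g • ρ g⁻¹ = 0) ?_ ?_ ?_ _ V ρ rfl
    · intro V _ _ _ ρ h
      exact Subsingleton.elim _ _
    · intro V _ _ _ ρ hi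
      have hm : IsIrr ρ.character := ⟨V, inferInstance, inferInstance, inferInstance, ρ, hi, rfl⟩
      obtain ⟨c, hc⟩ := schur ρ hi _ (sum_comm_rep ρ hf)
      have h2 := h _ hm
      have h3 : LinearMap.trace ℂ V (∑ g, f g • ρ g⁻¹) = 0 := by
        rw [map_sum]
        rw [ip, gs_eq] at h2
        have := (mul_eq_zero.mp h2).resolve_left (inv_ne_zero card_ne)
        rw [← this]
        apply Finset.sum_congr rfl
        intro g _
        rw [map_smul, ← hm.isChar.conj_inv]; rfl
      rw [hc] at h3 ⊢
      have hp := irr_finrank_pos ρ hi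
      rw [map_smul, LinearMap.trace_one, smul_eq_mul, mul_eq_zero] at h3
      rcases h3 with h3 | h3
      · simp [h3]
      · have : Module.finrank ℂ V = 0 := by exact_mod_cast h3
        omega
    · intro V _ _ _ ρ p q hpq h1 h2
      apply LinearMap.ext
      intro v
      obtain ⟨a, ha, b, hb, rfl⟩ := Submodule.mem_sup.mp
        (show v ∈ p.toSubmodule ⊔ q.toSubmodule by rw [hpq.sup_eq_top]; trivial)
      have e1 := congrArg Subtype.val (LinearMap.congr_fun h1 ⟨a, ha⟩)
      have e2 := congrArg Subtype.val (LinearMap.congr_fun h2 ⟨b, hb⟩)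
      simp only [LinearMap.sum_apply, LinearMap.smul_apply, LinearMap.zero_apply,
        AddSubmonoidClass.coe_finsetSum, SetLike.val_smul, ZeroMemClass.coe_zero] at e1 e2
      rw [map_add]
      simp only [LinearMap.sum_apply, LinearMap.smul_apply, LinearMap.zero_apply]
      refine (congrArg₂ (· + ·) e1 e2).trans ?_
      simp
  let R : Representation ℂ G (G → ℂ) :=
    { toFun := fun g => LinearMap.funLeft ℂ ℂ (fun x => x * g)
      map_one' := by ext; simp [LinearMap.funLeft]
      map_mul' := by intro a b; ext; simp [LinearMap.funLeft, mul_assoc] }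
  classical
  have h1 := LinearMap.congr_fun (key _ R) (Pi.single 1 1)
  ext g
  have h2 := congrFun h1 g
  simp only [R, LinearMap.sum_apply, LinearMap.smul_apply, LinearMap.zero_apply, MonoidHom.coe_mk,
    OneHom.coe_mk, LinearMap.funLeft_apply, Finset.sum_apply, Pi.smul_apply, Pi.single_apply,
    smul_eq_mul, mul_ite, mul_one, mul_zero, Pi.zero_apply, mul_inv_eq_one] at h2
  simpa using h2

theorem IsCl.add {f h : G → ℂ} (h1 : IsCl f) (h2 : IsCl h) : IsCl (f + h) := by
  intro a b; simp [h1 a b, h2 a b]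
theorem IsCl.smul (c : ℂ) {f : G → ℂ} (h1 : IsCl f) : IsCl (c • f) := by
  intro a b; simp [h1 a b]
theorem IsCl.sum {ι : Type*} (s : Finset ι) {f : ι → G → ℂ} (h : ∀ i ∈ s, IsCl (f i)) :
    IsCl (∑ i ∈ s, f i) := by
  intro a b; simp only [Finset.sum_apply]; exact Finset.sum_congr rfl (fun i hi => h i hi a b)

/-- expansion in irreducible characters -/
theorem IsCl.expand {f : G → ℂ} (hf : IsCl f) : f = ∑ χ ∈ IrrF G, ip f χ • χ := by
  rw [← sub_eq_zero, sub_eq_add_neg, ← neg_one_smul ℂ]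
  apply eq_zero_of_orth
  · apply hf.add
    apply IsCl.smul
    apply IsCl.sum
    intro χ hχ
    exact (mem_IrrF.mp hχ).isChar.isCl.smul _
  · intro χ hχ
    rw [ip_add_left, ip_smul_left, ip_sum_left, Finset.sum_eq_single_of_mem χ (mem_IrrF.mpr hχ)]
    · rw [ip_smul_left, ip_irr_self hχ]; ring
    · intro b hb hne
      rw [ip_smul_left, ip_irr_ne (mem_IrrF.mp hb) hχ hne, mul_zero]

theorem IsCl.ip_expand {f h : G → ℂ} (hf : IsCl f) :
    ip f h = ∑ χ ∈ IrrF G, ip f χ * ip χ h := by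
  conv_lhs => rw [hf.expand]
  rw [ip_sum_left]
  simp only [ip_smul_left]

end
end CT

open CategoryTheory
set_option linter.unusedSectionVars false
set_option linter.style.haveILetI false

namespace CT
noncomputable section
open ComplexConjugate

variable {G : Type} [Group G] [Finite G]

section closure
variable {H : Type} [Group H] [Finite H]

theorem IsChar.comp {f : G → ℂ} (hf : IsChar f) (φ : H →* G) : IsChar (fun x => f (φ x)) := by
  obtain ⟨V, _, _, _, ρ, rfl⟩ := hf
  exact ⟨V, inferInstance, inferInstance, inferInstance, ρ.comp φ, rfl⟩

theorem IsChar.add {f h : G → ℂ} (hf : IsChar f) (hh : IsChar h) : IsChar (f + h) := by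
  obtain ⟨V, _, _, _, ρ, rfl⟩ := hf
  obtain ⟨W, _, _, _, σ, rfl⟩ := hh
  refine ⟨V × W, inferInstance, inferInstance, inferInstance, ρ.prod σ, ?_⟩
  ext g
  exact LinearMap.trace_prodMap' _ _

theorem IsChar.mul {f h : G → ℂ} (hf : IsChar f) (hh : IsChar h) : IsChar (f * h) := by
  obtain ⟨V, _, _, _, ρ, rfl⟩ := hf
  obtain ⟨W, _, _, _, σ, rfl⟩ := hh
  exact ⟨TensorProduct ℂ V W, inferInstance, inferInstance, inferInstance, ρ.tprod σ,
    Representation.char_tensor ρ σ⟩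

theorem IsChar.cconj {f : G → ℂ} (hf : IsChar f) : IsChar (fun g => conj (f g)) := by
  have h := hf
  obtain ⟨V, _, _, _, ρ, rfl⟩ := hf
  refine ⟨Module.Dual ℂ V, inferInstance, inferInstance, inferInstance, ρ.dual, ?_⟩
  ext g
  rw [Representation.char_dual, h.conj_inv]

theorem IsChar.zero : IsChar (0 : G → ℂ) := by
  refine ⟨PUnit, inferInstance, inferInstance, inferInstance, 1, ?_⟩
  ext g
  have : (1 : Representation ℂ G PUnit) g = 0 := Subsingleton.elim _ _
  simp [Representation.character, this]

/-- linear characters -/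
theorem isIrr_lin (l : G →* ℂ) : IsIrr (fun g => l g) := by
  refine ⟨ℂ, inferInstance, inferInstance, inferInstance,
    ((Algebra.lmul ℂ ℂ).toRingHom.toMonoidHom.comp l : G →* Module.End ℂ ℂ), ?_, ?_⟩
  · have h : Nontrivial (Subrepresentation
      ((Algebra.lmul ℂ ℂ).toRingHom.toMonoidHom.comp l : G →* Module.End ℂ ℂ)) := by
      refine ⟨⊥, ⊤, ?_⟩
      intro h
      have h' : (⊥ : Submodule ℂ ℂ) = ⊤ := congrArg Subrepresentation.toSubmodule h
      exact bot_ne_top h'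
    refine ⟨fun a => ?_⟩
    rcases eq_bot_or_eq_top a.toSubmodule with h | h
    · left; exact Subrepresentation.toSubmodule_injective h
    · right; exact Subrepresentation.toSubmodule_injective h
  · ext g
    change LinearMap.trace ℂ ℂ (LinearMap.mul ℂ ℂ (l g)) = l g
    have : LinearMap.mul ℂ ℂ (l g) = l g • 1 := by ext; simp
    rw [this, map_smul, LinearMap.trace_one]; simp

theorem isIrr_one : IsIrr (fun _ : G => (1 : ℂ)) := isIrr_lin 1

theorem IsChar.sum {ι : Type*} (s : Finset ι) {f : ι → G → ℂ} (h : ∀ i ∈ s, IsChar (f i)) :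
    IsChar (∑ i ∈ s, f i) := by
  classical
  induction s using Finset.induction_on with
  | empty => simpa using IsChar.zero
  | insert a s ha ih =>
    rw [Finset.sum_insert ha]
    exact (h a (Finset.mem_insert_self a s)).add
      (ih (fun i hi => h i (Finset.mem_insert_of_mem hi)))

theorem IsChar.nsmul {f : G → ℂ} (hf : IsChar f) (n : ℕ) : IsChar ((n : ℂ) • f) := by
  have : (n : ℂ) • f = ∑ _i ∈ Finset.range n, f := by
    ext g; simp
  rw [this]
  exact IsChar.sum _ (fun _ _ => hf)

theorem isChar_of_coeff {f : G → ℂ} (hf : IsCl f) (h : ∀ χ, IsIrr χ → ∃ n : ℕ, ip f χ = n) :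
    IsChar f := by
  rw [hf.expand]
  apply IsChar.sum
  intro χ hχ
  obtain ⟨n, hn⟩ := h χ (mem_IrrF.mp hχ)
  rw [hn]
  exact (mem_IrrF.mp hχ).isChar.nsmul n

end closure

/-- degree of a character -/
def deg {G : Type} [Group G] (f : G → ℂ) : ℕ := ⌊(f 1).re⌋₊

/-- multiplicity -/
def mlt (f h : G → ℂ) : ℕ := ⌊(ip f h).re⌋₊

theorem IsChar.deg_eq {f : G → ℂ} (hf : IsChar f) : f 1 = deg f := by
  obtain ⟨V, _, _, _, ρ, rfl⟩ := hf
  rw [deg, Representation.char_one]; simp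

theorem IsIrr.deg_pos {f : G → ℂ} (hf : IsIrr f) : 0 < deg f := by
  obtain ⟨V, _, _, _, ρ, h, rfl⟩ := hf
  rw [deg, Representation.char_one]; simpa using irr_finrank_pos ρ h

theorem IsIrr.one_ne {f : G → ℂ} (hf : IsIrr f) : f 1 ≠ 0 := by
  rw [hf.isChar.deg_eq]; exact_mod_cast hf.deg_pos.ne'

theorem IsChar.mlt_irr {f χ : G → ℂ} (hf : IsChar f) (h : IsIrr χ) : ip f χ = mlt f χ := by
  obtain ⟨n, hn⟩ := hf.ip_nat h
  rw [mlt, hn]; simp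

theorem IsChar.mlt_eq {f h : G → ℂ} (hf : IsChar f) (hh : IsChar h) : ip f h = mlt f h := by
  have : ∃ n : ℕ, ip f h = n := by
    rw [hf.isCl.ip_expand]
    refine ⟨∑ χ ∈ IrrF G, mlt f χ * mlt h χ, ?_⟩
    push_cast
    apply Finset.sum_congr rfl
    intro χ hχ
    rw [hf.mlt_irr (mem_IrrF.mp hχ), ← ip_conj h χ, hh.mlt_irr (mem_IrrF.mp hχ)]
    simp
  obtain ⟨n, hn⟩ := this
  rw [mlt, hn]; simp

theorem IsChar.mlt_comm {f h : G → ℂ} (hf : IsChar f) (hh : IsChar h) : mlt f h = mlt h f := by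
  have h1 := hf.mlt_eq hh
  rw [← ip_conj, hh.mlt_eq hf] at h1
  simp only [Complex.conj_natCast] at h1
  exact_mod_cast h1.symm

theorem IsChar.expand {f : G → ℂ} (hf : IsChar f) : f = ∑ χ ∈ IrrF G, (mlt f χ : ℂ) • χ := by
  conv_lhs => rw [hf.isCl.expand]
  apply Finset.sum_congr rfl
  intro χ hχ
  rw [hf.mlt_irr (mem_IrrF.mp hχ)]

theorem IsChar.mlt_expand {f h : G → ℂ} (hf : IsChar f) (hh : IsChar h) :
    mlt f h = ∑ χ ∈ IrrF G, mlt f χ * mlt h χ := by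
  have h1 := hf.mlt_eq hh
  rw [hf.isCl.ip_expand] at h1
  have : ((∑ χ ∈ IrrF G, mlt f χ * mlt h χ : ℕ) : ℂ) = mlt f h := by
    rw [← h1]; push_cast
    apply Finset.sum_congr rfl
    intro χ hχ
    rw [hf.mlt_irr (mem_IrrF.mp hχ), ← ip_conj h χ, hh.mlt_irr (mem_IrrF.mp hχ)]
    simp
  exact_mod_cast this.symm

theorem IsChar.deg_expand {f : G → ℂ} (hf : IsChar f) :
    deg f = ∑ χ ∈ IrrF G, mlt f χ * deg χ := by
  have h1 := congrFun hf.expand 1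
  rw [hf.deg_eq] at h1
  have : (deg f : ℂ) = ((∑ χ ∈ IrrF G, mlt f χ * deg χ : ℕ) : ℂ) := by
    rw [h1]; push_cast; simp only [Finset.sum_apply, Pi.smul_apply, smul_eq_mul]
    apply Finset.sum_congr rfl
    intro χ hχ
    rw [(mem_IrrF.mp hχ).isChar.deg_eq]
  exact_mod_cast this

theorem IsIrr.mlt_self {χ : G → ℂ} (h : IsIrr χ) : mlt χ χ = 1 := by
  rw [mlt, ip_irr_self h]; simp

theorem IsIrr.mlt_ne {χ ψ : G → ℂ} (h : IsIrr χ) (h' : IsIrr ψ) (hne : χ ≠ ψ) : mlt χ ψ = 0 := by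
  rw [mlt, ip_irr_ne h h' hne]; simp

theorem IsIrr.eq_of_mlt {χ ψ : G → ℂ} (h : IsIrr χ) (h' : IsIrr ψ) (hne : mlt χ ψ ≠ 0) : χ = ψ := by
  by_contra hc
  exact hne (h.mlt_ne h' hc)

theorem IsChar.mlt_self_pos {f : G → ℂ} (hf : IsChar f) {χ : G → ℂ} (h : IsIrr χ) : mlt f χ ^ 2 ≤ mlt f f := by
  rw [hf.mlt_expand hf, sq]
  exact Finset.single_le_sum (f := fun χ => mlt f χ * mlt f χ) (fun _ _ => Nat.zero_le _)
    (mem_IrrF.mpr h)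

theorem isIrr_of_norm {f : G → ℂ} (hf : IsChar f) (h : ip f f = 1) : IsIrr f := by
  have h1 : mlt f f = 1 := by rw [mlt, h]; simp
  have h2 := hf.mlt_expand hf
  rw [h1] at h2
  have hne : ∃ χ ∈ IrrF G, mlt f χ * mlt f χ ≠ 0 := by
    by_contra hcon
    push Not at hcon
    rw [Finset.sum_eq_zero hcon] at h2
    omega
  obtain ⟨χ, hχ, hm⟩ := hne
  have h4 : ∀ ψ ∈ IrrF G, ψ ≠ χ → mlt f ψ = 0 := by
    intro ψ hψ hne
    by_contra hcon
    classical
    have h5 := Finset.add_sum_erase (IrrF G) (fun χ => mlt f χ * mlt f χ) hχ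
    have h6 : mlt f ψ * mlt f ψ ≤ ∑ x ∈ (IrrF G).erase χ, mlt f x * mlt f x :=
      Finset.single_le_sum (f := fun χ => mlt f χ * mlt f χ) (fun _ _ => Nat.zero_le _)
        (Finset.mem_erase.mpr ⟨hne, hψ⟩)
    have : mlt f ψ * mlt f ψ ≠ 0 := mul_ne_zero hcon hcon
    omega
  rw [Finset.sum_eq_single_of_mem χ hχ (fun b hb hne => by rw [h4 b hb hne, mul_zero])] at h2
  have h7 : mlt f χ = 1 := Nat.eq_one_of_mul_eq_one_right h2.symm
  have h8 : f = χ := by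
    rw [hf.expand, Finset.sum_eq_single_of_mem χ hχ (fun b hb hne => by rw [h4 b hb hne]; simp), h7]
    simp
  rw [h8]
  exact mem_IrrF.mp hχ

theorem isIrr_of_mlt {f : G → ℂ} (hf : IsChar f) (h : mlt f f = 1) : IsIrr f := by
  apply isIrr_of_norm hf
  rw [hf.mlt_eq hf, h]; simp

theorem IsChar.exists_const {f : G → ℂ} (hf : IsChar f) (h : f ≠ 0) :
    ∃ χ, IsIrr χ ∧ mlt f χ ≠ 0 := by
  by_contra hcon
  push Not at hcon
  apply h
  rw [hf.expand]
  apply Finset.sum_eq_zero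
  intro χ hχ
  rw [hcon χ (mem_IrrF.mp hχ)]; simp

theorem IsIrr.ne_zero {f : G → ℂ} (hf : IsIrr f) : f ≠ 0 := fun h => hf.one_ne (by rw [h]; rfl)

section quot
variable {H : Type} [Group H] [Finite H]

theorem gs_comp_surj {φ : H →* G} (hφ : Function.Surjective φ) (F : G → ℂ) :
    (Nat.card G : ℂ) * gs (fun x => F (φ x)) = Nat.card H * gs F := by
  rw [← gs_const, ← gs_const]
  calc gs (fun _ : G => gs (fun x => F (φ x))) = gs (fun g : G => gs (fun x => F (φ x * g))) := by
        apply gs_congr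
        intro g
        obtain ⟨k, rfl⟩ := hφ g
        rw [← gs_equiv (Equiv.mulRight k) (fun x => F (φ x))]
        simp
    _ = gs (fun x => gs (fun g => F (φ x * g))) := gs_comm _
    _ = _ := by
        apply gs_congr
        intro x
        exact gs_equiv (Equiv.mulLeft (φ x)) F

theorem ip_comp_surj {φ : H →* G} (hφ : Function.Surjective φ) (f h : G → ℂ) :
    ip (fun x => f (φ x)) (fun x => h (φ x)) = ip f h := by
  rw [ip, ip]
  have := gs_comp_surj hφ (fun g => f g * conj (h g))
  have h1 := card_ne (G := G)
  have h2 := card_ne (G := H)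
  field_simp
  linear_combination this

theorem IsIrr.comp_surj {χ : G → ℂ} (h : IsIrr χ) {φ : H →* G} (hφ : Function.Surjective φ) :
    IsIrr (fun x => χ (φ x)) :=
  isIrr_of_norm (h.isChar.comp φ) (by rw [ip_comp_surj hφ, ip_irr_self h])

theorem deg_comp (χ : G → ℂ) (φ : H →* G) : deg (fun x => χ (φ x)) = deg χ := by
  simp [deg]
end quot

/-! ### Kernels and centres -/

/-- kernel of a character -/
def kerc {G : Type} [Group G] (f : G → ℂ) : Subgroup G where
  carrier := {z | ∀ g, f (z * g) = f g}
  one_mem' := by simp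
  mul_mem' := by intro a b ha hb g; rw [mul_assoc, ha, hb]
  inv_mem' := by intro a ha g; rw [← ha (a⁻¹ * g), mul_inv_cancel_left]

/-- centre of a character -/
def Zc {G : Type} [Group G] (f : G → ℂ) : Subgroup G where
  carrier := {z | ∃ c : ℂ, c ≠ 0 ∧ ∀ g, f (z * g) = c * f g}
  one_mem' := ⟨1, one_ne_zero, by simp⟩
  mul_mem' := by
    rintro a b ⟨c, hc, ha⟩ ⟨d, hd, hb⟩
    exact ⟨c * d, mul_ne_zero hc hd, fun g => by rw [mul_assoc, ha, hb, mul_assoc]⟩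
  inv_mem' := by
    rintro a ⟨c, hc, ha⟩
    refine ⟨c⁻¹, inv_ne_zero hc, fun g => ?_⟩
    have := ha (a⁻¹ * g)
    rw [mul_inv_cancel_left] at this
    rw [this, inv_mul_cancel_left₀ hc]

theorem mem_kerc_def {f : G → ℂ} {z : G} : z ∈ kerc f ↔ ∀ g, f (z * g) = f g := Iff.rfl
theorem mem_Zc_def {f : G → ℂ} {z : G} : z ∈ Zc f ↔ ∃ c : ℂ, c ≠ 0 ∧ ∀ g, f (z * g) = c * f g :=
  Iff.rfl

theorem kerc_le_Zc (f : G → ℂ) : kerc f ≤ Zc f := fun z hz =>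
  ⟨1, one_ne_zero, fun g => by rw [mem_kerc_def.mp hz g, one_mul]⟩

theorem IsCl.comm {f : G → ℂ} (hf : IsCl f) (a b : G) : f (a * b) = f (b * a) := by
  have := hf (b * a) a
  rw [← this]; congr 1; group

theorem IsCl.kerc_normal {f : G → ℂ} (hf : IsCl f) : (kerc f).Normal := by
  refine ⟨fun z hz g => mem_kerc_def.mpr fun h => ?_⟩
  rw [show g * z * g⁻¹ * h = g * (z * (g⁻¹ * h)) by group, hf.comm, mul_assoc, mem_kerc_def.mp hz,
    hf.comm]
  congr 1; group

theorem IsCl.Zc_normal {f : G → ℂ} (hf : IsCl f) : (Zc f).Normal := by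
  refine ⟨fun z hz g => ?_⟩
  obtain ⟨c, hc, h1⟩ := hz
  refine ⟨c, hc, fun h => ?_⟩
  rw [show g * z * g⁻¹ * h = g * (z * (g⁻¹ * h)) by group, hf.comm, mul_assoc, h1,
    hf.comm]
  congr 2; group

theorem IsChar.norm_le {f : G → ℂ} (hf : IsChar f) (g : G) : ‖f g‖ ≤ deg f := by
  obtain ⟨V, _, _, _, ρ, rfl⟩ := hf
  have := (rep_norm_le ρ g).1
  rw [deg, Representation.char_one]; simpa using this

theorem IsChar.mem_Zc {f : G → ℂ} (hf : IsChar f) {z : G} (h : ‖f z‖ = deg f) : z ∈ Zc f := by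
  obtain ⟨V, _, _, _, ρ, rfl⟩ := hf
  have hd : deg ρ.character = Module.finrank ℂ V := by
    rw [deg, Representation.char_one]; simp
  rw [hd] at h
  obtain ⟨c, hc⟩ := (rep_norm_le ρ z).2 h
  by_cases h0 : c = 0
  · refine ⟨1, one_ne_zero, fun g => ?_⟩
    have : ∀ g, ρ.character g = 0 := by
      intro g
      have e : ρ g = 0 := by
        calc ρ g = ρ z * ρ (z⁻¹ * g) := by rw [← map_mul]; simp
          _ = 0 := by rw [hc, h0]; simp
      simp [Representation.character, e]
    rw [this, this, mul_zero]
  · refine ⟨c, h0, fun g => ?_⟩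
    simp only [Representation.character, map_mul, hc]
    rw [smul_mul_assoc, one_mul, map_smul, smul_eq_mul]

theorem IsIrr.Zc_apply {f : G → ℂ} (hf : IsIrr f) {z : G} (h : z ∈ Zc f) (g : G) :
    f (z * g) = f z / f 1 * f g := by
  obtain ⟨c, hc, h1⟩ := h
  have h2 := h1 1
  rw [mul_one] at h2
  rw [h1, h2, mul_div_cancel_right₀ _ hf.one_ne]

theorem IsIrr.norm_of_mem_Zc {f : G → ℂ} (hf : IsIrr f) {z : G} (h : z ∈ Zc f) :
    ‖f z‖ = deg f := by
  have h1 := hf.Zc_apply h z⁻¹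
  rw [mul_inv_cancel, hf.isChar.conj_inv] at h1
  have h2 : f z * conj (f z) = f 1 * f 1 := by
    field_simp [hf.one_ne] at h1
    rw [← sq, h1]
  rw [Complex.mul_conj, Complex.normSq_eq_norm_sq, hf.isChar.deg_eq] at h2
  have h3 : ‖f z‖ ^ 2 = (deg f : ℝ) ^ 2 := by rw [sq (deg f : ℝ)]; exact_mod_cast h2
  exact (sq_eq_sq₀ (norm_nonneg _) (by positivity)).mp h3

theorem IsIrr.mem_kerc {f : G → ℂ} (hf : IsIrr f) {z : G} : z ∈ kerc f ↔ f z = f 1 := by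
  constructor
  · intro h
    simpa using mem_kerc_def.mp h 1
  · intro h
    have h1 : z ∈ Zc f := hf.isChar.mem_Zc (by rw [h, hf.isChar.deg_eq]; simp)
    rw [mem_kerc_def]
    intro g
    rw [hf.Zc_apply h1, h, div_self hf.one_ne, one_mul]

theorem IsIrr.comm_mem_kerc {f : G → ℂ} (hf : IsIrr f) {z : G} (h : z ∈ Zc f) (g : G) :
    g * z * g⁻¹ * z⁻¹ ∈ kerc f := by
  have hn := hf.isChar.isCl.Zc_normal
  rw [hf.mem_kerc]
  have h1 := hn.conj_mem z h g
  rw [hf.Zc_apply h1, hf.isChar.isCl z g]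
  have h2 := hf.Zc_apply h z⁻¹
  rw [mul_inv_cancel] at h2
  exact h2.symm

/-- twist by a linear character -/
theorem IsIrr.mul_lin {f l : G → ℂ} (hf : IsIrr f) (hl : IsIrr l) (h1 : deg l = 1) :
    IsIrr (f * l) := by
  apply isIrr_of_norm (hf.isChar.mul hl.isChar)
  rw [← ip_irr_self hf, ip, ip]
  congr 1
  apply gs_congr
  intro g
  have hz : ‖l g‖ = 1 := by
    have : g ∈ Zc l := by
      by_contra hcon
      have hN : ∀ g, ‖l g‖ ≤ 1 := fun g => by simpa [h1] using hl.isChar.norm_le g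
      -- all values have norm at most one and the mean square is one
      have h2 := ip_irr_self hl
      rw [ip_self_real] at h2
      let := Fintype.ofFinite G
      rw [finsum_eq_sum_of_fintype] at h2
      have h3 : ∑ g, ‖l g‖ ^ 2 = Nat.card G := by
        have h4 : (Nat.card G : ℝ)⁻¹ * ∑ g, ‖l g‖ ^ 2 = 1 := by exact_mod_cast h2
        have : (Nat.card G : ℝ) ≠ 0 := by exact_mod_cast Nat.card_pos.ne'
        field_simp at h4
        linarith
      have h5 : ∑ g, ‖l g‖ ^ 2 < ∑ _g : G, (1 : ℝ) := by
        apply Finset.sum_lt_sum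
        · intro i _
          have := hN i
          have := norm_nonneg (l i)
          nlinarith
        · refine ⟨g, Finset.mem_univ _, ?_⟩
          have h6 : ‖l g‖ ≠ 1 := fun h => hcon (hl.isChar.mem_Zc (by rw [h, h1]; simp))
          have := lt_of_le_of_ne (hN g) h6
          have := norm_nonneg (l g)
          nlinarith
      rw [h3] at h5
      simp at h5
    rw [hl.norm_of_mem_Zc this, h1]; simp
  have h2 : l g * conj (l g) = 1 := by
    rw [Complex.mul_conj, Complex.normSq_eq_norm_sq, hz]; simp
  simp only [Pi.mul_apply, map_mul]
  linear_combination (f g * conj (f g)) * h2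

/-! ### the bridge to `charDegrees` -/

theorem mem_charDegrees {n : ℕ} : n ∈ charDegrees G ↔ ∃ χ : G → ℂ, IsIrr χ ∧ deg χ = n := by
  let := Fintype.ofFinite G
  have conv : ∀ {f : G → ℂ}, IsChar f → (ip f f = 1 ↔ ∑ g : G, f g * f g⁻¹ = Nat.card G) := by
    intro f hf
    have : ∑ g : G, f g * f g⁻¹ = gs (fun g => f g * conj (f g)) := by
      rw [gs_eq]; simp only [hf.conj_inv]
    rw [this, ip, inv_mul_eq_one₀ card_ne, eq_comm]
  constructor
  · rintro ⟨V, hV, rfl⟩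
    rw [FDRep.simple_iff_char_is_norm_one] at hV
    have hc : IsChar V.character :=
      ⟨V, inferInstance, inferInstance, inferInstance, V.ρ, rfl⟩
    refine ⟨V.character, isIrr_of_norm hc ((conv hc).mpr hV), ?_⟩
    rw [deg, FDRep.char_one]; simp
  · rintro ⟨χ, hχ, rfl⟩
    have hχ' := hχ
    obtain ⟨V, _, _, _, ρ, h, rfl⟩ := hχ
    refine ⟨FDRep.of ρ, ?_, ?_⟩
    · rw [FDRep.simple_iff_char_is_norm_one]
      exact (conv hχ'.isChar).mp (ip_irr_self hχ')
    · rw [deg, Representation.char_one]; simp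

end
end CT

open CategoryTheory
set_option linter.unusedSectionVars false
set_option linter.style.haveILetI false

namespace CT
noncomputable section
open ComplexConjugate

variable {G : Type} [Group G] [Finite G]

theorem IsChar.roots {f : G → ℂ} (hf : IsChar f) (g : G) : ∃ s : Multiset ℂ,
    s.card = deg f ∧ s.sum = f g ∧ ∀ z ∈ s, z ^ Nat.card G = 1 := by
  obtain ⟨V, _, _, _, ρ, rfl⟩ := hf
  refine ⟨(ρ g).charpoly.roots, ?_, ?_, ?_⟩
  · have h1 := (IsAlgClosed.splits (ρ g).charpoly).natDegree_eq_card_roots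
    rw [← h1, LinearMap.charpoly_natDegree, deg, Representation.char_one]; simp
  · exact (Module.End.trace_eq_sum_roots_charpoly_of_splits (IsAlgClosed.splits _)).symm
  · intro z hz
    have hz' := Polynomial.isRoot_of_mem_roots hz
    have h2 := Module.End.hasEigenvalue_iff_isRoot_charpoly (f := ρ g) (μ := z) |>.mpr hz'
    obtain ⟨v, hv⟩ := h2.exists_hasEigenvector
    have h3 := hv.pow_apply (Nat.card G)
    rw [← map_pow, pow_card_eq_one', map_one, Module.End.one_apply] at h3
    have h4 : (z ^ Nat.card G - 1) • v = 0 := by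
      rw [sub_smul, ← h3, one_smul, sub_self]
    rcases smul_eq_zero.mp h4 with h5 | h5
    · exact sub_eq_zero.mp h5
    · exact absurd h5 hv.2

theorem IsChar.isIntegral {f : G → ℂ} (hf : IsChar f) (g : G) : IsIntegral ℤ (f g) := by
  obtain ⟨s, h1, h2, h3⟩ := hf.roots g
  rw [← h2]
  apply IsIntegral.multiset_sum
  intro z hz
  apply IsIntegral.of_pow (n := Nat.card G) Nat.card_pos
  rw [h3 z hz]
  exact isIntegral_one

theorem avg_roots (s : Multiset ℂ) (n : ℕ) (hn : 0 < n) (hs : ∀ z ∈ s, z ^ n = 1)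
    (hc : 0 < s.card) (hi : IsIntegral ℤ (s.sum / s.card)) : s.sum = 0 ∨ ‖s.sum‖ = s.card := by
  by_cases h0 : s.sum = 0
  · exact Or.inl h0
  right
  let S : Set ℂ := {z | z ^ n = 1}
  have hSf : S.Finite := by
    apply Set.Finite.subset (Polynomial.nthRoots n (1 : ℂ)).toFinset.finite_toSet
    intro z hz
    simpa [Polynomial.mem_nthRoots hn] using (show z ^ n = 1 from hz)
  let K := IntermediateField.adjoin ℚ S
  have : Finite S := hSf
  have : FiniteDimensional ℚ K := by
    apply IntermediateField.finiteDimensional_adjoin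
    intro x hx
    apply IsIntegral.of_pow hn
    rw [show x ^ n = 1 from hx]
    exact isIntegral_one
  have : NumberField K := ⟨⟩
  have hmem : ∀ z ∈ s, z ∈ K := fun z hz => IntermediateField.subset_adjoin ℚ S (hs z hz)
  obtain ⟨t, ht⟩ : ∃ t : Multiset K, Multiset.map (fun x : K => (x : ℂ)) t = s := by
    refine ⟨s.attach.map (fun z => ⟨z.1, hmem z.1 z.2⟩), ?_⟩
    rw [Multiset.map_map]
    exact Multiset.attach_map_val s
  have hts : ((t.sum : K) : ℂ) = s.sum := by
    rw [← ht]
    exact map_multiset_sum (algebraMap K ℂ) t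
  have htc : t.card = s.card := by rw [← ht, Multiset.card_map]
  have hcK : (s.card : ℂ) ≠ 0 := by exact_mod_cast hc.ne'
  have key := NumberField.Embeddings.pow_eq_one_of_norm_le_one K ℂ (x := t.sum / s.card) ?_ ?_ ?_
  · obtain ⟨m, hm, h⟩ := key
    have h' := congrArg (fun x : K => (x : ℂ)) h
    simp only [IntermediateField.coe_pow, IntermediateField.coe_div, hts] at h'
    have h2 : ‖s.sum / (s.card : ℂ)‖ = 1 :=
      Complex.norm_eq_one_of_pow_eq_one (n := m) (by simpa using h') hm.ne'
    rw [norm_div, Complex.norm_natCast, div_eq_one_iff_eq (by exact_mod_cast hc.ne')] at h2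
    exact h2
  · intro h
    apply h0
    rw [← hts]
    have hcK' : (s.card : K) ≠ 0 := by exact_mod_cast hc.ne'
    have := (div_eq_zero_iff.mp h).resolve_right hcK'
    rw [this]; rfl
  · have : Function.Injective (algebraMap K ℂ) := (algebraMap K ℂ).injective
    rw [← isIntegral_algebraMap_iff this]
    convert hi using 1
    rw [map_div₀, map_natCast]
    congr 1
  · intro φ
    rw [map_div₀, map_natCast, norm_div, Complex.norm_natCast]
    apply div_le_one_of_le₀ _ (Nat.cast_nonneg _)
    rw [map_multiset_sum, ← htc]
    have hone : ∀ y ∈ t.map φ, ‖y‖ ≤ 1 := by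
      intro y hy
      obtain ⟨x, hx, rfl⟩ := Multiset.mem_map.mp hy
      have hx1 : x ^ n = 1 := by
        apply Subtype.ext
        have := hs (x : ℂ) (by rw [← ht]; exact Multiset.mem_map_of_mem _ hx)
        simpa using this
      have : (φ x) ^ n = 1 := by rw [← map_pow, hx1, map_one]
      exact (Complex.norm_eq_one_of_pow_eq_one this hn.ne').le
    have := Multiset.le_sum_of_subadditive (fun y : ℂ => ‖y‖) norm_zero.le norm_add_le (t.map φ)
    refine this.trans ?_
    have h3 := Multiset.sum_le_card_nsmul ((t.map φ).map (fun y => ‖y‖)) 1 (by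
      intro y hy
      obtain ⟨x, hx, rfl⟩ := Multiset.mem_map.mp hy
      exact hone x hx)
    simpa using h3

abbrev OC := integralClosure ℤ ℂ

/-- integrality of central elements -/
theorem int_central {V : Type} [AddCommGroup V] [Module ℂ V] [FiniteDimensional ℂ V]
    (ρ : Representation ℂ G V) (hρ : ρ.IsIrreducible) (T : V →ₗ[ℂ] V)
    (hT : T ∈ Submodule.span OC (Set.range ρ))
    (h : ∀ g, T ∘ₗ ρ g = ρ g ∘ₗ T) : ∃ c : ℂ, T = c • 1 ∧ IsIntegral ℤ c := by
  obtain ⟨c, hc⟩ := schur ρ hρ T h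
  refine ⟨c, hc, ?_⟩
  have hne : (1 : V →ₗ[ℂ] V) ≠ 0 := by
    intro h0
    have h1 := irr_finrank_pos ρ hρ
    have h2 : LinearMap.trace ℂ V 1 = Module.finrank ℂ V := LinearMap.trace_one ℂ V
    rw [h0, map_zero] at h2
    have : Module.finrank ℂ V = 0 := by exact_mod_cast h2.symm
    omega
  have hone : (1 : V →ₗ[ℂ] V) ∈ Submodule.span OC (Set.range ρ) :=
    Submodule.subset_span ⟨1, map_one ρ⟩
  have hmul : ∀ A ∈ Submodule.span OC (Set.range ρ), ∀ B ∈ Submodule.span OC (Set.range ρ),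
      (A * B : Module.End ℂ V) ∈ Submodule.span OC (Set.range ρ) := by
    intro A hA B hB
    induction hA using Submodule.span_induction with
    | zero => simp
    | add x y _ _ h1 h2 => rw [add_mul]; exact Submodule.add_mem _ h1 h2
    | smul a x _ h1 => rw [smul_mul_assoc]; exact Submodule.smul_mem _ _ h1
    | mem x hx =>
      obtain ⟨g, rfl⟩ := hx
      induction hB using Submodule.span_induction with
      | zero => simp
      | add x y _ _ h1 h2 => rw [mul_add]; exact Submodule.add_mem _ h1 h2
      | smul a x _ h1 => rw [mul_smul_comm]; exact Submodule.smul_mem _ _ h1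
      | mem x hx =>
        obtain ⟨g', rfl⟩ := hx
        rw [← map_mul]
        exact Submodule.subset_span ⟨_, rfl⟩
  have h1 : IsIntegral OC c := by
    apply isIntegral_of_smul_mem_submodule (Submodule.span OC (Set.range ρ))
    · intro h0
      rw [h0] at hone
      exact hne (by simpa using hone)
    · exact Submodule.fg_span (Set.finite_range ρ)
    · intro n hn
      have := hmul T hT n hn
      rw [hc, smul_mul_assoc, one_mul] at this
      exact this
  exact isIntegral_trans c h1

theorem int_sum {V : Type} [AddCommGroup V] [Module ℂ V] [FiniteDimensional ℂ V] [Fintype G]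
    (ρ : Representation ℂ G V) (hρ : ρ.IsIrreducible) (A : Subgroup G) (F : G → V →ₗ[ℂ] V)
    (hF : ∀ g, F g ∈ Submodule.span OC (Set.range ρ)) (hA : ∀ g, ∀ a ∈ A, F (g * a) = F g)
    (h : ∀ g, (∑ x, F x) ∘ₗ ρ g = ρ g ∘ₗ (∑ x, F x)) : ∃ c : ℂ, IsIntegral ℤ c ∧
      LinearMap.trace ℂ V (∑ x, F x) = Nat.card A * c * Module.finrank ℂ V := by
  classical
  let := Fintype.ofFinite (G ⧸ A)
  let := Fintype.ofFinite A
  let T : V →ₗ[ℂ] V := ∑ q : G ⧸ A, F q.out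
  have hT : ∑ x, F x = (Nat.card A : ℂ) • T := by
    rw [← Equiv.sum_comp (Subgroup.groupEquivQuotientProdSubgroup (s := A)).symm,
      Fintype.sum_prod_type]
    have : ∀ (q : G ⧸ A) (a : A),
        F ((Subgroup.groupEquivQuotientProdSubgroup (s := A)).symm (q, a)) = F q.out := by
      intro q a
      have h1 : ((Subgroup.groupEquivQuotientProdSubgroup (s := A)).symm (q, a) : G ⧸ A) = q := by
        have := (Subgroup.groupEquivQuotientProdSubgroup (s := A)).apply_symm_apply (q, a)
        conv_rhs => rw [show q = ((q, a) : (G ⧸ A) × A).1 from rfl, ← this]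
        rfl
      have h2 := QuotientGroup.mk_out_eq_mul A
        ((Subgroup.groupEquivQuotientProdSubgroup (s := A)).symm (q, a))
      obtain ⟨b, hb⟩ := h2
      rw [h1] at hb
      rw [hb, hA _ _ b.2]
    simp only [this, Finset.sum_const, Finset.card_univ, T]
    rw [← Finset.smul_sum, Nat.card_eq_fintype_card, Nat.cast_smul_eq_nsmul]
  have hne : (Nat.card A : ℂ) ≠ 0 := by exact_mod_cast Nat.card_pos.ne'
  have hTc : ∀ g, T ∘ₗ ρ g = ρ g ∘ₗ T := by
    intro g
    have := h g
    rw [hT, LinearMap.smul_comp, LinearMap.comp_smul] at this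
    exact smul_right_injective _ hne this
  obtain ⟨c, hc, hi⟩ := int_central ρ hρ T (Submodule.sum_mem _ fun q _ => hF _) hTc
  refine ⟨c, hi, ?_⟩
  rw [hT, hc, map_smul, map_smul, LinearMap.trace_one]
  simp [mul_assoc]

theorem int_of_ratio {a b : ℕ} (hb : b ≠ 0) (h : IsIntegral ℤ ((a : ℂ) / b)) : b ∣ a := by
  have h1 : IsIntegral ℤ ((a : ℚ) / b) := by
    have : Function.Injective (algebraMap ℚ ℂ) := (algebraMap ℚ ℂ).injective
    rw [← isIntegral_algebraMap_iff this]
    simpa using h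
  obtain ⟨z, hz⟩ := IsIntegrallyClosed.isIntegral_iff.mp h1
  have hb' : (b : ℚ) ≠ 0 := by exact_mod_cast hb
  have h2 : (z : ℚ) * b = a := by
    rw [eq_div_iff hb'] at hz
    simpa using hz
  have h3 : z * (b : ℤ) = a := by exact_mod_cast h2
  exact Int.natCast_dvd_natCast.mp ⟨z, by rw [← h3, mul_comm]⟩

theorem IsIrr.deg_dvd_index {f : G → ℂ} (hf : IsIrr f) (A : Subgroup G) (hA : A ≤ Zc f) :
    deg f ∣ A.index := by
  let := Fintype.ofFinite G
  have hf' := hf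
  obtain ⟨V, _, _, _, ρ, hρ, hρf⟩ := hf
  have hd : (Module.finrank ℂ V : ℂ) = deg f := by
    rw [deg, ← hρf, Representation.char_one]; simp
  have hAz : ∀ a ∈ A, ∃ c : ℂ, ρ a = c • 1 := by
    intro a ha
    have h1 := hf'.norm_of_mem_Zc (hA ha)
    have h2 : (deg f : ℝ) = Module.finrank ℂ V := by exact_mod_cast hd.symm
    rw [← hρf] at h1
    exact (rep_norm_le ρ a).2 (by rw [h1, hρf, h2])
  have key := int_sum ρ hρ A (fun g => f g⁻¹ • ρ g) ?_ ?_ ?_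
  · obtain ⟨c, hi, hc⟩ := key
    rw [map_sum] at hc
    have h1 : ∑ x, LinearMap.trace ℂ V (f x⁻¹ • ρ x) = Nat.card G := by
      have h2 := ip_irr_self hf'
      rw [ip, gs_eq] at h2
      have : ∑ x, LinearMap.trace ℂ V (f x⁻¹ • ρ x) = ∑ x, f x * conj (f x) := by
        apply Finset.sum_congr rfl
        intro x _
        rw [map_smul, hf'.isChar.conj_inv, smul_eq_mul, mul_comm]
        congr 1
        exact congrFun hρf x
      rw [this]
      field_simp [card_ne (G := G)] at h2
      exact h2
    rw [h1, hd, ← Subgroup.card_mul_index A] at hc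
    apply int_of_ratio hf'.deg_pos.ne'
    have hA0 : (Nat.card A : ℂ) ≠ 0 := by exact_mod_cast Nat.card_pos.ne'
    have hd0 : (deg f : ℂ) ≠ 0 := by exact_mod_cast hf'.deg_pos.ne'
    have : (A.index : ℂ) / deg f = c := by
      rw [div_eq_iff hd0]
      apply mul_left_cancel₀ hA0
      push_cast at hc
      rw [hc]; ring
    rw [this]; exact hi
  · intro g
    have : f g⁻¹ • ρ g = (⟨f g⁻¹, hf'.isChar.isIntegral _⟩ : OC) • ρ g := rfl
    rw [this]
    exact Submodule.smul_mem _ _ (Submodule.subset_span ⟨g, rfl⟩)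
  · intro g a ha
    obtain ⟨c, hc⟩ := hAz a ha
    have h0 : c ≠ 0 := by
      rintro rfl
      have h1 := hf'.norm_of_mem_Zc (hA ha)
      rw [← hρf, Representation.character, hc, zero_smul, map_zero, norm_zero, hρf] at h1
      exact hf'.deg_pos.ne' (by exact_mod_cast h1.symm)
    have h2 : ρ a⁻¹ = c⁻¹ • 1 := by
      have : ρ a * ρ a⁻¹ = 1 := by rw [← map_mul, mul_inv_cancel, map_one]
      rw [hc, smul_mul_assoc, one_mul] at this
      rw [← this, smul_smul, inv_mul_cancel₀ h0, one_smul]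
    have h3 : f (g * a)⁻¹ = c⁻¹ * f g⁻¹ := by
      rw [mul_inv_rev, ← hρf, Representation.character, map_mul, h2, smul_mul_assoc, one_mul,
        map_smul]
      rfl
    simp only [h3]
    rw [map_mul, hc, mul_smul_comm, mul_one, smul_smul]
    congr 1
    field_simp
  · intro h
    have := sum_comm_rep ρ (f := f) hf'.isChar.isCl h
    rw [← Equiv.sum_comp (Equiv.inv G)] at this
    simpa using this

theorem IsIrr.burnside {f : G → ℂ} (hf : IsIrr f) (A : Subgroup G) (g : G)
    (hA : ∀ a ∈ A, a * g * a⁻¹ * g⁻¹ ∈ kerc f) (hc : Nat.Coprime A.index (deg f)) :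
    f g = 0 ∨ g ∈ Zc f := by
  let := Fintype.ofFinite G
  have hf' := hf
  obtain ⟨V, _, _, _, ρ, hρ, hρf⟩ := hf
  have hd : (Module.finrank ℂ V : ℂ) = deg f := by
    rw [deg, ← hρf, Representation.char_one]; simp
  have hker : ∀ a ∈ kerc f, ρ a = 1 := by
    intro a ha
    have h1 := hf'.norm_of_mem_Zc (kerc_le_Zc f ha)
    have h2 : (deg f : ℝ) = Module.finrank ℂ V := by exact_mod_cast hd.symm
    rw [← hρf] at h1
    obtain ⟨c, hc⟩ := (rep_norm_le ρ a).2 (by rw [h1, hρf, h2])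
    have h3 := hf'.mem_kerc.mp ha
    rw [← hρf, Representation.char_one, Representation.character, hc, map_smul, smul_eq_mul,
      LinearMap.trace_one] at h3
    have h4 : (Module.finrank ℂ V : ℂ) ≠ 0 := by
      rw [hd]; exact_mod_cast hf'.deg_pos.ne'
    have : c = 1 := mul_right_cancel₀ h4 (by rw [h3, one_mul])
    rw [hc, this, one_smul]
  obtain ⟨c, hi, hc1⟩ := int_sum ρ hρ A (fun x => ρ (x * g * x⁻¹))
    (fun x => Submodule.subset_span ⟨_, rfl⟩)
    (by
      intro x a ha
      have h1 := hker _ (hA a ha)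
      have h2 : ρ (a * g * a⁻¹) = ρ g := by
        rw [show a * g * a⁻¹ = a * g * a⁻¹ * g⁻¹ * g by group, map_mul, h1, one_mul]
      rw [show x * a * g * (x * a)⁻¹ = x * (a * g * a⁻¹) * x⁻¹ by group, map_mul, map_mul, h2,
        ← map_mul, ← map_mul])
    (by
      intro h
      simp only [← Module.End.mul_eq_comp]
      rw [Finset.sum_mul, Finset.mul_sum, ← Equiv.sum_comp (Equiv.mulLeft h)]
      apply Finset.sum_congr rfl
      intro x _
      rw [← map_mul, ← map_mul]
      congr 1
      simp only [Equiv.coe_mulLeft]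
      group)
  have h1 : LinearMap.trace ℂ V (∑ x, ρ (x * g * x⁻¹)) = Nat.card G * f g := by
    rw [map_sum]
    have : ∀ x, LinearMap.trace ℂ V (ρ (x * g * x⁻¹)) = f g := by
      intro x
      rw [← hf'.isChar.isCl g x]
      exact congrFun hρf _
    rw [Finset.sum_congr rfl fun x _ => this x]
    simp
  have hA0 : (Nat.card A : ℂ) ≠ 0 := by exact_mod_cast Nat.card_pos.ne'
  have hd0 : (deg f : ℂ) ≠ 0 := by exact_mod_cast hf'.deg_pos.ne'
  have h2 : (A.index : ℂ) * (f g / deg f) = c := by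
    rw [h1, hd, ← Subgroup.card_mul_index A] at hc1
    apply mul_left_cancel₀ hA0
    push_cast at hc1
    rw [mul_div_assoc', mul_div_assoc', div_eq_iff hd0, ← mul_assoc, hc1]
  have hbez := Nat.gcd_eq_gcd_ab A.index (deg f)
  rw [hc] at hbez
  have h3 : IsIntegral ℤ (f g / deg f) := by
    have h4 : f g / deg f = ((A.index.gcdA (deg f) : ℤ) : ℂ) * c
        + ((A.index.gcdB (deg f) : ℤ) : ℂ) * f g := by
      have hb' : (1 : ℂ) = (A.index : ℂ) * ((A.index.gcdA (deg f) : ℤ) : ℂ)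
        + (deg f : ℂ) * ((A.index.gcdB (deg f) : ℤ) : ℂ) := by exact_mod_cast hbez
      rw [← h2]
      calc f g / deg f = 1 * (f g / deg f) := by ring
        _ = _ := by rw [hb']; field_simp
    rw [h4]
    have hz : ∀ z : ℤ, IsIntegral ℤ (z : ℂ) := fun z => isIntegral_algebraMap (R := ℤ) (A := ℂ)
    exact ((hz _).mul hi).add ((hz _).mul (hf'.isChar.isIntegral g))
  obtain ⟨s, hs1, hs2, hs3⟩ := hf'.isChar.roots g
  have := avg_roots s _ Nat.card_pos hs3 (by rw [hs1]; exact hf'.deg_pos) (by rw [hs1, hs2]; exact h3)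
  rw [hs1, hs2] at this
  rcases this with h | h
  · exact Or.inl h
  · exact Or.inr (hf'.isChar.mem_Zc h)
end
end CT

open CategoryTheory
set_option linter.unusedSectionVars false
set_option linter.style.haveILetI false

namespace CT
noncomputable section
open ComplexConjugate

variable {G : Type} [Group G] [Finite G]

section ind
variable {H : Type} [Group H] [Finite H]

open Classical in
/-- induction along a homomorphism -/
def Ind (φ : H →* G) (f : H → ℂ) : G → ℂ := fun g =>
  (Nat.card H : ℂ)⁻¹ * gs (fun x : G => gs (fun h : H => if φ h = x * g * x⁻¹ then f h else 0))

theorem Ind_isCl (φ : H →* G) (f : H → ℂ) : IsCl (Ind φ f) := by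
  classical
  intro g h
  unfold Ind
  congr 1
  rw [← gs_equiv (Equiv.mulRight h) (fun x : G => gs (fun k : H => if φ k = x * g * x⁻¹ then f k else 0))]
  apply gs_congr
  intro x
  apply gs_congr
  intro k
  have : x * (h * g * h⁻¹) * x⁻¹ = Equiv.mulRight h x * g * (Equiv.mulRight h x)⁻¹ := by
    simp only [Equiv.coe_mulRight]; group
  simp only [this]

theorem gs_ite {X : Type} [Finite X] [DecidableEq X] (a : X) (f : X → ℂ) :
    gs (fun x => if x = a then f x else 0) = f a := by
  let := Fintype.ofFinite X
  rw [gs_eq]; simp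

theorem frobenius (φ : H →* G) (f : H → ℂ) {χ : G → ℂ} (hχ : IsCl χ) :
    ip (Ind φ f) χ = ip f (fun h => χ (φ h)) := by
  classical
  unfold ip Ind
  have h1 : ∀ g : G, (Nat.card H : ℂ)⁻¹ * gs (fun x : G => gs (fun h : H => if φ h = x * g * x⁻¹ then f h else 0)) * conj (χ g)
     = (Nat.card H : ℂ)⁻¹ * gs (fun x : G => gs (fun h : H => if g = x⁻¹ * φ h * x then f h * conj (χ g) else 0)) := by
    intro g
    rw [mul_assoc, ← gs_mul_right]
    congr 1
    apply gs_congr; intro x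
    rw [← gs_mul_right]
    apply gs_congr; intro h
    have : (φ h = x * g * x⁻¹) ↔ (g = x⁻¹ * φ h * x) := by
      constructor
      · intro h; rw [h]; group
      · intro h; rw [h]; group
    simp only [this]
    split_ifs <;> simp
  rw [gs_congr h1, gs_mul, gs_comm]
  have h2 : ∀ x : G, gs (fun g : G => gs (fun h : H => if g = x⁻¹ * φ h * x then f h * conj (χ g) else 0))
     = gs (fun h : H => f h * conj (χ (φ h))) := by
    intro x
    rw [gs_comm]
    apply gs_congr; intro h
    rw [gs_ite (x⁻¹ * φ h * x) (fun g => f h * conj (χ g))]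
    have := hχ (φ h) x⁻¹
    rw [inv_inv] at this
    rw [this]
  rw [gs_congr h2, gs_const]
  have := card_ne (G := G)
  field_simp

theorem IsChar.ind {f : H → ℂ} (hf : IsChar f) (φ : H →* G) : IsChar (Ind φ f) := by
  apply isChar_of_coeff (Ind_isCl φ f)
  intro χ hχ
  rw [frobenius φ f hχ.isChar.isCl]
  exact ⟨_, hf.mlt_eq (hχ.isChar.comp φ)⟩

theorem mlt_ind {f : H → ℂ} (φ : H →* G) {χ : G → ℂ} (hχ : IsIrr χ) :
    mlt (Ind φ f) χ = mlt f (fun h => χ (φ h)) := by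
  unfold mlt
  rw [frobenius φ f hχ.isChar.isCl]

theorem Ind_one (φ : H →* G) (hφ : Function.Injective φ) (f : H → ℂ) :
    (Nat.card H : ℂ) * Ind φ f 1 = Nat.card G * f 1 := by
  classical
  unfold Ind
  have : ∀ x : G, gs (fun h : H => if φ h = x * 1 * x⁻¹ then f h else 0) = f 1 := by
    intro x
    rw [← gs_ite (1 : H) f]
    apply gs_congr; intro h
    have : φ h = x * 1 * x⁻¹ ↔ h = 1 := by simp [map_eq_one_iff φ hφ]
    simp only [this]
  rw [gs_congr this, gs_const, mul_inv_cancel_left₀ card_ne]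

theorem deg_ind {f : H → ℂ} (hf : IsChar f) (φ : H →* G) (hφ : Function.Injective φ) :
    Nat.card H * deg (Ind φ f) = Nat.card G * deg f := by
  have := Ind_one φ hφ f
  rw [(hf.ind φ).deg_eq, hf.deg_eq] at this
  exact_mod_cast this

/-- restriction of irreducible has irreducible constituents compatible -/
theorem mlt_res_trans {K : Type} [Group K] [Finite K] (φ : H →* G) (κ : K →* H) {χ : G → ℂ} (hχ : IsChar χ)
    {l : K → ℂ} (hl : IsIrr l) :
    mlt (fun k => χ (φ (κ k))) l = ∑ ψ ∈ IrrF H, mlt (fun h => χ (φ h)) ψ * mlt (fun k => ψ (κ k)) l := by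
  have hc := hχ.comp φ
  rw [((hc.comp κ).mlt_comm hl.isChar)]
  have h2 : ip l (fun k => χ (φ (κ k))) = ip (Ind κ l) (fun h => χ (φ h)) :=
    (frobenius κ l hc.isCl).symm
  have h3 : mlt l (fun k => χ (φ (κ k))) = mlt (Ind κ l) (fun h => χ (φ h)) := by
    unfold mlt; rw [h2]
  rw [h3, (hl.isChar.ind κ).mlt_expand hc]
  apply Finset.sum_congr rfl
  intro ψ hψ
  have hψ' := mem_IrrF.mp hψ
  rw [mlt_ind κ hψ', mul_comm, hl.isChar.mlt_comm (hψ'.isChar.comp κ)]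
end ind

theorem IsChar.eq_of_mlt_deg {f χ : G → ℂ} (hf : IsChar f) (hχ : IsIrr χ) (h : mlt f χ ≠ 0)
    (hd : deg f ≤ deg χ) : f = χ := by
  classical
  have h1 := hf.deg_expand
  have h2 : mlt f χ * deg χ ≤ deg f := by
    rw [h1]
    exact Finset.single_le_sum (f := fun χ => mlt f χ * deg χ) (fun _ _ => Nat.zero_le _)
      (mem_IrrF.mpr hχ)
  have h3 := hχ.deg_pos
  have h4 : mlt f χ = 1 := by
    have h5 : mlt f χ * deg χ ≤ 1 * deg χ := by omega
    have := Nat.le_of_mul_le_mul_right h5 h3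
    omega
  have h6 : deg f = deg χ := by rw [h4] at h2; omega
  rw [hf.expand]
  rw [Finset.sum_eq_single_of_mem χ (mem_IrrF.mpr hχ), h4]
  · simp
  intro ψ hψ hne
  have h7 : mlt f χ * deg χ + mlt f ψ * deg ψ ≤ deg f := by
    rw [h1, ← Finset.sum_pair (f := fun χ => mlt f χ * deg χ) hne.symm]
    apply Finset.sum_le_sum_of_subset
    intro x hx
    rcases Finset.mem_insert.mp hx with rfl | hx
    · exact mem_IrrF.mpr hχ
    · rw [Finset.mem_singleton.mp hx]; exact hψ
  have h8 := (mem_IrrF.mp hψ).deg_pos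
  have h9 : mlt f ψ * deg ψ = 0 := by rw [h4] at h7; omega
  rw [(Nat.mul_eq_zero.mp h9).resolve_right h8.ne']; simp

theorem IsChar.mlt_mul_deg_le {f χ : G → ℂ} (hf : IsChar f) (hχ : IsIrr χ) :
    mlt f χ * deg χ ≤ deg f := by
  rw [hf.deg_expand]
  exact Finset.single_le_sum (f := fun χ => mlt f χ * deg χ) (fun _ _ => Nat.zero_le _)
      (mem_IrrF.mpr hχ)

/-- a normal embedding, with the conjugation action -/
structure Nrm (L X : Type) [Group L] [Group X] where
  ι : L →* X
  inj : Function.Injective ι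
  a : X →* MulAut L
  ha : ∀ x l, ι (a x l) = x * ι l * x⁻¹

/-- subgroup version -/
def Nrm.ofSub {X : Type} [Group X] (N : Subgroup X) [N.Normal] : Nrm N X where
  ι := N.subtype
  inj := N.subtype_injective
  a := MulAut.conjNormal
  ha := by intro x l; rfl

section nrm
variable {L X : Type} [Group L] [Group X] [Finite L] [Finite X] (E : Nrm L X)

/-- restriction to an intermediate group -/
def Nrm.res (T : Subgroup X) (hT : ∀ l, E.ι l ∈ T) : Nrm L T where
  ι := E.ι.codRestrict T hT
  inj := by intro a b h; exact E.inj (congrArg Subtype.val h)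
  a := E.a.comp T.subtype
  ha := by
    intro x l
    apply Subtype.ext
    exact E.ha x l

theorem Nrm.range_normal : E.ι.range.Normal := by
  refine ⟨fun z hz g => ?_⟩
  obtain ⟨l, rfl⟩ := hz
  exact ⟨E.a g l, E.ha g l⟩

/-- stabilizer of a function -/
def Nrm.stab (θ : L → ℂ) : Subgroup X where
  carrier := {x | ∀ l, θ (E.a x l) = θ l}
  one_mem' := by intro l; simp
  mul_mem' := by
    intro x y hx hy l
    rw [map_mul, MulAut.mul_apply, hx, hy]
  inv_mem' := by
    intro x hx l
    rw [← hx (E.a x⁻¹ l), ← MulAut.mul_apply, ← map_mul]; simp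

theorem Nrm.mem_stab {θ : L → ℂ} {x : X} : x ∈ E.stab θ ↔ ∀ l, θ (E.a x l) = θ l := Iff.rfl

theorem Nrm.a_ι (l m : L) : E.a (E.ι l) m = l * m * l⁻¹ := by
  apply E.inj
  rw [E.ha]; simp

theorem Nrm.ι_mem_stab {θ : L → ℂ} (hθ : IsCl θ) (l : L) : E.ι l ∈ E.stab θ := by
  intro m
  rw [E.a_ι, hθ]

theorem Nrm.ind_res (θ : L → ℂ) (l : L) :
    Ind E.ι θ (E.ι l) = (Nat.card L : ℂ)⁻¹ * gs (fun x : X => θ (E.a x l)) := by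
  classical
  unfold Ind
  congr 1
  apply gs_congr; intro x
  rw [← gs_ite (E.a x l) θ]
  apply gs_congr; intro h
  have : E.ι h = x * E.ι l * x⁻¹ ↔ h = E.a x l := by
    rw [← E.ha]; exact E.inj.eq_iff
  simp only [this]

/-- the conjugate character -/
def Nrm.cj (x : X) (θ : L → ℂ) : L → ℂ := fun l => θ (E.a x l)

theorem Nrm.cj_irr (x : X) {θ : L → ℂ} (h : IsIrr θ) : IsIrr (E.cj x θ) :=
  h.comp_surj (φ := (E.a x).toMonoidHom) (E.a x).surjective

theorem Nrm.cj_mul (x y : X) (θ : L → ℂ) : E.cj (x * y) θ = E.cj y (E.cj x θ) := by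
  ext l; simp [Nrm.cj]

theorem Nrm.cj_eq_iff (x y : X) (θ : L → ℂ) : E.cj x θ = E.cj y θ ↔ x * y⁻¹ ∈ E.stab θ := by
  rw [E.mem_stab]
  constructor
  · intro h l
    have := congrFun h (E.a y⁻¹ l)
    simp only [Nrm.cj] at this
    rw [map_mul, MulAut.mul_apply, this, ← MulAut.mul_apply, ← map_mul]; simp
  · intro h
    ext l
    have := h (E.a y l)
    rw [← MulAut.mul_apply, ← map_mul, inv_mul_cancel_right] at this
    exact this

theorem Nrm.deg_cj (x : X) (θ : L → ℂ) : deg (E.cj x θ) = deg θ := by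
  simp [deg, Nrm.cj]

open Classical in
theorem Nrm.orbit_ip {θ φ : L → ℂ} (hθ : IsIrr θ) (hφ : IsIrr φ) :
    gs (fun x : X => ip (E.cj x θ) φ) = if ∃ x, φ = E.cj x θ then (Nat.card (E.stab θ) : ℂ) else 0 := by
  let := Fintype.ofFinite X
  split_ifs with h
  · obtain ⟨y, rfl⟩ := h
    have h1 : ∀ x : X, ip (E.cj x θ) (E.cj y θ) = if x * y⁻¹ ∈ E.stab θ then 1 else 0 := by
      intro x
      rw [ip_orth (E.cj_irr x hθ) (E.cj_irr y hθ)]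
      simp only [E.cj_eq_iff]
    rw [gs_congr h1, ← gs_equiv (Equiv.mulRight y)]
    simp only [Equiv.coe_mulRight, mul_inv_cancel_right]
    rw [gs_eq, Finset.sum_boole, Nat.card_eq_fintype_card, Fintype.card_subtype]
  · have h1 : ∀ x : X, ip (E.cj x θ) φ = 0 := by
      intro x
      rw [ip_orth (E.cj_irr x hθ) hφ, if_neg]
      intro h'
      exact h ⟨x, h'.symm⟩
    rw [gs_congr h1, gs_const, mul_zero]

theorem ip_gs_left {Y : Type} [Finite Y] (F : Y → L → ℂ) (f : L → ℂ) :
    ip (fun l => gs (fun y => F y l)) f = gs (fun y => ip (F y) f) := by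
  let := Fintype.ofFinite Y
  have := ip_sum_left (Finset.univ) F f
  rw [gs_eq, ← this]
  congr 1
  ext l
  rw [gs_eq]; simp

/-- sum of squares of ramification indices -/
theorem Nrm.sum_sq {θ : L → ℂ} (hθ : IsIrr θ) :
    (∑ χ ∈ IrrF X, mlt (fun l => χ (E.ι l)) θ ^ 2) * Nat.card L = Nat.card (E.stab θ) := by
  classical
  have h1 : ip (Ind E.ι θ) (Ind E.ι θ) = (Nat.card L : ℂ)⁻¹ * Nat.card (E.stab θ) := by
    rw [frobenius _ _ (Ind_isCl _ _), ← ip_conj]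
    have h2 : (fun h => Ind E.ι θ (E.ι h)) = (Nat.card L : ℂ)⁻¹ • (fun l => gs (fun x : X => E.cj x θ l)) := by
      ext l; rw [E.ind_res]; rfl
    rw [h2, ip_smul_left, ip_gs_left, E.orbit_ip hθ hθ, if_pos]
    · simp
    · exact ⟨1, by ext l; simp [Nrm.cj]⟩
  have h3 := hθ.isChar.ind E.ι
  rw [h3.mlt_eq h3, h3.mlt_expand h3, eq_inv_mul_iff_mul_eq₀ card_ne] at h1
  have h4 : Nat.card L * ∑ χ ∈ IrrF X, mlt (Ind E.ι θ) χ * mlt (Ind E.ι θ) χ = Nat.card (E.stab θ) := by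
    exact_mod_cast h1
  rw [← h4, mul_comm]
  congr 1
  apply Finset.sum_congr rfl
  intro χ hχ
  have hχ' := mem_IrrF.mp hχ
  rw [mlt_ind _ hχ', (hχ'.isChar.comp E.ι).mlt_comm hθ.isChar, sq]

theorem Nrm.res_cj {χ : X → ℂ} (hχ : IsCl χ) (x : X) : E.cj x (fun l => χ (E.ι l)) = fun l => χ (E.ι l) := by
  ext l
  simp only [Nrm.cj, E.ha]
  exact hχ _ _

theorem Nrm.ip_cj (x : X) (f h : L → ℂ) : ip (E.cj x f) (E.cj x h) = ip f h :=
  ip_comp_surj (φ := (E.a x).toMonoidHom) (E.a x).surjective f h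

theorem Nrm.mlt_cj {χ : X → ℂ} (hχ : IsCl χ) (x : X) (θ : L → ℂ) :
    mlt (fun l => χ (E.ι l)) (E.cj x θ) = mlt (fun l => χ (E.ι l)) θ := by
  unfold mlt
  rw [← E.ip_cj x (fun l => χ (E.ι l)) θ, E.res_cj hχ]

theorem Nrm.const_conj {χ : X → ℂ} (hχ : IsIrr χ) {θ φ : L → ℂ} (hθ : IsIrr θ) (hφ : IsIrr φ)
    (h : mlt (fun l => χ (E.ι l)) θ ≠ 0) (h' : mlt (fun l => χ (E.ι l)) φ ≠ 0) :
    ∃ x, φ = E.cj x θ := by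
  classical
  by_contra hcon
  have h1 := E.orbit_ip hθ hφ
  rw [if_neg hcon, ← ip_gs_left] at h1
  have h2 : (fun l => gs (fun x : X => E.cj x θ l)) = (Nat.card L : ℂ) • (fun h => Ind E.ι θ (E.ι h)) := by
    ext l; simp only [Pi.smul_apply]; rw [E.ind_res, smul_eq_mul, mul_inv_cancel_left₀ card_ne]; rfl
  rw [h2, ip_smul_left] at h1
  have h3 := (mul_eq_zero.mp h1).resolve_left card_ne
  have hi := hθ.isChar.ind E.ι
  have h4 : mlt (fun h => Ind E.ι θ (E.ι h)) φ = 0 := by unfold mlt; rw [h3]; simp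
  have h5 : ∑ ψ ∈ IrrF X, mlt (Ind E.ι θ) ψ * mlt (fun k => ψ (E.ι k)) φ = 0 := by
    rw [← h4]
    exact (mlt_res_trans (MonoidHom.id X) E.ι hi hφ).symm
  have h6 := Finset.sum_eq_zero_iff.mp h5 χ (mem_IrrF.mpr hχ)
  rcases Nat.mul_eq_zero.mp h6 with h7 | h7
  · rw [mlt_ind _ hχ, hθ.isChar.mlt_comm (hχ.isChar.comp E.ι)] at h7
    exact h h7
  · exact h' h7

theorem Nrm.clifford_fun {χ : X → ℂ} (hχ : IsIrr χ) {θ : L → ℂ} (hθ : IsIrr θ)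
    (h : mlt (fun l => χ (E.ι l)) θ ≠ 0) (l : L) :
    (Nat.card (E.stab θ) : ℂ) * χ (E.ι l) = mlt (fun l => χ (E.ι l)) θ * gs (fun x : X => θ (E.a x l)) := by
  classical
  set f : L → ℂ := fun l => χ (E.ι l) with hf
  have hfc : IsChar f := hχ.isChar.comp E.ι
  let F : L → ℂ := (Nat.card (E.stab θ) : ℂ) • f + (-(mlt f θ : ℂ)) • (fun l => gs (fun x : X => E.cj x θ l))
  suffices hF : F = 0 by
    have := congrFun hF l
    simp only [F, Pi.add_apply, Pi.smul_apply, smul_eq_mul, Pi.zero_apply, neg_mul] at this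
    exact eq_of_sub_eq_zero (by rw [sub_eq_add_neg]; exact this)
  apply eq_zero_of_orth
  · apply IsCl.add
    · exact hfc.isCl.smul _
    · apply IsCl.smul
      intro g k
      apply gs_congr
      intro x
      exact (E.cj_irr x hθ).isChar.isCl g k
  · intro φ hφ
    simp only [F]
    rw [ip_add_left, ip_smul_left, ip_smul_left, ip_gs_left, E.orbit_ip hθ hφ, hfc.mlt_irr hφ]
    split_ifs with h1
    · obtain ⟨x, rfl⟩ := h1
      rw [E.mlt_cj hχ.isChar.isCl]; ring
    · have : mlt f φ = 0 := by
        by_contra h2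
        exact h1 (E.const_conj hχ hθ hφ h h2)
      rw [this]; simp

theorem Nrm.clifford_deg {χ : X → ℂ} (hχ : IsIrr χ) {θ : L → ℂ} (hθ : IsIrr θ)
    (h : mlt (fun l => χ (E.ι l)) θ ≠ 0) :
    Nat.card (E.stab θ) * deg χ = mlt (fun l => χ (E.ι l)) θ * (Nat.card X * deg θ) := by
  have := E.clifford_fun hχ hθ h 1
  simp only [map_one] at this
  rw [gs_const, hχ.isChar.deg_eq, hθ.isChar.deg_eq] at this
  exact_mod_cast this

/-- every irreducible of `L` lies under one of `X` -/
theorem Nrm.exists_over {θ : L → ℂ} (hθ : IsIrr θ) :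
    ∃ χ : X → ℂ, IsIrr χ ∧ mlt (fun l => χ (E.ι l)) θ ≠ 0 := by
  by_contra hcon
  push Not at hcon
  have := E.sum_sq hθ
  rw [Finset.sum_eq_zero] at this
  · have h2 : 0 < Nat.card (E.stab θ) := Nat.card_pos
    omega
  · intro χ hχ
    rw [hcon χ (mem_IrrF.mp hχ)]; rfl

theorem Nrm.exists_under {χ : X → ℂ} (hχ : IsIrr χ) :
    ∃ θ : L → ℂ, IsIrr θ ∧ mlt (fun l => χ (E.ι l)) θ ≠ 0 := by
  apply (hχ.isChar.comp E.ι).exists_const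
  intro h
  have := congrFun h 1
  simp only [map_one] at this
  exact hχ.one_ne this

end nrm
end
end CT

open CategoryTheory
set_option linter.unusedSectionVars false
set_option linter.style.haveILetI false

namespace CT
noncomputable section
open ComplexConjugate

variable {G : Type} [Group G] [Finite G]

theorem ker_of_const {f χ : G → ℂ} (hf : IsChar f) (hχ : IsIrr χ) (hm : mlt f χ ≠ 0) {z : G}
    (hz : f z = f 1) : z ∈ kerc χ := by
  rw [hχ.mem_kerc]
  have h1 : ∑ ψ ∈ IrrF G, (mlt f ψ : ℝ) * ((deg ψ : ℝ) - (ψ z).re) = 0 := by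
    have e1 := congrArg Complex.re (congrFun hf.expand z)
    have e2 := congrArg Complex.re (congrFun hf.expand 1)
    rw [← hz, e1] at e2
    have e3 : ∀ (n : ℕ) (w : ℂ), ((n : ℂ) * w).re = n * w.re := by intro n w; simp
    simp only [Finset.sum_apply, Pi.smul_apply, smul_eq_mul, Complex.re_sum, e3] at e2
    simp only [mul_sub, Finset.sum_sub_distrib]
    rw [e2, sub_eq_zero]
    apply Finset.sum_congr rfl
    intro ψ hψ
    rw [(mem_IrrF.mp hψ).isChar.deg_eq]; simp
  have h0 : ∀ ψ ∈ IrrF G, 0 ≤ (mlt f ψ : ℝ) * ((deg ψ : ℝ) - (ψ z).re) := by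
    intro ψ hψ
    apply mul_nonneg (Nat.cast_nonneg _)
    have := (mem_IrrF.mp hψ).isChar.norm_le z
    have := Complex.re_le_norm (ψ z)
    linarith
  have h2 := (Finset.sum_eq_zero_iff_of_nonneg h0).mp h1 χ (mem_IrrF.mpr hχ)
  have h3 : (χ z).re = deg χ := by
    rcases mul_eq_zero.mp h2 with h | h
    · exact absurd (by exact_mod_cast h) hm
    · linarith
  have h4 := hχ.isChar.norm_le z
  rw [hχ.isChar.deg_eq]
  have h5 : (χ z).im = 0 := by
    have h6 : ‖χ z‖ ^ 2 = (χ z).re ^ 2 + (χ z).im ^ 2 := by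
      rw [← Complex.normSq_eq_norm_sq, Complex.normSq_apply]; ring
    rw [h3] at h6
    have : ‖χ z‖ ^ 2 ≤ (deg χ : ℝ) ^ 2 := by gcongr
    have : (χ z).im ^ 2 ≤ 0 := by linarith
    exact pow_eq_zero_iff (two_ne_zero) |>.mp (le_antisymm this (sq_nonneg _))
  apply Complex.ext
  · simpa using h3
  · simpa using h5

theorem ker_of_all_const {f : G → ℂ} (hf : IsChar f) {z : G} (h : ∀ χ, IsIrr χ → mlt f χ ≠ 0 → z ∈ kerc χ) :
    z ∈ kerc f := by
  intro g
  rw [hf.expand]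
  simp only [Finset.sum_apply, Pi.smul_apply]
  apply Finset.sum_congr rfl
  intro χ hχ
  by_cases hm : mlt f χ = 0
  · simp [hm]
  · rw [mem_kerc_def.mp (h χ (mem_IrrF.mp hχ) hm) g]

theorem conj_of_irr {x y : G} (h : ∀ χ : G → ℂ, IsIrr χ → χ x = χ y) : IsConj x y := by
  classical
  let f : G → ℂ := fun g => if IsConj x g then 1 else 0
  have hf : IsCl f := by
    intro g k
    have h1 : IsConj g (k * g * k⁻¹) := isConj_iff.mpr ⟨k, rfl⟩
    have : IsConj x (k * g * k⁻¹) ↔ IsConj x g := ⟨fun h => h.trans h1.symm, fun h => h.trans h1⟩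
    simp only [f, this]
  have h1 : f x = f y := by
    rw [hf.expand]
    simp only [Finset.sum_apply, Pi.smul_apply]
    apply Finset.sum_congr rfl
    intro χ hχ
    rw [h χ (mem_IrrF.mp hχ)]
  simp only [f, IsConj.refl, if_true] at h1
  by_contra hc
  rw [if_neg hc] at h1
  exact one_ne_zero h1

theorem eq_one_of_ker {x : G} (h : ∀ χ : G → ℂ, IsIrr χ → x ∈ kerc χ) : x = 1 := by
  have := conj_of_irr (x := x) (y := 1) (fun χ hχ => hχ.mem_kerc.mp (h χ hχ))
  exact isConj_one_left.mp this

theorem IsIrr.lin_norm {l : G → ℂ} (hl : IsIrr l) (h1 : deg l = 1) (g : G) : l g * conj (l g) = 1 := by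
  have h2 : (fun g => l g * conj (l g)) = fun _ => 1 := by
    have hc : IsChar (l * fun g => conj (l g)) := hl.isChar.mul hl.isChar.cconj
    apply IsChar.eq_of_mlt_deg hc isIrr_one
    · have : ip (l * fun g => conj (l g)) (fun _ => 1) = 1 := by
        have e := ip_irr_self hl
        unfold ip at e ⊢
        simpa using e
      unfold mlt; rw [this]; simp
    · have e := hl.isChar.deg_eq
      rw [h1] at e
      simp [deg, e]
  exact congrFun h2 g

theorem IsIrr.lin_Zc {l : G → ℂ} (hl : IsIrr l) (h1 : deg l = 1) (g : G) : g ∈ Zc l := by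
  apply hl.isChar.mem_Zc
  have := hl.lin_norm h1 g
  rw [Complex.mul_conj, Complex.normSq_eq_norm_sq] at this
  have h2 : ‖l g‖ ^ 2 = 1 := by exact_mod_cast this
  rw [h1]
  have := norm_nonneg (l g)
  have : ‖l g‖ = 1 := by nlinarith
  simpa using this

theorem IsIrr.lin_comm {l : G → ℂ} (hl : IsIrr l) (h1 : deg l = 1) (a b : G) :
    a * b * a⁻¹ * b⁻¹ ∈ kerc l := hl.comm_mem_kerc (hl.lin_Zc h1 b) a

theorem IsIrr.lin_mul {l : G → ℂ} (hl : IsIrr l) (h1 : deg l = 1) (a b : G) : l (a * b) = l a * l b := by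
  rw [hl.Zc_apply (hl.lin_Zc h1 a)]
  have e := hl.isChar.deg_eq
  rw [h1] at e
  rw [e]; simp

/-- nonabelian quotients have nonlinear characters -/
theorem exists_nonlin (K : Subgroup G) [K.Normal] {a b : G} (h : a * b * a⁻¹ * b⁻¹ ∉ K) :
    ∃ β : G → ℂ, IsIrr β ∧ K ≤ kerc β ∧ deg β ≠ 1 := by
  by_contra hcon
  push Not at hcon
  apply h
  rw [← QuotientGroup.eq_one_iff]
  apply eq_one_of_ker
  intro χ hχ
  have h1 := hχ.comp_surj (QuotientGroup.mk'_surjective K)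
  have h2 := hcon _ h1 (by
    intro k hk g
    have : (QuotientGroup.mk' K) k = 1 := (QuotientGroup.eq_one_iff k).mpr hk
    change χ (QuotientGroup.mk' K (k * g)) = χ (QuotientGroup.mk' K g)
    rw [map_mul, this, one_mul])
  rw [deg_comp] at h2
  have := hχ.lin_comm h2 (a : G ⧸ K) (b : G ⧸ K)
  simpa using this

theorem exists_lin (K : Subgroup G) [K.Normal] (hc : ∀ a b : G, a * b * a⁻¹ * b⁻¹ ∈ K) {g : G}
    (hg : g ∉ K) : ∃ l : G →* ℂ, (∀ k ∈ K, l k = 1) ∧ l g ≠ 1 := by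
  let : CommGroup (G ⧸ K) := { (inferInstance : Group (G ⧸ K)) with
    mul_comm := by
      intro x y
      induction x using QuotientGroup.induction_on with | H a => ?_
      induction y using QuotientGroup.induction_on with | H b => ?_
      have : ((a * b * a⁻¹ * b⁻¹ : G) : G ⧸ K) = 1 := (QuotientGroup.eq_one_iff _).mpr (hc a b)
      simp only [QuotientGroup.mk_mul, QuotientGroup.mk_inv] at this
      rw [mul_inv_eq_one, mul_inv_eq_iff_eq_mul] at this
      exact this }
  have hg' : (g : G ⧸ K) ≠ 1 := fun h => hg ((QuotientGroup.eq_one_iff g).mp h)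
  obtain ⟨φ, hφ⟩ := CommGroup.exists_apply_ne_one_of_hasEnoughRootsOfUnity (G ⧸ K) ℂ hg'
  refine ⟨(Units.coeHom ℂ).comp (φ.comp (QuotientGroup.mk' K)), ?_, ?_⟩
  · intro k hk
    have : (QuotientGroup.mk' K) k = 1 := (QuotientGroup.eq_one_iff k).mpr hk
    change ((φ ((QuotientGroup.mk' K) k) : ℂˣ) : ℂ) = 1
    rw [this]; simp
  · intro h
    apply hφ
    apply Units.ext
    exact h

theorem comm_mem_of_prime (K : Subgroup G) [K.Normal] {p : ℕ} (hp : p.Prime) (hi : K.index = p)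
    (a b : G) : a * b * a⁻¹ * b⁻¹ ∈ K := by
  have := Fact.mk hp
  have hcyc : IsCyclic (G ⧸ K) := isCyclic_of_prime_card (p := p) (by rw [← hi]; rfl)
  have : ∀ x y : G ⧸ K, x * y = y * x := fun x y => by
    have := hcyc.commGroup
    exact hcyc.isMulCommutative.is_comm.comm x y
  have h1 := this a b
  rw [← QuotientGroup.eq_one_iff]
  simp only [QuotientGroup.mk_mul, QuotientGroup.mk_inv]
  rw [h1]; group

theorem exists_lin_prime (K : Subgroup G) [K.Normal] {p : ℕ} (hp : p.Prime) (hi : K.index = p) :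
    ∃ l : G →* ℂ, ∀ g, (l g) ^ p = 1 ∧ (l g = 1 ↔ g ∈ K) := by
  obtain ⟨g, hg⟩ : ∃ g, g ∉ K := by
    by_contra hcon
    push Not at hcon
    have : K = ⊤ := by ext x; simp [hcon x]
    rw [this, Subgroup.index_top] at hi
    exact hp.one_lt.ne hi
  obtain ⟨l, h1, h2⟩ := exists_lin K (comm_mem_of_prime K hp hi) hg
  have h3 : K ≤ l.ker := h1
  refine ⟨l, fun x => ⟨?_, ?_, fun h => h1 x h⟩⟩
  · rw [← map_pow]
    apply h1
    rw [← hi]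
    exact Subgroup.pow_index_mem K x
  · intro hx
    have h4 := Subgroup.relIndex_mul_index h3
    rw [hi] at h4
    rcases (Nat.dvd_prime hp).mp (Dvd.intro_left _ h4) with h5 | h5
    · rw [Subgroup.index_eq_one] at h5
      have : g ∈ l.ker := by rw [h5]; trivial
      exact absurd this h2
    · rw [h5] at h4
      have h6 : K.relIndex l.ker = 1 := Nat.eq_of_mul_eq_mul_right hp.pos (by rw [h4, one_mul])
      exact Subgroup.relIndex_eq_one.mp h6 hx

section nrm
variable {L X : Type} [Group L] [Group X] [Finite L] [Finite X] (E : Nrm L X)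

theorem Nrm.gallagher {ψ β : X → ℂ} (hψ : IsIrr ψ) (hψL : IsIrr (fun l => ψ (E.ι l)))
    (hβ : IsIrr β) (hk : ∀ l, E.ι l ∈ kerc β) : IsIrr (ψ * β) := by
  classical
  apply isIrr_of_norm (hψ.isChar.mul hβ.isChar)
  have hP : IsChar (ψ * fun g => conj (ψ g)) := hψ.isChar.mul hψ.isChar.cconj
  have hQ : IsChar (β * fun g => conj (β g)) := hβ.isChar.mul hβ.isChar.cconj
  set P := ψ * fun g => conj (ψ g) with hPdef
  set Q := β * fun g => conj (β g) with hQdef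
  have h1 : ip (ψ * β) (ψ * β) = ip P Q := by
    unfold ip
    congr 1
    apply gs_congr
    intro g
    simp only [P, Q, Pi.mul_apply, map_mul, Complex.conj_conj]
    ring
  have norm1 : ∀ {Y : Type} [Group Y] [Finite Y] (f : Y → ℂ), ip (f * fun g => conj (f g)) (fun _ => 1) = ip f f := by
    intro Y _ _ f
    unfold ip
    simp
  have hP1 : mlt P (fun _ => 1) = 1 := by
    unfold mlt; rw [norm1, ip_irr_self hψ]; simp
  have hQ1 : mlt Q (fun _ => 1) = 1 := by
    unfold mlt; rw [norm1, ip_irr_self hβ]; simp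
  have hPL : mlt (fun l => P (E.ι l)) (fun _ => 1) = 1 := by
    have : (fun l => P (E.ι l)) = (fun l => ψ (E.ι l)) * fun l => conj (ψ (E.ι l)) := rfl
    unfold mlt
    rw [this, norm1 (fun l => ψ (E.ι l)), ip_irr_self hψL]; simp
  have h2 := mlt_res_trans (MonoidHom.id X) E.ι hP (isIrr_one (G := L))
  simp only [MonoidHom.id_apply] at h2
  rw [hPL] at h2
  rw [h1, hP.mlt_eq hQ, hP.mlt_expand hQ, Finset.sum_eq_single_of_mem (fun _ => 1) (mem_IrrF.mpr isIrr_one)]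
  · rw [hP1, hQ1]; simp
  intro χ hχ hne
  have hχ' := mem_IrrF.mp hχ
  by_contra h0
  have hp0 : mlt P χ ≠ 0 := fun h => h0 (by rw [h, zero_mul])
  have hq0 : mlt Q χ ≠ 0 := fun h => h0 (by rw [h, mul_zero])
  have hker : ∀ l, χ (E.ι l) = χ 1 := by
    intro l
    have := ker_of_const hQ hχ' hq0 (z := E.ι l) (by
      simp only [Q, Pi.mul_apply, hβ.mem_kerc.mp (hk l)])
    exact hχ'.mem_kerc.mp this
  have hm : mlt (fun l => χ (E.ι l)) (fun _ => 1) ≠ 0 := by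
    have : (fun l => χ (E.ι l)) = (χ 1) • (fun _ => 1) := by
      ext l; rw [hker l]; simp
    unfold mlt
    rw [this, ip_smul_left, ip_irr_self isIrr_one, hχ'.isChar.deg_eq]
    simpa using hχ'.deg_pos.ne'
  have hm1 : mlt (fun l => (fun _ : X => (1 : ℂ)) (E.ι l)) (fun _ => 1) ≠ 0 := by
    unfold mlt
    rw [ip_irr_self isIrr_one]; simp
  have h3 : mlt P (fun _ => 1) * mlt (fun l => (fun _ : X => (1 : ℂ)) (E.ι l)) (fun _ => 1)
     + mlt P χ * mlt (fun l => χ (E.ι l)) (fun _ => 1) ≤ 1 := by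
    rw [h2, ← Finset.sum_pair (f := fun χ => mlt P χ * mlt (fun l => χ (E.ι l)) (fun _ => 1)) hne.symm]
    apply Finset.sum_le_sum_of_subset
    intro x hx
    rcases Finset.mem_insert.mp hx with rfl | hx
    · exact mem_IrrF.mpr isIrr_one
    · rw [Finset.mem_singleton.mp hx]; exact hχ
  rw [hP1] at h3
  have h4 := Nat.pos_of_ne_zero (mul_ne_zero hp0 hm)
  omega

theorem Nrm.stab_res (T : Subgroup X) (hT : ∀ l, E.ι l ∈ T) (θ : L → ℂ) :
    (E.res T hT).stab θ = (E.stab θ).subgroupOf T := rfl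

/-- Clifford correspondence -/
theorem Nrm.corr {θ : L → ℂ} (hθ : IsIrr θ) {η : E.stab θ → ℂ} (hη : IsIrr η) {b : ℕ}
    (hb : mlt (fun l => η ⟨E.ι l, E.ι_mem_stab hθ.isChar.isCl l⟩) θ = b) (hb0 : b ≠ 0) :
    ∃ χ : X → ℂ, IsIrr χ ∧ mlt (fun l => χ (E.ι l)) θ = b ∧
      Nat.card (E.stab θ) * deg χ = Nat.card X * deg η := by
  let E' := E.res (E.stab θ) (E.ι_mem_stab hθ.isChar.isCl)
  have hb' : mlt (fun l => η (E'.ι l)) θ = b := hb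
  obtain ⟨χ, hχ, hm⟩ := (hη.isChar.ind (E.stab θ).subtype).exists_const (by
    intro h
    have h1 := deg_ind hη.isChar (E.stab θ).subtype (E.stab θ).subtype_injective
    rw [h] at h1
    simp only [deg, Pi.zero_apply, Complex.zero_re, Nat.floor_zero, mul_zero] at h1
    have h2 := hη.deg_pos
    have h3 : 0 < Nat.card X := Nat.card_pos
    have := Nat.mul_pos h3 h2
    unfold deg at this
    omega)
  have hm2 := hm
  rw [mlt_ind _ hχ, hη.isChar.mlt_comm (hχ.isChar.comp _)] at hm
  have h1 := mlt_res_trans (E.stab θ).subtype E'.ι hχ.isChar hθ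
  have h1' : mlt (fun k => χ ((E.stab θ).subtype (E'.ι k))) θ = mlt (fun l => χ (E.ι l)) θ := rfl
  rw [h1'] at h1
  have h2 : mlt (fun h => χ ((E.stab θ).subtype h)) η * b ≤ mlt (fun l => χ (E.ι l)) θ := by
    rw [h1, ← hb']
    exact Finset.single_le_sum (f := fun ψ => mlt (fun h => χ ((E.stab θ).subtype h)) ψ * mlt (fun k => ψ (E'.ι k)) θ)
      (fun _ _ => Nat.zero_le _) (mem_IrrF.mpr hη)
  have h3 : b ≤ mlt (fun l => χ (E.ι l)) θ :=
    le_trans (Nat.le_mul_of_pos_left b (Nat.pos_of_ne_zero hm)) h2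
  have h4 : deg χ ≤ deg (Ind (E.stab θ).subtype η) :=
    le_trans (Nat.le_mul_of_pos_left _ (Nat.pos_of_ne_zero hm2))
      ((hη.isChar.ind (E.stab θ).subtype).mlt_mul_deg_le hχ)
  have h5 := deg_ind hη.isChar (E.stab θ).subtype (E.stab θ).subtype_injective
  have h6 := E'.clifford_deg hη hθ (by rw [hb']; exact hb0)
  rw [hb'] at h6
  have h7 : Nat.card (E'.stab θ) = Nat.card (E.stab θ) := by
    have : E'.stab θ = ⊤ := by
      ext x
      simp only [Subgroup.mem_top, iff_true]
      exact x.2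
    rw [this, Subgroup.card_top]
  rw [h7] at h6
  have hTpos : 0 < Nat.card (E.stab θ) := Nat.card_pos
  have hXpos : 0 < Nat.card X := Nat.card_pos
  have h8 : deg η = b * deg θ := Nat.eq_of_mul_eq_mul_left hTpos (by rw [h6]; ring)
  have h9 := E.clifford_deg hχ hθ (by omega)
  have h10 : mlt (fun l => χ (E.ι l)) θ ≤ b := by
    have h11 : mlt (fun l => χ (E.ι l)) θ * (Nat.card X * deg θ) ≤ b * (Nat.card X * deg θ) := by
      rw [← h9]
      calc _ ≤ Nat.card (E.stab θ) * deg (Ind (E.stab θ).subtype η) := Nat.mul_le_mul_left _ h4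
        _ = _ := by rw [h5, h8]; ring
    exact Nat.le_of_mul_le_mul_right h11 (Nat.mul_pos hXpos hθ.deg_pos)
  have h12 := le_antisymm h10 h3
  refine ⟨χ, hχ, h12, ?_⟩
  rw [h9, h12, h8]; ring

/-- extensions to the stabilizer -/
theorem Nrm.ext_stab {θ : L → ℂ} (hθ : IsIrr θ) {χ : X → ℂ} (hχ : IsIrr χ)
    (h : mlt (fun l => χ (E.ι l)) θ = 1) : ∃ ψ : E.stab θ → ℂ, IsIrr ψ ∧
      (fun l => ψ ⟨E.ι l, E.ι_mem_stab hθ.isChar.isCl l⟩) = θ := by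
  let E' := E.res (E.stab θ) (E.ι_mem_stab hθ.isChar.isCl)
  have h1 := mlt_res_trans (E.stab θ).subtype E'.ι hχ.isChar hθ
  have h1' : mlt (fun k => χ ((E.stab θ).subtype (E'.ι k))) θ = 1 := h
  rw [h1'] at h1
  obtain ⟨ψ, hψ, hne⟩ := Finset.exists_ne_zero_of_sum_ne_zero (h1 ▸ one_ne_zero)
  have hψ' := mem_IrrF.mp hψ
  have h2 : mlt (fun h => χ ((E.stab θ).subtype h)) ψ * mlt (fun k => ψ (E'.ι k)) θ ≤ 1 := by
    rw [h1]
    exact Finset.single_le_sum (f := fun ψ => mlt (fun h => χ ((E.stab θ).subtype h)) ψ * mlt (fun k => ψ (E'.ι k)) θ)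
      (fun _ _ => Nat.zero_le _) hψ
  have h3 : mlt (fun k => ψ (E'.ι k)) θ = 1 := by
    have : mlt (fun h => χ ((E.stab θ).subtype h)) ψ * mlt (fun k => ψ (E'.ι k)) θ = 1 := by omega
    exact Nat.dvd_one.mp (Dvd.intro_left _ this)
  refine ⟨ψ, hψ', ?_⟩
  have h6 := E'.clifford_deg hψ' hθ (by omega)
  have h7 : Nat.card (E'.stab θ) = Nat.card (E.stab θ) := by
    have : E'.stab θ = ⊤ := by
      ext x
      simp only [Subgroup.mem_top, iff_true]
      exact x.2
    rw [this, Subgroup.card_top]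
  rw [h3, h7, one_mul] at h6
  have h8 := Nat.eq_of_mul_eq_mul_left Nat.card_pos h6
  apply IsChar.eq_of_mlt_deg (hψ'.isChar.comp E'.ι) hθ (by omega)
  rw [deg_comp, h8]

/-- the GAL lemma -/
theorem Nrm.gal {θ : L → ℂ} (hθ : IsIrr θ) {χ : X → ℂ} (hχ : IsIrr χ)
    (h : mlt (fun l => χ (E.ι l)) θ = 1) {β : E.stab θ → ℂ} (hβ : IsIrr β)
    (hk : ∀ l, (⟨E.ι l, E.ι_mem_stab hθ.isChar.isCl l⟩ : E.stab θ) ∈ kerc β) :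
    ∃ χ' : X → ℂ, IsIrr χ' ∧ mlt (fun l => χ' (E.ι l)) θ = deg β ∧ deg χ' = deg χ * deg β := by
  obtain ⟨ψ, hψ, hψL⟩ := E.ext_stab hθ hχ h
  have h1 := (E.res _ (E.ι_mem_stab hθ.isChar.isCl)).gallagher hψ (by
    change IsIrr (fun l => ψ ⟨E.ι l, E.ι_mem_stab hθ.isChar.isCl l⟩)
    rw [hψL]; exact hθ) hβ hk
  have h2 : (fun l => (ψ * β) ⟨E.ι l, E.ι_mem_stab hθ.isChar.isCl l⟩) = (deg β : ℂ) • θ := by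
    ext l
    have hl : ψ ⟨E.ι l, E.ι_mem_stab hθ.isChar.isCl l⟩ = θ l := congrFun hψL l
    simp only [Pi.mul_apply, Pi.smul_apply, smul_eq_mul]
    rw [hl, hβ.mem_kerc.mp (hk l), hβ.isChar.deg_eq, mul_comm]
  obtain ⟨χ', h3, h4, h5⟩ := E.corr hθ h1 (b := deg β) (by
    rw [h2]; unfold mlt
    rw [ip_smul_left, ip_irr_self hθ]; simp) hβ.deg_pos.ne'
  refine ⟨χ', h3, h4, ?_⟩
  have h6 := E.clifford_deg hχ hθ (by omega)
  have h7 := E.clifford_deg h3 hθ (by rw [h4]; exact hβ.deg_pos.ne')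
  rw [h] at h6
  rw [h4] at h7
  have hp : 0 < Nat.card (E.stab θ) := Nat.card_pos
  apply Nat.eq_of_mul_eq_mul_left hp
  calc _ = deg β * (Nat.card X * deg θ) := h7
    _ = (Nat.card (E.stab θ) * deg χ) * deg β := by rw [h6]; ring
    _ = _ := by ring

theorem Nrm.gs_range (F : X → ℂ) (hF : ∀ x, x ∉ E.ι.range → F x = 0) : gs F = gs (fun l => F (E.ι l)) := by
  classical
  let := Fintype.ofFinite X
  let := Fintype.ofFinite L
  rw [gs_eq, gs_eq]
  change _ = ∑ x, F ((⟨E.ι, E.inj⟩ : L ↪ X) x)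
  rw [← Finset.sum_map Finset.univ ⟨E.ι, E.inj⟩ F]
  symm
  apply Finset.sum_subset (Finset.subset_univ _)
  intro x _ hx
  apply hF
  rintro ⟨l, rfl⟩
  apply hx
  simp

theorem Nrm.index_eq {p : ℕ} (h : Nat.card X = p * Nat.card L) : E.ι.range.index = p := by
  have h1 := Subgroup.card_mul_index E.ι.range
  have h2 : Nat.card E.ι.range = Nat.card L := Nat.card_congr (MonoidHom.ofInjective E.inj).toEquiv.symm
  rw [h2, h, mul_comm] at h1
  exact Nat.eq_of_mul_eq_mul_right Nat.card_pos h1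

/-- prime index dichotomy -/
theorem Nrm.prime_index {p : ℕ} (hp : p.Prime) (h : Nat.card X = p * Nat.card L) {χ : X → ℂ} (hχ : IsIrr χ) :
    IsIrr (fun l => χ (E.ι l)) ∨ ∀ x, x ∉ E.ι.range → χ x = 0 := by
  have := E.range_normal
  obtain ⟨l, hl⟩ := exists_lin_prime E.ι.range hp (E.index_eq h)
  by_cases hv : ∀ x, x ∉ E.ι.range → χ x = 0
  · exact Or.inr hv
  left
  push Not at hv
  obtain ⟨x, hx, hx0⟩ := hv
  apply isIrr_of_norm (hχ.isChar.comp E.ι)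
  have hlirr : ∀ i : ℕ, IsIrr (fun g => (l g) ^ i) := fun i => isIrr_lin (l ^ i)
  have hldeg : ∀ i : ℕ, deg (fun g => (l g) ^ i) = 1 := fun i => by simp [deg]
  have h1 : ∀ i ∈ Finset.range p, i ≠ 0 → ip (χ * fun g => (l g) ^ i) χ = 0 := by
    intro i hi hi0
    apply ip_irr_ne (hχ.mul_lin (hlirr i) (hldeg i)) hχ
    intro he
    have h2 := congrFun he x
    simp only [Pi.mul_apply] at h2
    have h3 : l x ^ i = 1 := mul_left_cancel₀ hx0 (by rw [h2, mul_one])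
    have h4 := (hl x).1
    have h5 : orderOf (l x) ∣ 1 := by
      have hcop : Nat.Coprime i p := by
        rw [Nat.coprime_comm, hp.coprime_iff_not_dvd]
        intro hd
        have := Nat.le_of_dvd (Nat.pos_of_ne_zero hi0) hd
        have := Finset.mem_range.mp hi
        omega
      rw [← hcop]
      exact Nat.dvd_gcd (orderOf_dvd_of_pow_eq_one h3) (orderOf_dvd_of_pow_eq_one h4)
    have h6 : l x = 1 := by
      rw [← orderOf_eq_one_iff]; exact Nat.dvd_one.mp h5
    exact hx ((hl x).2.mp h6)
  have h2 : ∑ i ∈ Finset.range p, ip (χ * fun g => (l g) ^ i) χ = 1 := by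
    rw [Finset.sum_eq_single_of_mem 0 (Finset.mem_range.mpr hp.pos) h1]
    have : (χ * fun g => (l g) ^ 0) = χ := by ext; simp
    rw [this, ip_irr_self hχ]
  rw [← h2, ← ip_sum_left]
  have h3 : ∀ g, (∑ i ∈ Finset.range p, χ * fun g => (l g) ^ i) g = χ g * ∑ i ∈ Finset.range p, (l g) ^ i := by
    intro g
    simp [Finset.mul_sum]
  unfold ip
  rw [E.gs_range (fun g => (∑ i ∈ Finset.range p, χ * fun g => (l g) ^ i) g * conj (χ g)), h]
  · have h4 : ∀ k, (∑ i ∈ Finset.range p, χ * fun g => (l g) ^ i) (E.ι k) * conj (χ (E.ι k))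
       = p * (χ (E.ι k) * conj (χ (E.ι k))) := by
      intro k
      rw [h3, (hl (E.ι k)).2.mpr ⟨k, rfl⟩]
      simp; ring
    rw [gs_congr h4, gs_mul]
    have h5 : (p : ℂ) ≠ 0 := by exact_mod_cast hp.ne_zero
    have := card_ne (G := L)
    push_cast
    field_simp
  · intro g hg
    rw [h3]
    have h4 : l g ≠ 1 := fun h => hg ((hl g).2.mp h)
    rw [geom_sum_eq h4, (hl g).1]; simp

/-- extension of invariant characters, prime index -/
theorem Nrm.prime_ext {p : ℕ} (hp : p.Prime) (h : Nat.card X = p * Nat.card L) {θ : L → ℂ} (hθ : IsIrr θ)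
    (hst : E.stab θ = ⊤) : ∃ χ : X → ℂ, IsIrr χ ∧ ∀ l, χ (E.ι l) = θ l := by
  obtain ⟨χ, hχ, hm⟩ := E.exists_over hθ
  have hcl : ∀ l, χ (E.ι l) = mlt (fun l => χ (E.ι l)) θ * θ l := by
    intro l
    have h1 := E.clifford_fun hχ hθ hm l
    have h2 : ∀ x : X, θ (E.a x l) = θ l := fun x => by
      have : x ∈ E.stab θ := by rw [hst]; trivial
      exact this l
    rw [gs_congr h2, gs_const, hst, Subgroup.card_top] at h1
    apply mul_left_cancel₀ (card_ne (G := X))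
    rw [h1]; ring
  set e := mlt (fun l => χ (E.ι l)) θ
  have hip : ip (fun l => χ (E.ι l)) (fun l => χ (E.ι l)) = (e ^ 2 : ℕ) := by
    have : (fun l => χ (E.ι l)) = (e : ℂ) • θ := funext hcl
    rw [this, ip_smul_left, ip_smul_right, ip_irr_self hθ]
    simp [sq]
  rcases E.prime_index hp h hχ with h1 | h1
  · refine ⟨χ, hχ, fun l => ?_⟩
    have h2 := h1.eq_of_mlt hθ hm
    exact congrFun h2 l
  · exfalso
    have h2 := ip_irr_self hχ
    unfold ip at h2 hip
    rw [E.gs_range (fun g => χ g * conj (χ g)) (by intro x hx; rw [h1 x hx, zero_mul])] at h2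
    rw [inv_mul_eq_iff_eq_mul₀ card_ne] at h2 hip
    rw [hip, h] at h2
    have h3 : Nat.card L * e ^ 2 = p * Nat.card L := by
      simp only [mul_one] at h2
      exact_mod_cast h2
    have h4 : e ^ 2 = p := Nat.eq_of_mul_eq_mul_left (Nat.card_pos (α := L)) (by rw [h3, mul_comm])
    exact hp.not_isSquare ⟨e, by rw [← h4, sq]⟩

end nrm
end
end CT

open CategoryTheory
set_option linter.unusedSectionVars false
set_option linter.style.haveILetI false

namespace CT
noncomputable section
open ComplexConjugate

variable {G : Type} [Group G] [Finite G]


theorem cube_norm {v : ℂ} (h3 : v ^ 3 = 1) (h1 : v ≠ 1) (a b c : ℕ) :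
    ((a : ℂ) + b * v + c * v ^ 2) * conj ((a : ℂ) + b * v + c * v ^ 2)
      = (((a : ℤ) ^ 2 + b ^ 2 + c ^ 2 - a * b - b * c - a * c : ℤ) : ℂ) := by
  have hn : ‖v‖ = 1 := by
    have : ‖v‖ ^ 3 = 1 := by rw [← norm_pow, h3, norm_one]
    exact (pow_eq_one_iff_of_nonneg (norm_nonneg v) (by norm_num)).mp this
  have hc : v * conj v = 1 := by
    rw [Complex.mul_conj, Complex.normSq_eq_norm_sq, hn]; simp
  have hv : v ^ 2 + v + 1 = 0 := by
    have : (v - 1) * (v ^ 2 + v + 1) = 0 := by ring_nf; rw [h3]; ring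
    exact (mul_eq_zero.mp this).resolve_left (sub_ne_zero.mpr h1)
  have hcv : conj v = v ^ 2 := by
    have h : v * v ^ 2 = 1 := by rw [← h3]; ring
    exact mul_left_cancel₀ (fun h0 => by simp [h0] at h3) (hc.trans h.symm)
  simp only [map_add, map_mul, map_pow, map_natCast, hcv]
  push_cast
  linear_combination ((a : ℂ) * b + a * c + b * c) * hv + ((a : ℂ) * c * v + (b : ℂ) ^ 2 + b * c * (v ^ 2 + v)
    + (c : ℂ) ^ 2 * (v ^ 3 + 1)) * h3

theorem Nrm.ip_range {L X : Type} [Group L] [Group X] [Finite L] [Finite X] (E : Nrm L X) {p : ℕ} (hp : p ≠ 0)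
    (h : Nat.card X = p * Nat.card L) (f f' : X → ℂ) (hf : ∀ x, x ∉ E.ι.range → f x = 0) :
    ip f f' * p = ip (fun l => f (E.ι l)) (fun l => f' (E.ι l)) := by
  unfold ip
  rw [E.gs_range (fun g => f g * conj (f' g)) (fun x hx => by rw [hf x hx, zero_mul]), h]
  have := card_ne (G := L)
  have h5 : (p : ℂ) ≠ 0 := by exact_mod_cast hp
  push_cast
  field_simp

section lemC
variable {L X : Type} [Group L] [Group X] [Finite L] [Finite X] (E : Nrm L X)

open Classical in
theorem Nrm.lemC {θ : L → ℂ} (hθ : IsIrr θ) (B : Subgroup X) (hLB : ∀ l, E.ι l ∈ B)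
    (hB : Nat.card B = 3 * Nat.card L) (hst : B ≤ E.stab θ) (c : X) (hcB : c ∈ B) (hc : c ∉ E.ι.range)
    (hcen : ∀ x, x * c * x⁻¹ * c⁻¹ ∈ E.ι.range → x ∈ B) :
    ((IrrF X).filter (fun χ => ¬ 3 ∣ mlt (fun l => χ (E.ι l)) θ)).card ≤ 3 := by
  have hnX := E.range_normal
  let E' := E.res B hLB
  have hn := E'.range_normal
  have hr : ∀ b : B, b ∈ E'.ι.range ↔ (b : X) ∈ E.ι.range := by
    intro b
    constructor
    · rintro ⟨l, rfl⟩; exact ⟨l, rfl⟩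
    · rintro ⟨l, hl⟩; exact ⟨l, Subtype.ext hl⟩
  have hidx := E'.index_eq hB
  obtain ⟨α, hα, hαθ⟩ := E'.prime_ext (by norm_num : Nat.Prime 3) hB hθ (by
    ext x
    simp only [Subgroup.mem_top, iff_true]
    exact hst x.2)
  obtain ⟨l, hl⟩ := exists_lin_prime E'.ι.range (by norm_num : Nat.Prime 3) hidx
  let c' : B := ⟨c, hcB⟩
  have hc' : c' ∉ E'.ι.range := fun h => hc ((hr _).mp h)
  set w := l c' with hw
  have hw3 : w ^ 3 = 1 := (hl c').1
  have hw1 : w ≠ 1 := fun h => hc' ((hl c').2.mp h)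
  have hw0 : w ≠ 0 := fun h => by simp [h] at hw3
  have hl0 : ∀ b, l b ≠ 0 := fun b h => by have := (hl b).1; simp [h] at this
  let A : ℕ → B → ℂ := fun i => α * fun b => (l b) ^ i
  have hA : ∀ i, IsIrr (A i) := fun i => hα.mul_lin (isIrr_lin (l ^ i)) (by simp [deg])
  -- value on the coset c nonzero somewhere: distinctness through norms
  let β : B → ℂ := ∑ i ∈ Finset.range 3, (w⁻¹) ^ i • A i
  have hβ : ∀ b, β b = α b * ∑ i ∈ Finset.range 3, (w⁻¹ * l b) ^ i := by
    intro b
    simp only [β, A, Finset.sum_apply, Pi.smul_apply, Pi.mul_apply, smul_eq_mul, Finset.mul_sum]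
    apply Finset.sum_congr rfl
    intro i _
    rw [mul_pow]; ring
  have hlc : ∀ b : B, l b = w ↔ (b : X) * c⁻¹ ∈ E.ι.range := by
    intro b
    have h1 := (hl (b * c'⁻¹)).2
    rw [hr] at h1
    have h2 : ((b * c'⁻¹ : B) : X) = b * c⁻¹ := rfl
    rw [← h2, ← h1, map_mul]
    have h3 : l c'⁻¹ * w = 1 := by rw [hw, ← map_mul]; simp
    constructor
    · intro h; rw [h, mul_comm, h3]
    · intro h
      have h4 : l b * l c'⁻¹ * w = w := by rw [h, one_mul]
      rw [mul_assoc, h3, mul_one] at h4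
      exact h4
  have hβ1 : ∀ b : B, l b = w → β b = 3 * α b := by
    intro b hb
    rw [hβ, hb, inv_mul_cancel₀ hw0]
    simp; ring
  have hβ0 : ∀ b : B, l b ≠ w → β b = 0 := by
    intro b hb
    rw [hβ]
    have h4 : w⁻¹ * l b ≠ 1 := by
      intro h
      apply hb
      rw [inv_mul_eq_one₀ hw0] at h
      exact h.symm
    rw [geom_sum_eq h4, mul_pow, inv_pow, hw3, (hl b).1]; simp
  let F := Ind B.subtype β
  have hβcl : IsCl β := IsCl.sum _ (fun i _ => (hA i).isChar.isCl.smul _)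
  have hF : ∀ b : B, l b = w → F b = β b := by
    intro b hb
    simp only [F, Ind]
    have hx : ∀ x : X, gs (fun h : B => if B.subtype h = x * b * x⁻¹ then β h else 0) = if x ∈ B then β b else 0 := by
      intro x
      split_ifs with hxB
      · have := gs_ite (⟨x, hxB⟩ * b * ⟨x, hxB⟩⁻¹) β
        rw [hβcl] at this
        rw [← this]
        apply gs_congr
        intro h
        have : B.subtype h = x * b * x⁻¹ ↔ h = ⟨x, hxB⟩ * b * ⟨x, hxB⟩⁻¹ := by
          rw [Subtype.ext_iff]; rfl
        simp only [this]
      · have : ∀ h : B, (if B.subtype h = x * b * x⁻¹ then β h else 0) = 0 := by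
          intro h
          split_ifs with h1
          · apply hβ0
            intro h2
            apply hxB
            apply hcen
            rw [hlc] at h2 hb
            rw [show (h : X) = x * b * x⁻¹ from h1] at h2
            have h3 : x * c * x⁻¹ * c⁻¹ = (x * (b * c⁻¹)⁻¹ * x⁻¹) * (x * b * x⁻¹ * c⁻¹) := by group
            rw [h3]
            exact E.ι.range.mul_mem (hnX.conj_mem _ (inv_mem hb) x) h2
          · rfl
        rw [gs_congr this, gs_const, mul_zero]
    rw [gs_congr hx]
    have h5 : gs (fun x : X => if x ∈ B then β b else 0) = Nat.card B * β b := by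
      let := Fintype.ofFinite X
      rw [gs_eq, ← Finset.sum_filter, Finset.sum_const, nsmul_eq_mul, Nat.card_eq_fintype_card, Fintype.card_subtype]
    rw [h5, inv_mul_cancel_left₀ card_ne]
  have hcoef : ∀ f : B → ℂ, ip β f = ∑ i ∈ Finset.range 3, (w⁻¹) ^ i * ip (A i) f := by
    intro f
    simp only [β]
    rw [ip_sum_left]
    simp only [ip_smul_left]
  have hsum1 : ∀ f : B → ℂ, ∑ i ∈ Finset.range 3, ip (A i) f = ip θ (fun k => f (E'.ι k)) := by
    intro f
    have h1 : ∀ b, (∑ i ∈ Finset.range 3, A i) b = α b * ∑ i ∈ Finset.range 3, (l b) ^ i := by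
      intro b
      simp only [A, Finset.sum_apply, Pi.mul_apply, Finset.mul_sum]
    rw [← ip_sum_left]
    have h2 := E'.ip_range (p := 3) (by norm_num) hB (∑ i ∈ Finset.range 3, A i) f (by
      intro b hb
      rw [h1, geom_sum_eq (fun h => hb ((hl b).2.mp h)), (hl b).1]; simp)
    have h3 : (fun k => (∑ i ∈ Finset.range 3, A i) (E'.ι k)) = (3 : ℂ) • θ := by
      ext k
      rw [h1, (hl (E'.ι k)).2.mpr ⟨k, rfl⟩, hαθ]
      simp; ring
    rw [h3, ip_smul_left] at h2
    push_cast at h2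
    linear_combination h2 / 3
  -- norm of F
  have hFF : ip F F = 3 := by
    have h1 : ip F F = ip β β := by
      simp only [F]
      rw [frobenius _ _ (Ind_isCl _ _)]
      unfold ip
      congr 1
      apply gs_congr
      intro b
      by_cases hb : l b = w
      · have := hF b hb
        simp only [F] at this
        simp only [Subgroup.subtype_apply, this]
      · rw [hβ0 b hb]; simp
    rw [h1, hcoef]
    have h2 : ∀ i ∈ Finset.range 3, (w⁻¹) ^ i * ip (A i) β = 1 := by
      intro i hi
      have h3 := hcoef (A i)
      have h5 : ∀ j ∈ Finset.range 3, j ≠ i → ip (A j) (A i) = 0 := by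
        intro j hj hne
        by_contra h0
        have h6 := hsum1 (A i)
        have h7 : (fun k => A i (E'.ι k)) = θ := by
          ext k
          simp only [A, Pi.mul_apply]
          rw [(hl (E'.ι k)).2.mpr ⟨k, rfl⟩, hαθ]
          simp
        rw [h7, ip_irr_self hθ] at h6
        have h8 : ∑ j ∈ Finset.range 3, mlt (A j) (A i) = 1 := by
          have : ∀ j ∈ Finset.range 3, ip (A j) (A i) = mlt (A j) (A i) :=
            fun j _ => (hA j).isChar.mlt_irr (hA i)
          rw [Finset.sum_congr rfl this] at h6
          exact_mod_cast h6
        have h9 : mlt (A j) (A i) ≠ 0 := by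
          intro h
          rw [(hA j).isChar.mlt_irr (hA i), h] at h0
          simp at h0
        have h10 : mlt (A i) (A i) = 1 := (hA i).mlt_self
        have h11 : mlt (A j) (A i) + mlt (A i) (A i) ≤ 1 := by
          rw [← h8, ← Finset.sum_pair (f := fun j => mlt (A j) (A i)) hne]
          apply Finset.sum_le_sum_of_subset
          intro x hx
          rcases Finset.mem_insert.mp hx with rfl | hx
          · exact hj
          · rw [Finset.mem_singleton.mp hx]; exact hi
        omega
      rw [Finset.sum_eq_single_of_mem i hi (fun j hj hne => by rw [h5 j hj hne, mul_zero]), ip_irr_self (hA i),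
        mul_one] at h3
      rw [← ip_conj, h3, map_pow, ← mul_pow, Complex.mul_conj, Complex.normSq_eq_norm_sq, norm_inv]
      have hn : ‖w‖ = 1 := by
        have : ‖w‖ ^ 3 = 1 := by rw [← norm_pow, hw3, norm_one]
        exact (pow_eq_one_iff_of_nonneg (norm_nonneg w) (by norm_num)).mp this
      rw [hn]; simp
    rw [Finset.sum_congr rfl h2]; simp
  have hv3 : (w⁻¹) ^ 3 = 1 := by rw [inv_pow, hw3, inv_one]
  have hv1 : w⁻¹ ≠ 1 := fun h => hw1 (inv_eq_one.mp h)
  have hq : ∀ χ ∈ IrrF X, ∃ q : ℕ, ip F χ * ip χ F = q ∧ (¬ 3 ∣ mlt (fun l => χ (E.ι l)) θ → q ≠ 0) := by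
    intro χ hχ
    have hχ' := mem_IrrF.mp hχ
    have hχB := hχ'.isChar.comp B.subtype
    have hm : ∀ i, ip (A i) (fun h => χ (B.subtype h)) = mlt (A i) (fun h => χ (B.subtype h)) :=
      fun i => (hA i).isChar.mlt_eq hχB
    have h1 := hcoef (fun h => χ (B.subtype h))
    have h2 := hsum1 (fun h => χ (B.subtype h))
    have h3 : ip θ (fun k => χ (B.subtype (E'.ι k))) = mlt (fun l => χ (E.ι l)) θ := by
      rw [hθ.isChar.mlt_eq (hχB.comp E'.ι), hθ.isChar.mlt_comm (hχB.comp E'.ι)]; rfl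
    rw [h3] at h2
    simp only [Finset.sum_range_succ, Finset.sum_range_zero, zero_add, hm, pow_zero, one_mul, pow_one] at h1 h2
    set a := mlt (A 0) (fun h => χ (B.subtype h))
    set b := mlt (A 1) (fun h => χ (B.subtype h))
    set d := mlt (A 2) (fun h => χ (B.subtype h))
    have h2' : a + b + d = mlt (fun l => χ (E.ι l)) θ := by exact_mod_cast h2
    have h4 : ip F χ = a + b * w⁻¹ + d * (w⁻¹) ^ 2 := by
      simp only [F]
      rw [frobenius _ _ hχ'.isChar.isCl, h1]; ring
    have h5 : (0 : ℤ) ≤ (a : ℤ) ^ 2 + b ^ 2 + d ^ 2 - a * b - b * d - a * d := by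
      nlinarith [sq_nonneg ((a : ℤ) - b), sq_nonneg ((b : ℤ) - d), sq_nonneg ((a : ℤ) - d)]
    refine ⟨((a : ℤ) ^ 2 + b ^ 2 + d ^ 2 - a * b - b * d - a * d).toNat, ?_, ?_⟩
    · rw [← ip_conj F χ, h4, cube_norm hv3 hv1]
      have h6 := Int.toNat_of_nonneg h5
      have h7 := congrArg (Int.cast : ℤ → ℂ) h6
      rw [← h7, Int.cast_natCast]
    · intro h6 h7
      apply h6
      rw [← h2']
      have h8 : (a : ℤ) ^ 2 + b ^ 2 + d ^ 2 - a * b - b * d - a * d = 0 := by omega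
      have h9 : ((a : ℤ) - b) ^ 2 = 0 := by
        nlinarith [sq_nonneg ((a : ℤ) - b), sq_nonneg ((b : ℤ) - d), sq_nonneg ((a : ℤ) - d)]
      have h10 : ((b : ℤ) - d) ^ 2 = 0 := by
        nlinarith [sq_nonneg ((a : ℤ) - b), sq_nonneg ((b : ℤ) - d), sq_nonneg ((a : ℤ) - d)]
      have h11 := pow_eq_zero_iff (two_ne_zero) |>.mp h9
      have h12 := pow_eq_zero_iff (two_ne_zero) |>.mp h10
      omega
  choose! q hq1 hq2 using hq
  have h1 : ∑ χ ∈ IrrF X, q χ = 3 := by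
    have h2 := (Ind_isCl B.subtype β).ip_expand (h := F)
    change ip F F = _ at h2
    have h3 : ∀ χ ∈ IrrF X, ip (Ind B.subtype β) χ * ip χ F = q χ := hq1
    rw [hFF, Finset.sum_congr rfl h3] at h2
    exact_mod_cast h2.symm
  refine le_trans ?_ h1.le
  rw [Finset.card_eq_sum_ones, Finset.sum_filter]
  apply Finset.sum_le_sum
  intro χ hχ
  split_ifs with h
  · exact Nat.zero_le _
  · exact Nat.one_le_iff_ne_zero.mpr (hq2 χ hχ h)
end lemC

end
end CT

open CategoryTheory
set_option linter.unusedSectionVars false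
set_option linter.style.haveILetI false

namespace CT
noncomputable section
open ComplexConjugate

variable {G : Type} [Group G] [Finite G]


theorem gs_inj {Y Z : Type} [Finite Y] [Finite Z] (φ : Y → Z) (hφ : Function.Injective φ) (F : Z → ℂ)
    (hF : ∀ z, z ∉ Set.range φ → F z = 0) : gs F = gs (fun y => F (φ y)) := by
  classical
  let := Fintype.ofFinite Y
  let := Fintype.ofFinite Z
  rw [gs_eq, gs_eq]
  change _ = ∑ x, F ((⟨φ, hφ⟩ : Y ↪ Z) x)
  rw [← Finset.sum_map Finset.univ ⟨φ, hφ⟩ F]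
  symm
  apply Finset.sum_subset (Finset.subset_univ _)
  intro x _ hx
  apply hF
  rintro ⟨l, rfl⟩
  apply hx
  simp

/-- the intersection of `U` with a conjugate -/
def Dm (U : Subgroup G) (m : G) : Subgroup G := U ⊓ U.comap (MulAut.conj m).toMonoidHom

theorem mem_Dm {U : Subgroup G} {m d : G} : d ∈ Dm U m ↔ d ∈ U ∧ m * d * m⁻¹ ∈ U := Iff.rfl

def Dm1 (U : Subgroup G) (m : G) : Dm U m →* U := Subgroup.inclusion inf_le_left

def Dm2 (U : Subgroup G) (m : G) : Dm U m →* U :=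
  ((MulAut.conj m).toMonoidHom.comp (Dm U m).subtype).codRestrict U (fun d => d.2.2)

open Classical in
theorem lem8 (U : Subgroup G) {α : U → ℂ} (hα : IsIrr α) (d : ℕ) (hd : ∀ m, m ∉ U → Nat.card (Dm U m) = d)
    (hd2 : d * (Nat.card G - Nat.card U) = Nat.card U ^ 2)
    (hi1 : ∀ m, m ∉ U → IsIrr (fun x => α (Dm1 U m x))) (hi2 : ∀ m, m ∉ U → IsIrr (fun x => α (Dm2 U m x)))
    (hm : ∃ m, m ∉ U ∧ (fun x => α (Dm1 U m x)) ≠ (fun x => α (Dm2 U m x))) :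
    IsIrr (Ind U.subtype α) := by
  have hI := hα.isChar.ind U.subtype
  let := Fintype.ofFinite G
  apply isIrr_of_mlt hI
  let ε : G → ℕ := fun m => if (fun x => α (Dm1 U m x)) = (fun x => α (Dm2 U m x)) then 1 else 0
  have hUU : ∀ m ∈ U, Nat.card (Dm U m) = Nat.card U := by
    intro m hm
    have : Dm U m = U := by
      ext x
      rw [mem_Dm]
      exact ⟨fun h => h.1, fun h => ⟨h, U.mul_mem (U.mul_mem hm h) (U.inv_mem hm)⟩⟩
    rw [this]
  have hJ : ∀ m : G, gs (fun u : U => α u * conj (gs (fun h : U => if U.subtype h = m * u * m⁻¹ then α h else 0)))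
      = ((Nat.card (Dm U m) * ε m : ℕ) : ℂ) := by
    intro m
    have h1 : gs (fun u : U => α u * conj (gs (fun h : U => if U.subtype h = m * u * m⁻¹ then α h else 0)))
        = gs (fun x : Dm U m => α (Dm1 U m x) * conj (α (Dm2 U m x))) := by
      have hinj : Function.Injective (Dm1 U m) := Subgroup.inclusion_injective _
      rw [gs_inj (Dm1 U m) hinj]
      · apply gs_congr
        intro x
        rw [← gs_ite (Dm2 U m x) α]
        congr 2
        apply gs_congr
        intro h
        have : h = Dm2 U m x ↔ U.subtype h = m * (Dm1 U m x) * m⁻¹ := by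
          rw [Subtype.ext_iff]; rfl
        simp only [this]
      intro u hu
      have : ∀ h : U, (if U.subtype h = m * u * m⁻¹ then α h else 0) = 0 := by
        intro h
        split_ifs with h3
        · exfalso
          apply hu
          exact ⟨⟨u, u.2, by change m * u * m⁻¹ ∈ U; rw [← h3]; exact h.2⟩, rfl⟩
        · rfl
      rw [gs_congr this, gs_const]; simp
    rw [h1]
    by_cases hmU : m ∈ U
    · have h2 : (fun x => α (Dm1 U m x)) = (fun x => α (Dm2 U m x)) := by
        ext x
        have : Dm2 U m x = ⟨m, hmU⟩ * Dm1 U m x * ⟨m, hmU⟩⁻¹ := rfl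
        rw [this, hα.isChar.isCl]
      simp only [ε, if_pos h2]
      have h3 : ∀ x, α (Dm2 U m x) = α (Dm1 U m x) := fun x => (congrFun h2 x).symm
      simp only [h3]
      have h5 : Function.Surjective (Dm1 U m) := by
        intro u
        exact ⟨⟨u, u.2, U.mul_mem (U.mul_mem hmU u.2) (U.inv_mem hmU)⟩, rfl⟩
      have h4 := ip_comp_surj h5 α α
      rw [ip_irr_self hα] at h4
      unfold ip at h4
      rw [inv_mul_eq_iff_eq_mul₀ card_ne] at h4
      rw [h4]; simp
    · have h4 := ip_orth (hi1 m hmU) (hi2 m hmU)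
      unfold ip at h4
      rw [inv_mul_eq_iff_eq_mul₀ card_ne] at h4
      rw [h4]
      simp only [ε]
      split_ifs <;> simp
  have h1 : mlt (Ind U.subtype α) (Ind U.subtype α) * Nat.card U ^ 2 = ∑ m, Nat.card (Dm U m) * ε m := by
    have h2 := hI.mlt_eq hI
    rw [frobenius _ _ hI.isCl] at h2
    have h3 : ∀ u : U, α u * conj (Ind U.subtype α (U.subtype u)) = (Nat.card U : ℂ)⁻¹ *
        gs (fun m : G => α u * conj (gs (fun h : U => if U.subtype h = m * u * m⁻¹ then α h else 0))) := by
      intro u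
      unfold Ind
      rw [map_mul, gs_conj, gs_mul]
      simp only [map_inv₀, map_natCast, Subgroup.subtype_apply]
      rw [mul_left_comm]
      congr!
    unfold ip at h2
    rw [gs_congr h3, gs_mul, gs_comm, gs_congr hJ, gs_eq] at h2
    have h0 := card_ne (G := U)
    have h4 : ((mlt (Ind U.subtype α) (Ind U.subtype α) * Nat.card U ^ 2 : ℕ) : ℂ) = ((∑ m, Nat.card (Dm U m) * ε m : ℕ) : ℂ) := by
      push_cast at h2 ⊢
      rw [← h2]
      field_simp
    exact_mod_cast h4
  have h2 : ∑ m, Nat.card (Dm U m) * ε m < ∑ m, Nat.card (Dm U m) := by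
    obtain ⟨m, hmU, hne⟩ := hm
    apply Finset.sum_lt_sum
    · intro i _
      simp only [ε]
      split_ifs <;> simp
    · refine ⟨m, Finset.mem_univ _, ?_⟩
      simp only [ε, if_neg hne, mul_zero]
      exact Nat.card_pos
  have h3 : ∑ m, Nat.card (Dm U m) = 2 * Nat.card U ^ 2 := by
    rw [← Finset.sum_filter_add_sum_filter_not Finset.univ (fun m => m ∈ U)]
    rw [Finset.sum_congr rfl (g := fun _ => Nat.card U) (fun x hx => hUU x (Finset.mem_filter.mp hx).2),
      Finset.sum_congr (s₁ := Finset.univ.filter (fun m => m ∉ U)) rfl (g := fun _ => d) (fun x hx => hd x (Finset.mem_filter.mp hx).2)]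
    have h4 : (Finset.univ.filter (fun m => m ∈ U)).card = Nat.card U := by
      rw [Nat.card_eq_fintype_card, Fintype.card_subtype]
    have h5 := Finset.card_filter_add_card_filter_not (s := (Finset.univ : Finset G)) (fun m => m ∈ U)
    rw [h4, Finset.card_univ, ← Nat.card_eq_fintype_card] at h5
    have h6 : (Finset.univ.filter (fun m => m ∉ U)).card = Nat.card G - Nat.card U := by omega
    rw [Finset.sum_const, Finset.sum_const, h4, h6, smul_eq_mul, smul_eq_mul, mul_comm _ d, hd2]; ring
  rw [h3, ← h1] at h2
  have h4 : 0 < Nat.card U ^ 2 := by have : 0 < Nat.card U := Nat.card_pos; positivity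
  have h5 : mlt (Ind U.subtype α) (Ind U.subtype α) < 2 := lt_of_mul_lt_mul_right h2 (Nat.zero_le _)
  have h6 : mlt (Ind U.subtype α) (Ind U.subtype α) ≠ 0 := by
    intro h
    have h7 := hI.mlt_eq hI
    rw [h, Nat.cast_zero] at h7
    have h8 := ip_self_eq_zero h7
    have h9 := deg_ind hα.isChar U.subtype U.subtype_injective
    rw [h8] at h9
    have h10 : deg (0 : G → ℂ) = 0 := by simp [deg]
    rw [h10, mul_zero] at h9
    have := Nat.mul_pos (Nat.card_pos (α := G)) hα.deg_pos
    omega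
  omega

end
end CT

open CategoryTheory
set_option linter.unusedSectionVars false
set_option linter.style.haveILetI false

namespace CT
noncomputable section
open ComplexConjugate

variable {G : Type} [Group G] [Finite G]


instance fact7 : Fact (Nat.Prime 7) := ⟨by norm_num⟩

theorem sylow_eq_of_card {p : ℕ} [Fact p.Prime] (P : Sylow p G) (Q : Subgroup G) (hQ : IsPGroup p Q)
    (hc : Nat.card Q = Nat.card P) (hn : Q ≤ Subgroup.normalizer (P : Set G)) : Q = P := by
  have h1 := hQ.inf_normalizer_sylow P
  rw [inf_eq_left.mpr hn] at h1
  have h2 : Q ≤ P := by rw [h1]; exact inf_le_right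
  exact Subgroup.eq_of_le_of_card_ge h2 hc.ge

theorem orbit_seven (h8 : Nat.card (Sylow 7 G) = 8) (P : Sylow 7 G) (hP : Nat.card P = 7) {Q : Sylow 7 G} (hQ : Q ≠ P) :
    ∀ R : Sylow 7 G, R ≠ P → ∃ u : P, u • Q = R := by
  have h1 : ∀ u : P, u • P = P := by
    intro u
    have : (u : G) ∈ Subgroup.normalizer (P : Set G) := Subgroup.le_normalizer u.2
    exact Sylow.smul_eq_iff_mem_normalizer.mpr this
  have h2 : MulAction.orbit P Q ⊆ {P}ᶜ := by
    rintro R ⟨u, rfl⟩ h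
    simp only [Set.mem_singleton_iff] at h
    apply hQ
    rw [← inv_smul_smul u Q]
    rw [h, h1]
  have h3 : (MulAction.orbit P Q).ncard = 7 := by
    have h4 := MulAction.index_stabilizer P Q
    have h5 : (MulAction.stabilizer P Q).index ∣ 7 :=
      (Subgroup.index_dvd_card (MulAction.stabilizer P Q)).trans (dvd_of_eq hP)
    rw [← h4]
    rcases (Nat.dvd_prime (by norm_num)).mp h5 with h6 | h6
    · exfalso
      rw [Subgroup.index_eq_one] at h6
      apply hQ
      apply Sylow.ext
      symm
      apply sylow_eq_of_card
      · exact P.isPGroup'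
      · exact Nat.card_congr (Sylow.equiv P Q).toEquiv
      · intro u hu
        have : (⟨u, hu⟩ : P) ∈ MulAction.stabilizer P Q := by rw [h6]; trivial
        exact Sylow.smul_eq_iff_mem_normalizer.mp this
    · exact h6
  have h4 : MulAction.orbit P Q = {P}ᶜ := by
    apply Set.eq_of_subset_of_ncard_le h2
    rw [h3, Set.ncard_compl, Set.ncard_singleton, h8]
  intro R hR
  have : R ∈ MulAction.orbit P Q := by rw [h4]; exact hR
  exact this

theorem Dm_seven (h8 : Nat.card (Sylow 7 G) = 8) (P : Sylow 7 G) (hP : Nat.card P = 7) {m : G}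
    (hm : m ∉ Subgroup.normalizer (P : Set G)) :
    Nat.card (Dm (Subgroup.normalizer (P : Set G)) m) * 7 = Nat.card (Subgroup.normalizer (P : Set G)) := by
  set U := Subgroup.normalizer (P : Set G) with hU
  let Q := m⁻¹ • P
  have hQ : Q ≠ P := by
    intro h
    have : m⁻¹ ∈ U := Sylow.smul_eq_iff_mem_normalizer.mp h
    exact hm (by simpa using U.inv_mem this)
  have h1 : (Dm U m).subgroupOf U = MulAction.stabilizer U Q := by
    ext d
    rw [Subgroup.mem_subgroupOf, mem_Dm, MulAction.mem_stabilizer_iff]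
    have : d • Q = Q ↔ (m * d * m⁻¹) • P = P := by
      constructor
      · intro h
        have h' : (d : G) • (m⁻¹ • P) = m⁻¹ • P := h
        rw [mul_smul, mul_smul, h', smul_inv_smul]
      · intro h
        rw [mul_smul, mul_smul, smul_eq_iff_eq_inv_smul] at h
        exact h
    rw [this, Sylow.smul_eq_iff_mem_normalizer]
    exact ⟨fun h => h.2, fun h => ⟨d.2, h⟩⟩
  have h2 : MulAction.orbit U Q = {P}ᶜ := by
    ext R
    constructor
    · rintro ⟨u, rfl⟩ h
      simp only [Set.mem_singleton_iff] at h
      have h1 : u • P = P := Sylow.smul_eq_iff_mem_normalizer.mpr u.2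
      apply hQ
      rw [← inv_smul_smul u Q, h]
      rw [inv_smul_eq_iff, h1]
    · intro h
      obtain ⟨u, hu⟩ := orbit_seven h8 P hP hQ R h
      exact ⟨⟨u, Subgroup.le_normalizer u.2⟩, hu⟩
  have h3 := MulAction.index_stabilizer U Q
  rw [h2, Set.ncard_compl, Set.ncard_singleton, h8, ← h1] at h3
  have h4 := Subgroup.card_mul_index ((Dm U m).subgroupOf U)
  rw [h3] at h4
  rw [← h4]
  congr 1
  exact Nat.card_congr (Subgroup.subgroupOfEquivOfLe (inf_le_left : Dm U m ≤ U)).toEquiv.symm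

theorem orbit_free (h8 : Nat.card (Sylow 7 G) = 8) (P : Sylow 7 G) (hP : Nat.card P = 7) {Q : Sylow 7 G} (hQ : Q ≠ P)
    {u v : P} (h : u • Q = v • Q) : u = v := by
  have h1 : Function.Surjective (fun u : P => (⟨u • Q, by
      intro h'
      have h1 : u • P = P := Sylow.smul_eq_iff_mem_normalizer.mpr (Subgroup.le_normalizer u.2)
      apply hQ
      rw [← inv_smul_smul u Q, h', inv_smul_eq_iff, h1]⟩ : {R : Sylow 7 G // R ≠ P})) := by
    rintro ⟨R, hR⟩
    obtain ⟨u, hu⟩ := orbit_seven h8 P hP hQ R hR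
    exact ⟨u, Subtype.ext hu⟩
  have h2 : Nat.card {R : Sylow 7 G // R ≠ P} = 7 := by
    have : Nat.card (({P} : Set (Sylow 7 G))ᶜ : Set _) = 7 := by
      rw [Nat.card_coe_set_eq, Set.ncard_compl, Set.ncard_singleton, h8]
    exact this
  have h3 := (Nat.bijective_iff_surjective_and_card _).mpr ⟨h1, by rw [h2]; exact hP⟩
  exact h3.1 (Subtype.ext h)

theorem cent_free (h8 : Nat.card (Sylow 7 G) = 8) (P : Sylow 7 G) (hP : Nat.card P = 7) {Q : Sylow 7 G} (hQ : Q ≠ P)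
    {y : G} (hy : ∀ u ∈ P, y * u = u * y) (hyQ : y • Q = Q) (R : Sylow 7 G) : y • R = R := by
  by_cases hR : R = P
  · rw [hR]
    apply Sylow.smul_eq_iff_mem_normalizer.mpr
    refine Subgroup.mem_normalizer_iff.mpr ?_
    intro u
    constructor
    · intro hu
      rw [hy u hu]; simpa using hu
    · intro hu
      have := hy _ hu
      have h2 : y * u * y⁻¹ = u := by
        have h3 : y⁻¹ * (y * (y * u * y⁻¹)) = y⁻¹ * (y * u * y⁻¹ * y) := by rw [this]
        simpa [mul_assoc] using h3
      rwa [h2] at hu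
  · obtain ⟨u, rfl⟩ := orbit_seven h8 P hP hQ R hR
    change y • (u : G) • Q = (u : G) • Q
    rw [← mul_smul, hy u u.2, mul_smul, hyQ]

section simple
variable {S : Type} [Group S] [Finite S] [IsSimpleGroup S]

theorem fac168 : Nat.factorization 168 7 = 1 ∧ Nat.factorization 168 3 = 1 ∧ Nat.factorization 168 2 = 3 := by
  have : (168 : ℕ) = 2 ^ 3 * 3 ^ 1 * 7 ^ 1 := by norm_num
  rw [this, Nat.factorization_mul (by norm_num) (by norm_num), Nat.factorization_mul (by norm_num) (by norm_num),
    Nat.Prime.factorization_pow (by norm_num), Nat.Prime.factorization_pow (by norm_num),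
    Nat.Prime.factorization_pow (by norm_num)]
  simp

theorem index_ge (hS : Nat.card S = 168) {H : Subgroup S} (hH : H ≠ ⊤) : 168 ∣ (H.index).factorial := by
  have h1 : (MulAction.toPermHom S (S ⧸ H)).ker = ⊥ := by
    rw [← Subgroup.normalCore_eq_ker]
    rcases (inferInstance : H.normalCore.Normal).eq_bot_or_eq_top with h | h
    · exact h
    · exfalso
      apply hH
      rw [eq_top_iff, ← h]
      exact Subgroup.normalCore_le H
  have h2 := Subgroup.card_dvd_of_injective _ ((MonoidHom.ker_eq_bot_iff _).mp h1)
  rw [hS, Nat.card_perm] at h2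
  exact h2

theorem no_normal (hS : Nat.card S = 168) {H : Subgroup S} (h1 : Nat.card H ≠ 1) (h2 : Nat.card H ≠ 168) : ¬ H.Normal := by
  intro h
  rcases h.eq_bot_or_eq_top with h | h
  · rw [h] at h1; simp at h1
  · rw [h, Subgroup.card_top] at h2; exact h2 hS

theorem card_P7 (hS : Nat.card S = 168) (P : Sylow 7 S) : Nat.card P = 7 := by
  rw [P.card_eq_multiplicity, hS, fac168.1]; norm_num

theorem n7 (hS : Nat.card S = 168) : Nat.card (Sylow 7 S) = 8 := by
  let P : Sylow 7 S := default
  have h1 := P.card_dvd_index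
  have h2 := Subgroup.card_mul_index (P : Subgroup S)
  rw [card_P7 hS P, hS] at h2
  have h3 : (P : Subgroup S).index = 24 := by omega
  rw [h3] at h1
  have h4 := card_sylow_modEq_one 7 S
  have h5 : Nat.card (Sylow 7 S) ≤ 24 := Nat.le_of_dvd (by norm_num) h1
  have h6 : Nat.card (Sylow 7 S) ≠ 1 := by
    intro h
    rw [P.card_eq_index_normalizer, Subgroup.index_eq_one] at h
    replace h := Subgroup.normalizer_eq_top_iff.mp h
    exact no_normal hS (by rw [card_P7 hS P]; norm_num) (by rw [card_P7 hS P]; norm_num) h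
  generalize Nat.card (Sylow 7 S) = n at *
  unfold Nat.ModEq at h4
  interval_cases n <;> omega

theorem card_N7 (hS : Nat.card S = 168) (P : Sylow 7 S) : Nat.card (Subgroup.normalizer (P : Set S)) = 21 := by
  have h1 := Subgroup.card_mul_index (Subgroup.normalizer (P : Set S))
  rw [← P.card_eq_index_normalizer, n7 hS, hS] at h1
  omega

theorem Dm_S (hS : Nat.card S = 168) (P : Sylow 7 S) {m : S} (hm : m ∉ Subgroup.normalizer (P : Set S)) :
    Nat.card (Dm (Subgroup.normalizer (P : Set S)) m) = 3 := by
  have := Dm_seven (n7 hS) P (card_P7 hS P) hm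
  rw [card_N7 hS] at this
  omega

theorem not_comm (hS : Nat.card S = 168) : commutator S = ⊤ := by
  rcases (inferInstance : (commutator S).Normal).eq_bot_or_eq_top with h | h
  · exfalso
    let P : Sylow 7 S := default
    refine no_normal hS (H := P) (by rw [card_P7 hS P]; norm_num) (by rw [card_P7 hS P]; norm_num) ⟨?_⟩
    intro n hn g
    have : g * n * g⁻¹ * n⁻¹ ∈ commutator S := Subgroup.commutator_mem_commutator (Subgroup.mem_top g) (Subgroup.mem_top n)
    rw [h, Subgroup.mem_bot, mul_inv_eq_one] at this
    rw [this]; exact hn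
  · exact h

theorem sub7 (hS : Nat.card S = 168) {H : Subgroup S} (h7 : 7 ∣ Nat.card H) : H = ⊤ ∨ Nat.card H = 7 ∨ Nat.card H = 21 := by
  obtain ⟨x, hx⟩ := exists_prime_orderOf_dvd_card' 7 h7
  have hR : Nat.card (Subgroup.zpowers (x : S)) = 7 := by
    rw [Nat.card_zpowers, Subgroup.orderOf_coe, hx]
  let P : Sylow 7 S := Sylow.ofCard (Subgroup.zpowers (x : S)) (by rw [hR, hS, fac168.1]; norm_num)
  have hPH : (P : Subgroup S) ≤ H := by
    change Subgroup.zpowers (x : S) ≤ H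
    rw [Subgroup.zpowers_le]; exact x.2
  have hd : Nat.card H ∣ 168 := hS ▸ Subgroup.card_subgroup_dvd_card H
  by_cases hN : H ≤ Subgroup.normalizer (P : Set S)
  · right
    have h1 := Subgroup.card_dvd_of_le hN
    rw [card_N7 hS] at h1
    obtain ⟨k, hk⟩ := h7
    rw [hk] at h1
    have : k ∣ 3 := Nat.dvd_of_mul_dvd_mul_left (by norm_num : 0 < 7) h1
    rcases (Nat.dvd_prime (by norm_num)).mp this with rfl | rfl
    · left; omega
    · right; omega
  · left
    -- H moves P, hence is transitive on the eight Sylow subgroups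
    have h1 : Function.Surjective (fun h : H => h • P) := by
      obtain ⟨h, hh, hhn⟩ := Set.not_subset.mp hN
      have h2 : h • P ≠ P := fun h' => hhn (Sylow.smul_eq_iff_mem_normalizer.mp h')
      intro R
      by_cases hR : R = P
      · exact ⟨1, by simp [hR]⟩
      · obtain ⟨u, hu⟩ := orbit_seven (n7 hS) P (card_P7 hS P) h2 R hR
        refine ⟨⟨u * h, H.mul_mem (hPH u.2) hh⟩, ?_⟩
        simp only
        rw [← hu]
        exact mul_smul (u : S) h P
    have h2 : MulAction.orbit H P = Set.univ := by
      ext R; simp only [Set.mem_univ, iff_true]; exact h1 R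
    have h3 := MulAction.index_stabilizer H P
    rw [h2, Set.ncard_univ, n7 hS] at h3
    have h4 : 8 ∣ Nat.card H := h3 ▸ Subgroup.index_dvd_card _
    have h5 : 56 ∣ Nat.card H := by
      have := Nat.Coprime.mul_dvd_of_dvd_of_dvd (by norm_num : Nat.Coprime 7 8) h7 h4
      exact this
    by_contra hT
    have h6 := index_ge hS hT
    have h7 := Subgroup.card_mul_index H
    rw [hS] at h7
    obtain ⟨k, hk⟩ := h5
    rw [hk] at h7
    have h8 : k * H.index = 3 := by
      have : 56 * (k * H.index) = 56 * 3 := by rw [← mul_assoc, h7]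
      exact Nat.eq_of_mul_eq_mul_left (by norm_num) this
    have h9 : H.index ∣ 3 := Dvd.intro_left _ h8
    rcases (Nat.dvd_prime (by norm_num)).mp h9 with h | h
    · rw [h] at h6; norm_num [Nat.factorial] at h6
    · rw [h] at h6; norm_num [Nat.factorial] at h6

theorem syl_faith (hS : Nat.card S = 168) {y : S} (hy : ∀ R : Sylow 7 S, y • R = R) : y = 1 := by
  have h1 : (MulAction.toPermHom S (Sylow 7 S)).ker = ⊥ := by
    rcases (inferInstance : (MulAction.toPermHom S (Sylow 7 S)).ker.Normal).eq_bot_or_eq_top with h | h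
    · exact h
    · exfalso
      let P : Sylow 7 S := default
      have h2 : (⊤ : Subgroup S) ≤ Subgroup.normalizer (P : Set S) := by
        intro y _
        have : y ∈ (MulAction.toPermHom S (Sylow 7 S)).ker := by rw [h]; trivial
        rw [MonoidHom.mem_ker] at this
        exact Sylow.smul_eq_iff_mem_normalizer.mp (congrArg (fun σ => σ P) this)
      have h3 := Subgroup.card_dvd_of_le h2
      rw [card_N7 hS, Subgroup.card_top, hS] at h3
      norm_num at h3
  have : y ∈ (MulAction.toPermHom S (Sylow 7 S)).ker := by
    rw [MonoidHom.mem_ker]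
    ext R : 1
    exact hy R
  rwa [h1, Subgroup.mem_bot] at this

theorem fix2 (hS : Nat.card S = 168) {c : S} (hc : c ≠ 1) {P Q R : Sylow 7 S} (hQP : Q ≠ P)
    (hP : c • P = P) (hQ : c • Q = Q) (hR : c • R = R) : R = P ∨ R = Q := by
  by_contra! hh
  obtain ⟨u, hu⟩ := orbit_seven (n7 hS) P (card_P7 hS P) hQP R hh.1
  have hn : c ∈ Subgroup.normalizer (P : Set S) := Sylow.smul_eq_iff_mem_normalizer.mp hP
  have h1 : c * u * c⁻¹ ∈ P := (Subgroup.mem_normalizer_iff.mp hn u).mp u.2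
  have h2 : (⟨c * u * c⁻¹, h1⟩ : P) • Q = u • Q := by
    change (c * u * c⁻¹) • Q = u • Q
    have h3 : c⁻¹ • Q = Q := by rw [inv_smul_eq_iff, hQ]
    rw [mul_smul, mul_smul, h3]
    change c • (u • Q) = u • Q
    rw [hu, hR]
  have h3 := orbit_free (n7 hS) P (card_P7 hS P) hQP h2
  have h4 : c * u = u * c := by
    have := congrArg Subtype.val h3
    simp only at this
    rw [mul_inv_eq_iff_eq_mul] at this
    exact this
  have hu1 : u ≠ 1 := by
    rintro rfl
    rw [one_smul] at hu
    exact hh.2 hu.symm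
  have h5 : Subgroup.zpowers u = ⊤ := by
    have h7 : (Subgroup.zpowers u).index ∣ 7 := (Subgroup.index_dvd_card _).trans (dvd_of_eq (card_P7 hS P))
    have h8 := Subgroup.card_mul_index (Subgroup.zpowers u)
    have h9 : Nat.card P = 7 := card_P7 hS P
    have h8' : Nat.card (Subgroup.zpowers u) * (Subgroup.zpowers u).index = 7 := h8.trans h9
    rcases (Nat.dvd_prime (by norm_num)).mp h7 with h | h
    · exact Subgroup.index_eq_one.mp h
    · exfalso
      rw [h, Nat.card_zpowers] at h8'
      apply hu1
      rw [← orderOf_eq_one_iff]; omega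
  refine hc (syl_faith hS (cent_free (n7 hS) P (card_P7 hS P) hQP ?_ hQ))
  intro v hv
  have h6 : (⟨v, hv⟩ : P) ∈ Subgroup.zpowers u := by rw [h5]; trivial
  obtain ⟨k, hk⟩ := Subgroup.mem_zpowers_iff.mp h6
  have h7 : v = (u : S) ^ k := by
    have := congrArg Subtype.val hk
    simpa using this.symm
  rw [h7]
  exact (show Commute c (u : S) from h4).zpow_right k

instance fact3 : Fact (Nat.Prime 3) := ⟨by norm_num⟩

theorem transfer_contra (hS : Nat.card S = 168) {p : ℕ} [Fact p.Prime] (P : Sylow p S) (h1 : Nat.card P ≠ 1) (h2 : Nat.card P ≠ 168)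
    (hn : Subgroup.normalizer (P : Set S) ≤ Subgroup.centralizer (P : Set S)) : False := by
  have h3 := MonoidHom.ker_transferSylow_isComplement' P hn
  have h4 := h3.card_mul_card
  rw [hS] at h4
  rcases (inferInstance : (MonoidHom.transferSylow P hn).ker.Normal).eq_bot_or_eq_top with h | h
  · rw [h] at h4
    simp at h4
    exact h2 h4
  · rw [h, Subgroup.card_top, hS] at h4
    have : Nat.card P = 1 := by
      have h5 : 168 * Nat.card P = 168 := h4
      omega
    exact h1 this

theorem cent3 (hS : Nat.card S = 168) {c : S} (hc : orderOf c = 3) :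
    Nat.card (Subgroup.centralizer ({c} : Set S)) = 3 ∧ ∃ m, m * c * m⁻¹ = c⁻¹ := by
  have hc1 : c ≠ 1 := by rintro rfl; simp at hc
  have hZ : Nat.card (Subgroup.zpowers c) = 3 := by rw [Nat.card_zpowers, hc]
  let T : Sylow 3 S := Sylow.ofCard (Subgroup.zpowers c) (by rw [hZ, hS, fac168.2.1]; norm_num)
  have hT : (T : Subgroup S) = Subgroup.zpowers c := rfl
  have hTc : Nat.card T = 3 := hZ
  have hcT : c ∈ (T : Subgroup S) := by rw [hT]; exact Subgroup.mem_zpowers c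
  -- two fixed points
  obtain ⟨P, Q, hQP, hP, hQ⟩ : ∃ P Q : Sylow 7 S, Q ≠ P ∧ c • P = P ∧ c • Q = Q := by
    have h1 := T.isPGroup'.card_modEq_card_fixedPoints (Sylow 7 S)
    rw [n7 hS] at h1
    have h2 : 1 < (MulAction.fixedPoints T (Sylow 7 S)).ncard := by
      have h3 : 8 ≡ (MulAction.fixedPoints T (Sylow 7 S)).ncard [MOD 3] := h1
      unfold Nat.ModEq at h3
      omega
    obtain ⟨P, hP⟩ := Set.nonempty_of_ncard_ne_zero (by omega : (MulAction.fixedPoints T (Sylow 7 S)).ncard ≠ 0)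
    obtain ⟨Q, hQ, hne'⟩ := Set.exists_ne_of_one_lt_ncard h2 P
    have hne := hne'.symm
    exact ⟨P, Q, hne.symm, hP ⟨c, hcT⟩, hQ ⟨c, hcT⟩⟩
  -- normalizer has order at most 6
  have hN : ∀ n ∈ Subgroup.normalizer (T : Set S), ∀ R : Sylow 7 S, c • R = R → c • (n • R) = n • R := by
    intro n hn R hR
    have h1 : n⁻¹ * c * n ∈ (T : Subgroup S) := by
      have := (Subgroup.mem_normalizer_iff.mp (Subgroup.inv_mem _ hn) c).mp hcT
      simpa using this
    rw [hT] at h1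
    obtain ⟨k, hk⟩ := Subgroup.mem_zpowers_iff.mp h1
    have h2 : c ∈ MulAction.stabilizer S R := hR
    have h3 : (c ^ k) • R = R := Subgroup.zpow_mem _ h2 k
    rw [hk, mul_smul, mul_smul, inv_smul_eq_iff] at h3
    exact h3
  have hm : ∃ m : S, m⁻¹ • P = Q := by
    obtain ⟨g, hg⟩ := MulAction.exists_smul_eq S P Q
    exact ⟨g⁻¹, by simpa using hg⟩
  obtain ⟨m, hm⟩ := hm
  have hmU : m ∉ Subgroup.normalizer (P : Set S) := by
    intro h
    have := Sylow.smul_eq_iff_mem_normalizer.mpr (Subgroup.inv_mem _ h)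
    rw [hm] at this
    exact hQP this
  set Nn := Subgroup.normalizer (T : Set S) with hNn
  have hst : Nat.card (MulAction.stabilizer Nn P) ≤ 3 := by
    rw [← Dm_S hS P hmU]
    refine Nat.card_le_card_of_injective (fun n => ⟨n.1.1, ?_⟩) ?_
    · rw [mem_Dm]
      have h1 : (n.1.1 : S) • P = P := n.2
      refine ⟨Sylow.smul_eq_iff_mem_normalizer.mp h1, Sylow.smul_eq_iff_mem_normalizer.mp ?_⟩
      have h2 : (n.1.1 : S) • Q = Q := by
        rcases fix2 hS hc1 hQP hP hQ (hN n.1.1 n.1.2 Q hQ) with h | h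
        · exfalso
          apply hQP
          exact smul_left_cancel _ (h.trans h1.symm)
        · exact h
      rw [mul_smul, mul_smul, hm, h2, ← hm, smul_inv_smul]
    · intro a b hab
      simp only [Subtype.mk.injEq] at hab
      exact Subtype.ext (Subtype.ext hab)
  have horb : (MulAction.orbit Nn P).ncard ≤ 2 := by
    have : MulAction.orbit Nn P ⊆ {P, Q} := by
      rintro R ⟨n, rfl⟩
      exact fix2 hS hc1 hQP hP hQ (hN n.1 n.2 P hP)
    refine (Set.ncard_le_ncard this).trans ?_
    exact (Set.ncard_insert_le _ _).trans (by rw [Set.ncard_singleton])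
  have h6 : Nat.card Nn ≤ 6 := by
    have h1 := MulAction.index_stabilizer Nn P
    have h2 := Subgroup.card_mul_index (MulAction.stabilizer Nn P)
    rw [← h2, h1]
    calc _ ≤ 3 * 2 := Nat.mul_le_mul hst horb
      _ = 6 := by norm_num
  have hTN : Subgroup.zpowers c ≤ Nn := by
    rw [← hT]; exact Subgroup.le_normalizer
  have h3N : 3 ∣ Nat.card Nn := hZ ▸ Subgroup.card_dvd_of_le hTN
  have h66 : Nat.card Nn = 6 := by
    have h1 := Subgroup.card_mul_index Nn
    have h2 := card_sylow_modEq_one 3 S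
    rw [T.card_eq_index_normalizer] at h2
    change Nn.index ≡ 1 [MOD 3] at h2
    rw [hS] at h1
    unfold Nat.ModEq at h2
    have h5 : 0 < Nat.card Nn := Nat.card_pos
    generalize Nat.card Nn = n at *
    interval_cases n <;> omega
  set C := Subgroup.centralizer ({c} : Set S) with hC
  have hCN : C ≤ Nn := by
    intro z hz
    have hzc : c * z = z * c := by
      have := Subgroup.mem_centralizer_iff.mp hz c rfl
      exact this
    have : ∀ k : ℤ, z * c ^ k * z⁻¹ = c ^ k := by
      intro k
      rw [mul_inv_eq_iff_eq_mul]
      exact ((show Commute c z from hzc).zpow_left k).symm.eq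
    refine Subgroup.mem_normalizer_iff.mpr ?_
    intro w
    change w ∈ (T : Subgroup S) ↔ z * w * z⁻¹ ∈ (T : Subgroup S)
    rw [hT]
    constructor
    · intro hw
      obtain ⟨k, rfl⟩ := Subgroup.mem_zpowers_iff.mp hw
      rw [this]; exact hw
    · intro hw
      obtain ⟨k, hk⟩ := Subgroup.mem_zpowers_iff.mp hw
      have : w = c ^ k := by
        have h2 := this k
        rw [hk] at h2
        rw [hk]
        have h3 : z⁻¹ * (z * (z * w * z⁻¹) * z⁻¹) * z = z⁻¹ * (z * w * z⁻¹) * z := by rw [h2]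
        have h4 : z * w * z⁻¹ = w := by simpa [mul_assoc] using h3
        exact h4.symm
      rw [this]; exact Subgroup.mem_zpowers_iff.mpr ⟨k, rfl⟩
  have hZC : Subgroup.zpowers c ≤ C := by
    rw [Subgroup.zpowers_le, hC, Subgroup.mem_centralizer_iff]
    intro h hh
    rw [Set.mem_singleton_iff.mp hh]
  have hne : ¬ Nn ≤ C := by
    intro hle
    refine transfer_contra hS T (by rw [hTc]; norm_num) (by rw [hTc]; norm_num) ?_
    intro n hn
    rw [Subgroup.mem_centralizer_iff]
    intro w hw
    have hw' : w ∈ (T : Subgroup S) := hw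
    rw [hT] at hw'
    obtain ⟨k, rfl⟩ := Subgroup.mem_zpowers_iff.mp hw'
    have h1 : c * n = n * c := Subgroup.mem_centralizer_iff.mp (hle hn) c rfl
    exact ((show Commute c n from h1).zpow_left k).eq
  constructor
  · have h1 : 3 ∣ Nat.card C := hZ ▸ Subgroup.card_dvd_of_le hZC
    have h2 : Nat.card C ∣ 6 := h66 ▸ Subgroup.card_dvd_of_le hCN
    have h3 : Nat.card C ≠ 6 := by
      intro h
      have := Subgroup.eq_of_le_of_card_ge hCN (by rw [h, h66])
      exact hne this.ge
    have h4 := Nat.le_of_dvd (by norm_num) h2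
    have h5 : 0 < Nat.card C := Nat.card_pos
    omega
  · classical
    obtain ⟨n, hn, hnC⟩ := Set.not_subset.mp hne
    refine ⟨n, ?_⟩
    have h1 : n * c * n⁻¹ ∈ (T : Subgroup S) := (Subgroup.mem_normalizer_iff.mp hn c).mp hcT
    rw [hT] at h1
    rw [mem_zpowers_iff_mem_range_orderOf, hc] at h1
    obtain ⟨k, hk, hk2⟩ := Finset.mem_image.mp h1
    rw [Finset.mem_range] at hk
    interval_cases k
    · exfalso
      rw [pow_zero] at hk2
      apply hc1
      have := hk2.symm
      rw [conj_eq_one_iff] at this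
      exact this
    · exfalso
      apply hnC
      rw [pow_one] at hk2
      change n ∈ C
      rw [hC, Subgroup.mem_centralizer_iff]
      intro h hh
      rw [Set.mem_singleton_iff.mp hh]
      have := hk2.symm
      rw [mul_inv_eq_iff_eq_mul] at this
      exact this.symm
    · rw [← hk2, eq_inv_iff_mul_eq_one, ← pow_succ]
      change c ^ 3 = 1
      rw [← hc, pow_orderOf_eq_one]

theorem nonab8 (hS : Nat.card S = 168) (H : Subgroup S) (hH : Nat.card H = 8) : ∃ a ∈ H, ∃ b ∈ H, a * b ≠ b * a := by
  by_contra! hab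
  let Q : Sylow 2 S := Sylow.ofCard H (by rw [hH, hS, fac168.2.2]; norm_num)
  have hQ : (Q : Subgroup S) = H := rfl
  have hQc : Nat.card Q = 8 := hH
  set Nn := Subgroup.normalizer (Q : Set S) with hNn
  have hQN : H ≤ Nn := by rw [← hQ]; exact Subgroup.le_normalizer
  have h8 : 8 ∣ Nat.card Nn := hH ▸ Subgroup.card_dvd_of_le hQN
  have h168 : Nat.card Nn ∣ 168 := hS ▸ Subgroup.card_subgroup_dvd_card Nn
  have h7 : ¬ 7 ∣ Nat.card Nn := by
    intro h
    rcases sub7 hS h with h | h | h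
    · have := Subgroup.normalizer_eq_top_iff.mp h
      exact no_normal hS (by rw [hQc]; norm_num) (by rw [hQc]; norm_num) this
    · rw [h] at h8; norm_num at h8
    · rw [h] at h8; norm_num at h8
  have h3 : ¬ 3 ∣ Nat.card Nn := by
    intro h
    obtain ⟨c, hc⟩ := exists_prime_orderOf_dvd_card' 3 h
    have hc' : orderOf (c : S) = 3 := by rw [Subgroup.orderOf_coe, hc]
    let K := Subgroup.zpowers c
    have hK : IsPGroup 3 K := IsPGroup.of_card (n := 1) (by rw [Nat.card_zpowers, hc]; norm_num)
    -- action by conjugation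
    let act : K →* MulAut H := (Subgroup.normalizerMonoidHom H).comp K.subtype
    letI : MulAction K H := MulAction.compHom H act
    have h1 := hK.card_modEq_card_fixedPoints H
    rw [hH] at h1
    have h2 : 1 < (MulAction.fixedPoints K H).ncard := by
      have h3 : 8 ≡ (MulAction.fixedPoints K H).ncard [MOD 3] := h1
      unfold Nat.ModEq at h3
      omega
    obtain ⟨v, hv, hv1⟩ := Set.exists_ne_of_one_lt_ncard h2 1
    have hv2 : (c : S) * v * (c : S)⁻¹ = v := by
      have := hv ⟨c, Subgroup.mem_zpowers c⟩
      exact congrArg Subtype.val this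
    have hv3 : (v : S) ∈ Subgroup.centralizer ({(c : S)} : Set S) := by
      rw [Subgroup.mem_centralizer_iff]
      intro h hh
      rw [Set.mem_singleton_iff.mp hh]
      exact mul_inv_eq_iff_eq_mul.mp hv2
    have h4 : orderOf (v : S) ∣ 3 := by
      rw [← (cent3 hS hc').1]
      exact Subgroup.orderOf_dvd_natCard _ hv3
    have h5 : orderOf (v : S) ∣ 8 := by
      rw [← hH]; exact Subgroup.orderOf_dvd_natCard _ v.2
    have h6 := Nat.dvd_gcd h4 h5
    norm_num at h6
    exact hv1 h6
  have hN8 : Nat.card Nn = 8 := by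
    obtain ⟨k, hk⟩ := h8
    rw [hk] at h168 h7 h3 ⊢
    have h1 : k ∣ 21 := by
      have : 8 * k ∣ 8 * 21 := h168
      exact Nat.dvd_of_mul_dvd_mul_left (by norm_num) this
    have h2 : k ∣ 3 * 7 := h1
    have c3 : Nat.Coprime k 3 := by
      rw [Nat.coprime_comm]
      exact (Nat.Prime.coprime_iff_not_dvd (by norm_num)).mpr (fun h => h3 (h.mul_left 8))
    have c7 : Nat.Coprime k 7 := by
      rw [Nat.coprime_comm]
      exact (Nat.Prime.coprime_iff_not_dvd (by norm_num)).mpr (fun h => h7 (h.mul_left 8))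
    have := Nat.Coprime.eq_one_of_dvd (c3.mul_right c7) h2
    omega
  have hNH : Nn = H := (Subgroup.eq_of_le_of_card_ge hQN (by rw [hN8, hH])).symm
  refine transfer_contra hS Q (by rw [hQc]; norm_num) (by rw [hQc]; norm_num) ?_
  intro n hn
  have hn' : n ∈ H := by rw [← hNH]; exact hn
  rw [Subgroup.mem_centralizer_iff]
  intro w hw
  exact hab w hw n hn'

end simple

end
end CT

open CategoryTheory
set_option linter.unusedSectionVars false
set_option linter.style.haveILetI false

namespace CT
noncomputable section
open ComplexConjugate

variable {G : Type} [Group G] [Finite G]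

theorem card_PSL (F : Type) [Field F] [Fintype F] (hF : Fintype.card F = 7) : Nat.card (PSL2 F) = 168 := by
  classical
  have h1 := Matrix.card_GL_field (𝔽 := F) 2
  rw [hF] at h1
  have h2 : Nat.card (GL (Fin 2) F) = 2016 := by rw [h1]; simp [Fin.prod_univ_two]
  have h3 : Nat.card Fˣ = 6 := by
    rw [Nat.card_eq_fintype_card, Fintype.card_units, hF]
  let d : GL (Fin 2) F →* Fˣ := Matrix.GeneralLinearGroup.det
  have hd : Function.Surjective d := Matrix.GeneralLinearGroup.det_surjective
  have h4 : Nat.card d.ker * 6 = 2016 := by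
    rw [← h2, ← Subgroup.card_mul_index d.ker, Subgroup.index_ker, MonoidHom.range_eq_top.mpr hd, Subgroup.card_top, h3]
  have h5 : Nat.card (Matrix.SpecialLinearGroup (Fin 2) F) = Nat.card d.ker := by
    have h6 : Set.range (Matrix.SpecialLinearGroup.toGL (n := Fin 2) (R := F)) = (d.ker : Set _) := by
      rw [Matrix.SpecialLinearGroup.range_toGL]
      ext g; rw [Set.mem_preimage, Set.mem_singleton_iff, SetLike.mem_coe, MonoidHom.mem_ker]
    have h7 := Set.ncard_range_of_injective (f := Matrix.SpecialLinearGroup.toGL (n := Fin 2) (R := F)) Matrix.SpecialLinearGroup.toGL_injective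
    rw [h6] at h7
    exact h7.symm
  have h8 : Nat.card (Subgroup.center (Matrix.SpecialLinearGroup (Fin 2) F)) = 2 := by
    rw [Nat.card_congr (Matrix.SpecialLinearGroup.center_equiv_rootsOfUnity (n := Fin 2) (R := F)).toEquiv]
    have h2 : (-1 : F) ≠ 1 := by
      intro h
      have h3 : (2 : F) = 0 := by linear_combination -h
      have h7 : (7 : F) = 0 := by
        have := Nat.cast_card_eq_zero F
        rw [hF] at this
        exact_mod_cast this
      have : (1 : F) = 0 := by linear_combination h7 - 3 * h3
      exact one_ne_zero this
    have hp : IsPrimitiveRoot (-1 : F) 2 := by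
      rw [IsPrimitiveRoot.iff (by norm_num)]
      refine ⟨by norm_num, ?_⟩
      intro l h1 h3
      interval_cases l
      simpa using h2
    have := hp.card_rootsOfUnity
    simpa using this
  have h9 := Subgroup.card_eq_card_quotient_mul_card_subgroup (Subgroup.center (Matrix.SpecialLinearGroup (Fin 2) F))
  rw [h8, h5] at h9
  change Nat.card (PSL2 F) = _
  have : Nat.card d.ker = Nat.card (PSL2 F) * 2 := h9
  omega

theorem simple_PSL (F : Type) [Field F] [Fintype F] (hF : Fintype.card F = 7) : IsSimpleGroup (PSL2 F) :=
  Matrix.ProjectiveSpecialLinearGroup.rank_two_simple (by rw [Nat.card_eq_fintype_card, hF]; norm_num)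

theorem syl_conj {S : Type} [Group S] (σ : MulAut S) (s : S) (Q : Sylow 7 S) :
    σ • (s • Q) = (σ s) • (σ • Q) := by
  have h : ∀ t : S, ∀ R : Sylow 7 S, t • R = MulAut.conj t • R := fun t R => rfl
  rw [h, h, ← mul_smul, ← mul_smul]
  congr 1
  ext x
  simp

section gam
variable {Γ : Type} [Group Γ] [Finite Γ] (S : Subgroup Γ) [S.Normal]

theorem cent_P [IsSimpleGroup S] (hS : Nat.card S = 168) (hC : Subgroup.centralizer (S : Set Γ) = ⊥) (P : Sylow 7 S)
    {y : Γ} (hy : ∀ u : S, u ∈ P → y * u = u * y) : ∃ u : S, u ∈ P ∧ (u : Γ) = y := by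
  let a : Γ →* MulAut S := MulAut.conjNormal
  have haS : ∀ s : S, a s = MulAut.conj s := fun s => MulAut.conjNormal_val
  have hW : ∀ w : Γ, (∀ R : Sylow 7 S, a w • R = R) → w = 1 := by
    intro w hw
    have hw' : w ∈ (⊥ : Subgroup Γ) := by
      rw [← hC, Subgroup.mem_centralizer_iff]
      intro s hs
      -- commutator lies in the kernel and in S
      have h1 : w * s * w⁻¹ ∈ S := Subgroup.Normal.conj_mem inferInstance s hs w
      have h2 : w * s * w⁻¹ * s⁻¹ ∈ S := S.mul_mem h1 (S.inv_mem hs)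
      have h3 : (⟨w * s * w⁻¹ * s⁻¹, h2⟩ : S) = 1 := by
        apply syl_faith hS
        intro R
        have h4 : (⟨w * s * w⁻¹ * s⁻¹, h2⟩ : S) • R = a (w * s * w⁻¹ * s⁻¹) • R := by
          have := haS ⟨w * s * w⁻¹ * s⁻¹, h2⟩
          simp only at this
          rw [this]; rfl
        rw [h4, map_mul, map_mul, map_mul, map_inv, map_inv]
        have h5 : ∀ R : Sylow 7 S, (a w)⁻¹ • R = R := by
          intro R; rw [inv_smul_eq_iff, hw]
        rw [mul_smul, mul_smul, mul_smul, h5, smul_inv_smul, hw]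
      have h4 := congrArg Subtype.val h3
      simp only [Subgroup.coe_one] at h4
      have h5 : w * s = s * w := by
        rw [mul_inv_eq_one, mul_inv_eq_iff_eq_mul] at h4
        exact h4
      exact h5.symm
    simpa using hw'
  have hcong : ∀ z : Γ, (∀ u : S, u ∈ P → z * u = u * z) → (∀ u : S, u ∈ P → a z u = u) := by
    intro z hz u hu
    apply Subtype.ext
    change z * u * z⁻¹ = u
    rw [hz u hu, mul_inv_cancel_right]
  have hPP : ∀ z : Γ, (∀ u : S, u ∈ P → z * u = u * z) → a z • P = P := by
    intro z hz
    apply Sylow.ext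
    symm
    apply Subgroup.eq_of_le_of_card_ge
    · intro u hu
      refine ⟨u, hu, hcong z hz u hu⟩
    · exact (Nat.card_congr (Sylow.equiv (a z • P) P).toEquiv).le
  obtain ⟨Q, hQP⟩ : ∃ Q : Sylow 7 S, Q ≠ P := by
    have : Nontrivial (Sylow 7 S) := by
      rw [← Finite.one_lt_card_iff_nontrivial, n7 hS]; norm_num
    exact exists_ne P
  have hyQ : a y • Q ≠ P := by
    intro h
    rw [← hPP y hy] at h
    exact hQP (smul_left_cancel _ h)
  obtain ⟨u, hu⟩ := orbit_seven (n7 hS) P (card_P7 hS P) hQP _ hyQ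
  refine ⟨u, u.2, ?_⟩
  have hu' : ∀ v : S, v ∈ P → (u : Γ) * v = v * u := by
    have : IsCyclic P := isCyclic_of_prime_card (p := 7) (card_P7 hS P)
    letI := IsCyclic.commGroup (α := P)
    intro v hv
    have := mul_comm u ⟨v, hv⟩
    exact congrArg (fun x : P => ((x : S) : Γ)) this
  have hz : ∀ v : S, v ∈ P → ((u : S) : Γ)⁻¹ * y * v = v * (((u : S) : Γ)⁻¹ * y) := by
    intro v hv
    rw [mul_assoc, hy v hv, ← mul_assoc, ← mul_assoc]
    congr 1
    rw [inv_mul_eq_iff_eq_mul, ← mul_assoc, hu' v hv, mul_assoc, mul_inv_cancel, mul_one]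
  have := hW (((u : S) : Γ)⁻¹ * y) ?_
  · rw [inv_mul_eq_one] at this
    exact this
  intro R
  have hzQ : a (((u : S) : Γ)⁻¹ * y) • Q = Q := by
    rw [map_mul, mul_smul, ← hu, map_inv, inv_smul_eq_iff, haS]
    rfl
  by_cases hR : R = P
  · rw [hR]; exact hPP _ hz
  obtain ⟨v, rfl⟩ := orbit_seven (n7 hS) P (card_P7 hS P) hQP R hR
  change a _ • ((v : S) • Q) = (v : S) • Q
  rw [syl_conj, hzQ, hcong _ hz v v.2]

end gam
end
end CT

open CategoryTheory
set_option linter.unusedSectionVars false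
set_option linter.style.haveILetI false

namespace CT
noncomputable section
open ComplexConjugate

variable {G : Type} [Group G] [Finite G]

section gam
variable {Γ : Type} [Group Γ] [Finite Γ] (S : Subgroup Γ) [S.Normal]

theorem gam_facts [IsSimpleGroup S] (hS : Nat.card S = 168) (hC : Subgroup.centralizer (S : Set Γ) = ⊥) :
    S.index ≤ 2 ∧ ∃ χ : Γ → ℂ, IsIrr χ ∧ deg χ = 8 := by
  let P : Sylow 7 S := default
  have hP7 : Nat.card P = 7 := card_P7 hS P
  let R : Subgroup Γ := (P : Subgroup S).map S.subtype
  have hR7 : Nat.card R = 7 := by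
    rw [← hP7]
    exact Subgroup.card_map_of_injective S.subtype_injective
  set B := Subgroup.normalizer (R : Set Γ) with hB
  have hRB : R ≤ B := Subgroup.le_normalizer
  have hRS : ∀ s : S, (s : Γ) ∈ R ↔ s ∈ P := by
    intro s
    constructor
    · rintro ⟨t, ht, h⟩
      have : t = s := Subtype.ext h
      exact this ▸ ht
    · intro h; exact ⟨s, h, rfl⟩
  have hSB : B.subgroupOf S = Subgroup.normalizer (P : Set S) := by
    ext s
    rw [Subgroup.mem_subgroupOf]
    refine Iff.trans (Subgroup.mem_normalizer_iff (H := R)) (Iff.trans ?_ (Subgroup.mem_normalizer_iff (H := (P : Subgroup S))).symm)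
    constructor
    · intro h t
      have := h t
      rw [hRS] at this
      exact Iff.trans this (hRS (s * t * s⁻¹))
    · intro h t
      constructor
      · rintro ⟨u, hu, rfl⟩
        exact ⟨s * u * s⁻¹, (h u).mp hu, rfl⟩
      · rintro ⟨u, hu, hu2⟩
        have : t = ((s⁻¹ * u * s : S) : Γ) := by
          change (u : Γ) = _ at hu2
          push_cast
          rw [hu2]; group
        rw [this, hRS]
        have h2 := (h (s⁻¹ * u * s)).mpr (by
          have : s * (s⁻¹ * u * s) * s⁻¹ = u := by group
          rw [this]; exact hu)
        exact h2
  have h21 : Nat.card (S.subgroupOf B) = 21 := by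
    rw [← card_N7 hS P, ← hSB]

    refine Nat.card_congr ⟨fun x => ⟨⟨x.1.1, x.2⟩, x.1.2⟩, fun x => ⟨⟨x.1.1, x.2⟩, x.1.2⟩, fun x => rfl, fun x => rfl⟩
  have hfr : B ⊔ S = ⊤ := Sylow.normalizer_sup_eq_top P
  have hidx : S.relIndex B = S.index := by
    rw [← Subgroup.relIndex_sup_right, hfr, Subgroup.relIndex_top_right]
  have hBc : 21 * S.index = Nat.card B := by
    rw [← hidx, ← h21]
    exact Subgroup.card_mul_index (S.subgroupOf B)
  have hcyc : IsCyclic R := isCyclic_of_prime_card (p := 7) hR7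
  have hcenR : ∀ y : Γ, y ∈ Subgroup.centralizer (R : Set Γ) → y ∈ R := by
    intro y hy
    obtain ⟨u, hu, rfl⟩ := cent_P S hS hC P (y := y) (by
      intro u hu
      exact (Subgroup.mem_centralizer_iff.mp hy u ((hRS u).mpr hu)).symm)
    exact (hRS u).mpr hu
  have hcm : ∀ a b : MulAut R, a * b = b * a := by
    intro a b
    apply (IsCyclic.mulAutMulEquiv R).injective
    rw [map_mul, map_mul, mul_comm]
  have hker : ∀ b : B, b ∈ (R.normalizerMonoidHom).ker → (b : Γ) ∈ R := by
    intro b hb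
    rw [Subgroup.normalizerMonoidHom_ker] at hb
    exact hcenR _ hb
  have hcomm : ∀ a b : B, a * b * a⁻¹ * b⁻¹ ∈ R.subgroupOf B := by
    intro a b
    refine Subgroup.mem_subgroupOf.mpr (hker _ ?_)
    rw [MonoidHom.mem_ker, map_mul, map_mul, map_mul, map_inv, map_inv]
    rw [hcm (R.normalizerMonoidHom a)]
    group
  have h42 : Nat.card B ≤ 42 := by
    have h1 := Subgroup.card_mul_index (R.normalizerMonoidHom).ker
    rw [Subgroup.index_ker] at h1
    have h2 : Nat.card (R.normalizerMonoidHom).ker ≤ 7 := by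
      rw [← hR7]
      refine Nat.card_le_card_of_injective (fun x => ⟨x.1.1, hker x.1 x.2⟩) ?_
      intro x y hxy
      simp only [Subtype.mk.injEq] at hxy
      exact Subtype.ext (Subtype.ext hxy)
    have h3 : Nat.card (R.normalizerMonoidHom).range ≤ 6 := by
      have h4 : Nat.card (MulAut R) = 6 := by
        rw [IsCyclic.card_mulAut, hR7]; decide
      rw [← h4]
      exact Subgroup.card_le_card_group _
    calc Nat.card B = _ := h1.symm
      _ ≤ 7 * 6 := Nat.mul_le_mul h2 h3
      _ = 42 := by norm_num
  have hi2 : S.index ≤ 2 := by omega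
  refine ⟨hi2, ?_⟩
  have hi0 : 0 < S.index := Nat.pos_of_ne_zero Subgroup.index_ne_zero_of_finite
  have hΓ : Nat.card Γ = 168 * S.index := by rw [← hS, Subgroup.card_mul_index]
  let T : Sylow 7 Γ := Sylow.ofCard R (by
    rw [hR7, hΓ]
    have : S.index = 1 ∨ S.index = 2 := by omega
    rcases this with h | h
    · rw [h, mul_one, fac168.1]; norm_num
    · rw [h, Nat.factorization_mul (by norm_num) (by norm_num), Finsupp.add_apply, fac168.1, Nat.Prime.factorization (by norm_num)]
      simp)
  have hT7 : Nat.card T = 7 := hR7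
  have hT8 : Nat.card (Sylow 7 Γ) = 8 := by
    rw [T.card_eq_index_normalizer]
    change B.index = 8
    have := Subgroup.card_mul_index B
    rw [← hBc, hΓ] at this
    have h2 : (21 * S.index) * B.index = (21 * S.index) * 8 := by rw [this]; ring
    exact Nat.eq_of_mul_eq_mul_left (by omega) h2
  obtain ⟨c, hc⟩ := exists_prime_orderOf_dvd_card' (G := S.subgroupOf B) 3 (by rw [h21]; norm_num)
  have hcS : ((c : B) : Γ) ∈ S := c.2
  let cS : S := ⟨((c : B) : Γ), hcS⟩
  have hcS3 : orderOf cS = 3 := by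
    have h1 : orderOf ((c : B) : Γ) = 3 := by rw [Subgroup.orderOf_coe, Subgroup.orderOf_coe, hc]
    rw [← Subgroup.orderOf_coe]; exact h1
  have hcR : (c : B) ∉ R.subgroupOf B := by
    intro h
    have h1 : ((c : B) : Γ) ∈ R := h
    have h2 := Subgroup.orderOf_dvd_natCard _ h1
    rw [hR7, Subgroup.orderOf_coe, Subgroup.orderOf_coe, hc] at h2
    norm_num at h2
  have : (R.subgroupOf B).Normal := Subgroup.normal_in_normalizer
  obtain ⟨l, hl, hlc⟩ := exists_lin (R.subgroupOf B) hcomm hcR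
  obtain ⟨-, m, hm⟩ := cent3 hS hcS3
  have hmΓ : (m : Γ) * (c : B) * (m : Γ)⁻¹ = ((c : B) : Γ)⁻¹ := congrArg Subtype.val hm
  have hl3 : l c ^ 3 = 1 := by
    rw [← map_pow, ← hc]
    have : ((c : B)) ^ orderOf c = 1 := by
      have := pow_orderOf_eq_one c
      exact congrArg Subtype.val this
    rw [this, map_one]
  have hl2 : ∀ d : B, d = (c : B)⁻¹ → l d = l c → False := by
    rintro d rfl h
    apply hlc
    have h1 : l (c : B)⁻¹ * l c = 1 := by rw [← map_mul, inv_mul_cancel, map_one]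
    rw [h] at h1
    calc l c = l c ^ 3 := by rw [pow_succ, pow_two, h1, one_mul]
      _ = 1 := hl3
  have hmB : (m : Γ) ∉ B := by
    intro h
    refine hl2 ((⟨m, h⟩ : B) * c * (⟨m, h⟩ : B)⁻¹) (Subtype.ext hmΓ) ?_
    rw [map_mul, map_mul, mul_right_comm, ← map_mul, mul_inv_cancel, map_one, one_mul]
  have hirr := lem8 B (isIrr_lin l) (3 * S.index) (by
      intro x hx
      have := Dm_seven hT8 T hT7 (m := x) hx
      have h2 : Nat.card (Dm B x) * 7 = Nat.card B := this
      omega) (by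
      rw [← hBc, hΓ]
      have : 168 * S.index - 21 * S.index = 147 * S.index := by omega
      rw [this]; ring)
    (fun x _ => isIrr_lin (l.comp (Dm1 B x))) (fun x _ => isIrr_lin (l.comp (Dm2 B x)))
    ⟨m, hmB, by
      intro h
      have hD : ((c : B) : Γ) ∈ Dm B m := by
        rw [mem_Dm]
        refine ⟨(c : B).2, ?_⟩
        rw [hmΓ]; exact B.inv_mem (c : B).2
      have := congrFun h ⟨_, hD⟩
      exact hl2 (Dm2 B m ⟨_, hD⟩) (Subtype.ext hmΓ) this.symm⟩
  refine ⟨_, hirr, ?_⟩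
  have h1 := deg_ind (isIrr_lin l).isChar B.subtype B.subtype_injective
  have h2 : deg (fun g => l g) = 1 := by
    have := (isIrr_lin l).isChar.deg_eq
    simp only [map_one] at this
    exact_mod_cast this.symm
  rw [h2, ← hBc, hΓ] at h1
  have h3 : (21 * S.index) * deg (Ind B.subtype fun g => l g) = (21 * S.index) * 8 := by rw [h1]; ring
  exact Nat.eq_of_mul_eq_mul_left (by omega) h3
end gam
end
end CT

open CategoryTheory
set_option linter.unusedSectionVars false
set_option linter.style.haveILetI false

namespace CT
noncomputable section
open ComplexConjugate

variable {G : Type} [Group G] [Finite G]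

/-- The working hypotheses on `π : X → S`. -/
structure Hyp {X S : Type} [Group X] [Group S] (π : X →* S) (CD : Set ℕ) : Prop where
  surj : Function.Surjective π
  card : Nat.card S = 168
  simple : IsSimpleGroup S
  tp : ∀ a ∈ CD, ∀ b ∈ CD, a ≠ b → (Nat.gcd a b).primeFactorsList.length ≤ 2
  eight : 8 ∈ CD
  up : ∀ χ : X → ℂ, IsIrr χ → deg χ ∈ CD ∨ 2 * deg χ ∈ CD
  down : ∀ f ∈ CD, ∃ χ : X → ℂ, IsIrr χ ∧ (f = deg χ ∨ f = 2 * deg χ)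

theorem Nrm.two_index {L X : Type} [Group L] [Group X] [Finite L] [Finite X] (E : Nrm L X)
    (h2 : E.ι.range.index ≤ 2) {ψ : X → ℂ} (hψ : IsIrr ψ) {χ : L → ℂ} (hχ : IsIrr χ)
    (hm : mlt (fun l => ψ (E.ι l)) χ ≠ 0) : deg ψ = deg χ ∨ deg ψ = 2 * deg χ := by
  have hL : Nat.card E.ι.range = Nat.card L := Nat.card_congr (MonoidHom.ofInjective E.inj).toEquiv.symm
  have h1 := Subgroup.card_mul_index E.ι.range
  rw [hL] at h1
  have hLp : 0 < Nat.card L := Nat.card_pos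
  have hle : E.ι.range ≤ E.stab χ := by
    rintro _ ⟨l, rfl⟩; exact E.ι_mem_stab hχ.isChar.isCl l
  have h3 := Subgroup.card_dvd_of_le hle
  rw [hL] at h3
  obtain ⟨k, hk⟩ := h3
  have h4 : Nat.card (E.stab χ) ∣ Nat.card X := Subgroup.card_subgroup_dvd_card _
  rw [hk, ← h1] at h4
  have hkd : k ∣ E.ι.range.index := Nat.dvd_of_mul_dvd_mul_left hLp h4
  have h5 := E.sum_sq hχ
  rw [hk, mul_comm] at h5
  have h6 := Nat.eq_of_mul_eq_mul_left hLp h5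
  have h7 : mlt (fun l => ψ (E.ι l)) χ ^ 2 ≤ k := by
    have h := Finset.single_le_sum (f := fun ψ : X → ℂ => mlt (fun l => ψ (E.ι l)) χ ^ 2) (s := IrrF X)
      (fun _ _ => Nat.zero_le _) (mem_IrrF.mpr hψ)
    rw [h6] at h
    exact h
  have hi0 : 0 < E.ι.range.index := Nat.pos_of_ne_zero Subgroup.index_ne_zero_of_finite
  have hk2 : k ≤ 2 := (Nat.le_of_dvd hi0 hkd).trans h2
  have hm1 : mlt (fun l => ψ (E.ι l)) χ = 1 := by
    generalize mlt (fun l => ψ (E.ι l)) χ = m at h7 hm ⊢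
    have : m < 2 := by
      by_contra h
      have : 2 ^ 2 ≤ m ^ 2 := Nat.pow_le_pow_left (by omega) 2
      omega
    omega
  have h8 := E.clifford_deg hψ hχ hm
  rw [hm1, hk, ← h1, one_mul, mul_assoc, mul_assoc] at h8
  have h9 := Nat.eq_of_mul_eq_mul_left hLp h8
  generalize E.ι.range.index = i at hi0 h2 hkd h9
  have hk0 : k ≠ 0 := by rintro rfl; simp at hkd; omega
  have hik : (i = 1 ∨ i = 2) ∧ (k = 1 ∨ k = 2) ∧ k ≤ i := by
    have := Nat.le_of_dvd hi0 hkd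
    omega
  rcases hik with ⟨rfl | rfl, rfl | rfl, h⟩ <;> omega

theorem hyp_of (F : Type) [Field F] [Fintype F] (hF : Fintype.card F = 7)
    (hG : TwoPrimeHypothesis G)
    (N M : Subgroup G) [N.Normal] [M.Normal] (hNM : N ≤ M)
    (hiso : Nonempty ((M.map (QuotientGroup.mk' N)) ≃* PSL2 F))
    (hcent : Subgroup.centralizer ((M.map (QuotientGroup.mk' N)) : Set (G ⧸ N)) = ⊥) :
    Hyp ((QuotientGroup.mk' N).subgroupMap M) (charDegrees G) := by
  obtain ⟨e⟩ := hiso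
  have hSc : Nat.card (M.map (QuotientGroup.mk' N)) = 168 := by
    rw [Nat.card_congr e.toEquiv, card_PSL F hF]
  have := simple_PSL F hF
  have hSs : IsSimpleGroup (M.map (QuotientGroup.mk' N)) := (MulEquiv.isSimpleGroup_congr e).mpr this
  have hSn : (M.map (QuotientGroup.mk' N)).Normal := Subgroup.Normal.map inferInstance _ (QuotientGroup.mk'_surjective N)
  obtain ⟨hi, χ8, hχ8, hd8⟩ := gam_facts (M.map (QuotientGroup.mk' N)) hSc hcent
  have hMi : M.index ≤ 2 := by
    have h1 : (M.map (QuotientGroup.mk' N)).comap (QuotientGroup.mk' N) = M := by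
      rw [Subgroup.comap_map_eq, QuotientGroup.ker_mk', sup_eq_left.mpr hNM]
    rw [← h1, Subgroup.index_comap_of_surjective _ (QuotientGroup.mk'_surjective N)]
    exact hi
  let E := Nrm.ofSub M
  have hEi : E.ι.range.index ≤ 2 := by
    change M.subtype.range.index ≤ 2
    rw [Subgroup.range_subtype]; exact hMi
  refine ⟨MonoidHom.subgroupMap_surjective _ _, hSc, hSs, hG, ?_, ?_, ?_⟩
  · rw [mem_charDegrees]
    refine ⟨_, hχ8.comp_surj (QuotientGroup.mk'_surjective N), ?_⟩
    rw [deg_comp, hd8]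
  · intro χ hχ
    obtain ⟨ψ, hψ, hm⟩ := E.exists_over hχ
    rcases E.two_index hEi hψ hχ hm with h | h
    · left; rw [mem_charDegrees]; exact ⟨ψ, hψ, h⟩
    · right; rw [mem_charDegrees]; exact ⟨ψ, hψ, h⟩
  · intro f hf
    rw [mem_charDegrees] at hf
    obtain ⟨ψ, hψ, rfl⟩ := hf
    obtain ⟨χ, hχ, hm⟩ := E.exists_under hψ
    exact ⟨χ, hχ, E.two_index hEi hψ hχ hm⟩

end
end CT

open CategoryTheory
set_option linter.unusedSectionVars false
set_option linter.style.haveILetI false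

namespace CT
noncomputable section
open ComplexConjugate

variable {G : Type} [Group G] [Finite G]

section main
variable {X S : Type} [Group X] [Finite X] [Group S] [Finite S] {π : X →* S} {CD : Set ℕ}

/-- the normal inclusion of the kernel -/
abbrev EN (π : X →* S) : Nrm π.ker X := Nrm.ofSub π.ker

/-- inertia quotient -/
def Tb (π : X →* S) (θ : π.ker → ℂ) : Subgroup S := ((EN π).stab θ).map π

/-- multiplicity of `θ` in `χ` -/
abbrev mm (π : X →* S) (χ : X → ℂ) (θ : π.ker → ℂ) : ℕ := mlt (fun l => χ ((EN π).ι l)) θ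

theorem three_len {p q r g : ℕ} (hp : p.Prime) (hq : q.Prime) (hr : r.Prime) (hg : g ≠ 0) (h : p * q * r ∣ g) :
    3 ≤ g.primeFactorsList.length := by
  have h1 := (Nat.primeFactorsList_sublist_of_dvd h hg).length_le
  have h2 : (p * q * r).primeFactorsList.length = 3 := by
    rw [(Nat.perm_primeFactorsList_mul (mul_ne_zero hp.ne_zero hq.ne_zero) hr.ne_zero).length_eq, List.length_append,
      (Nat.perm_primeFactorsList_mul hp.ne_zero hq.ne_zero).length_eq, List.length_append,
      Nat.primeFactorsList_prime hp, Nat.primeFactorsList_prime hq, Nat.primeFactorsList_prime hr]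
    rfl
  omega

variable (H : Hyp π CD)

theorem Hyp.pos (H : Hyp π CD) {f : ℕ} (hf : f ∈ CD) : 0 < f := by
  obtain ⟨χ, hχ, h⟩ := H.down f hf
  have := hχ.deg_pos
  omega

theorem Hyp.tp3 (H : Hyp π CD) {a b p q r : ℕ} (ha : a ∈ CD) (hb : b ∈ CD) (hp : p.Prime) (hq : q.Prime) (hr : r.Prime)
    (hA : p * q * r ∣ a) (hB : p * q * r ∣ b) : a = b := by
  by_contra h
  have h1 := H.tp a ha b hb h
  have h2 : Nat.gcd a b ≠ 0 := by
    have := H.pos ha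
    exact (Nat.gcd_pos_of_pos_left b this).ne'
  have := three_len hp hq hr h2 (Nat.dvd_gcd hA hB)
  omega

theorem Hyp.tp2 (H : Hyp π CD) {a b p q k : ℕ} (ha : a ∈ CD) (hb : b ∈ CD) (hp : p.Prime) (hq : q.Prime) (hk : k ≠ 1)
    (hA : p * q * k ∣ a) (hB : p * q * k ∣ b) : a = b := by
  obtain ⟨r, hr, hrk⟩ := Nat.exists_prime_and_dvd hk
  have : p * q * r ∣ p * q * k := Nat.mul_dvd_mul_left _ hrk
  exact H.tp3 ha hb hp hq hr (this.trans hA) (this.trans hB)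

theorem Hyp.deg8 (H : Hyp π CD) {χ : X → ℂ} (hχ : IsIrr χ) (h : 8 ∣ deg χ) : deg χ = 8 := by
  have h2 : Nat.Prime 2 := by norm_num
  rcases H.up χ hχ with h1 | h1
  · exact H.tp3 h1 H.eight h2 h2 h2 h (by norm_num)
  · have := H.tp3 h1 H.eight h2 h2 h2 (h.mul_left 2) (by norm_num)
    omega

theorem card_sub (hπ : Function.Surjective π) (K : Subgroup X) (hK : π.ker ≤ K) :
    Nat.card K = Nat.card (K.map π) * Nat.card π.ker := by
  have h1 := Subgroup.index_map K π
  rw [sup_eq_left.mpr hK, MonoidHom.range_eq_top.mpr hπ, Subgroup.index_top, mul_one] at h1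
  have h2 := Subgroup.card_mul_index K
  have h3 := Subgroup.card_mul_index (K.map π)
  have h4 := Subgroup.card_mul_index π.ker
  rw [Subgroup.index_ker, MonoidHom.range_eq_top.mpr hπ, Subgroup.card_top] at h4
  have h5 : K.index ≠ 0 := Subgroup.index_ne_zero_of_finite
  rw [h1] at h3
  apply Nat.eq_of_mul_eq_mul_right (Nat.pos_of_ne_zero h5)
  rw [h2, ← h4, ← h3]; ring

theorem Hyp.cardX (H : Hyp π CD) : Nat.card X = 168 * Nat.card π.ker := by
  have h4 := Subgroup.card_mul_index π.ker
  rw [Subgroup.index_ker, MonoidHom.range_eq_top.mpr H.surj, Subgroup.card_top, H.card] at h4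
  rw [← h4, mul_comm]

theorem ker_le_stab {θ : π.ker → ℂ} (hθ : IsIrr θ) : π.ker ≤ (EN π).stab θ := by
  intro x hx
  exact (EN π).ι_mem_stab hθ.isChar.isCl ⟨x, hx⟩

theorem mem_Tb {θ : π.ker → ℂ} (hθ : IsIrr θ) {x : X} : π x ∈ Tb π θ ↔ x ∈ (EN π).stab θ := by
  constructor
  · rintro ⟨y, hy, hxy⟩
    have h1 : y⁻¹ * x ∈ π.ker := by rw [MonoidHom.mem_ker, map_mul, map_inv, hxy, inv_mul_cancel]
    have := Subgroup.mul_mem _ hy (ker_le_stab hθ h1)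
    rwa [mul_inv_cancel_left] at this
  · intro h; exact ⟨x, h, rfl⟩

theorem Hyp.card_stab (H : Hyp π CD) {θ : π.ker → ℂ} (hθ : IsIrr θ) :
    Nat.card ((EN π).stab θ) = Nat.card (Tb π θ) * Nat.card π.ker := card_sub H.surj _ (ker_le_stab hθ)

theorem Hyp.sum (H : Hyp π CD) {θ : π.ker → ℂ} (hθ : IsIrr θ) :
    ∑ χ ∈ IrrF X, mm π χ θ ^ 2 = Nat.card (Tb π θ) := by
  have h := (EN π).sum_sq hθ
  rw [H.card_stab hθ] at h
  exact Nat.eq_of_mul_eq_mul_right Nat.card_pos h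

theorem Hyp.cliff (H : Hyp π CD) {θ : π.ker → ℂ} (hθ : IsIrr θ) {χ : X → ℂ} (hχ : IsIrr χ) (hm : mm π χ θ ≠ 0) :
    Nat.card (Tb π θ) * deg χ = 168 * (mm π χ θ * deg θ) := by
  have h := (EN π).clifford_deg hχ hθ hm
  rw [H.card_stab hθ, H.cardX] at h
  apply Nat.eq_of_mul_eq_mul_right (Nat.card_pos (α := π.ker))
  rw [show mlt (fun l => χ ((EN π).ι l)) θ = mm π χ θ from rfl] at h
  linarith

theorem Hyp.tdvd (H : Hyp π CD) (θ : π.ker → ℂ) : Nat.card (Tb π θ) ∣ 168 := H.card ▸ Subgroup.card_subgroup_dvd_card _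

open Classical in
theorem Hyp.lemC (H : Hyp π CD) {θ : π.ker → ℂ} (hθ : IsIrr θ) (h3 : 3 ∣ Nat.card (Tb π θ)) :
    ((IrrF X).filter (fun χ => ¬ 3 ∣ mm π χ θ)).card ≤ 3 := by
  have := H.simple
  obtain ⟨c', hc'⟩ := exists_prime_orderOf_dvd_card' 3 h3
  obtain ⟨c, hc, hcc⟩ := c'.2
  have hc3 : orderOf (π c) = 3 := by rw [hcc, Subgroup.orderOf_coe, hc']
  have hcen : Subgroup.centralizer {π c} = Subgroup.zpowers (π c) := by
    symm
    apply Subgroup.eq_of_le_of_card_ge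
    · rw [Subgroup.zpowers_le, Subgroup.mem_centralizer_iff]
      intro h hh
      rw [Set.mem_singleton_iff.mp hh]
    · rw [(cent3 H.card hc3).1, Nat.card_zpowers, hc3]
  have hrange : (EN π).ι.range = π.ker := Subgroup.range_subtype _
  refine (EN π).lemC hθ ((Subgroup.zpowers (π c)).comap π) ?_ ?_ ?_ c ?_ ?_ ?_
  · intro l
    rw [Subgroup.mem_comap]
    have : π ((EN π).ι l) = 1 := l.2
    rw [this]; exact Subgroup.one_mem _
  · rw [card_sub H.surj _ (MonoidHom.ker_le_comap _ _), Subgroup.map_comap_eq_self_of_surjective H.surj, Nat.card_zpowers, hc3]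
  · intro x hx
    rw [← mem_Tb hθ]
    have h1 : Subgroup.zpowers (π c) ≤ Tb π θ := by
      rw [Subgroup.zpowers_le]; exact ⟨c, hc, rfl⟩
    exact h1 hx
  · rw [Subgroup.mem_comap]; exact Subgroup.mem_zpowers _
  · rw [hrange, MonoidHom.mem_ker]
    intro h
    rw [h] at hc3; simp at hc3
  · intro x hx
    rw [hrange, MonoidHom.mem_ker, map_mul, map_mul, map_mul, map_inv, map_inv, mul_inv_eq_one, mul_inv_eq_iff_eq_mul] at hx
    rw [Subgroup.mem_comap, ← hcen, Subgroup.mem_centralizer_iff]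
    intro h hh
    rw [Set.mem_singleton_iff.mp hh, hx]

theorem Hyp.A1 (H : Hyp π CD) {θ : π.ker → ℂ} (hθ : IsIrr θ) (h7 : 7 ∣ Nat.card (Tb π θ)) : Tb π θ = ⊤ := by
  classical
  have := H.simple
  rcases sub7 H.card h7 with h | h | h
  · exact h
  · exfalso
    obtain ⟨χ, hχ, hm⟩ := (EN π).exists_over hθ
    have h1 := H.cliff hθ hχ hm
    rw [h] at h1
    have h2 : deg χ = 8 * (3 * (mm π χ θ * deg θ)) := by omega
    have h3 := H.deg8 hχ (by rw [h2]; exact Dvd.intro _ rfl)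
    omega
  · exfalso
    have h1 : ∀ χ ∈ IrrF X, mm π χ θ = 0 ∨ mm π χ θ = 1 := by
      intro χ hχ
      rw [mem_IrrF] at hχ
      by_cases hm : mm π χ θ = 0
      · exact Or.inl hm
      · right
        have h1 := H.cliff hθ hχ hm
        rw [h] at h1
        have h2 : deg χ = 8 * (mm π χ θ * deg θ) := by omega
        have h3 := H.deg8 hχ (by rw [h2]; exact Dvd.intro _ rfl)
        have h4 : mm π χ θ * deg θ = 1 := by omega
        exact Nat.eq_one_of_mul_eq_one_right h4
    have h2 := H.sum hθ
    have h3 := H.lemC hθ (by rw [h]; norm_num)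
    have h4 : ∑ χ ∈ IrrF X, mm π χ θ ^ 2 = ((IrrF X).filter (fun χ => ¬ 3 ∣ mm π χ θ)).card := by
      rw [Finset.card_filter]
      apply Finset.sum_congr rfl
      intro χ hχ
      rcases h1 χ hχ with h | h <;> rw [h] <;> norm_num
    omega
end main
end
end CT

open CategoryTheory
set_option linter.unusedSectionVars false
set_option linter.style.haveILetI false

namespace CT
noncomputable section
open ComplexConjugate

variable {G : Type} [Group G] [Finite G]

theorem IsChar.irr_of_res {K : Type} [Group K] [Finite K] {f : G → ℂ} (hf : IsChar f) (φ : K →* G)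
    (h : IsIrr (fun k => f (φ k))) : IsIrr f := by
  classical
  have h1 := mlt_res_trans (MonoidHom.id G) φ hf h
  have h2 : mlt (fun k => f (φ k)) (fun k => f (φ k)) = 1 := h.mlt_self
  have h3 : (∑ ψ ∈ IrrF G, mlt f ψ * mlt (fun k => ψ (φ k)) (fun k => f (φ k))) = 1 := by
    rw [← h2]; exact h1.symm
  obtain ⟨ψ, hψ, h4⟩ : ∃ ψ ∈ IrrF G, mlt f ψ * mlt (fun k => ψ (φ k)) (fun k => f (φ k)) ≠ 0 := by
    by_contra hcon
    push Not at hcon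
    rw [Finset.sum_eq_zero hcon] at h3
    exact absurd h3 (by norm_num)
  rw [mem_IrrF] at hψ
  have h5 := (hψ.isChar.comp φ).mlt_mul_deg_le h
  have h6 : deg (fun k => f (φ k)) = deg f := by simp [deg]
  have h7 : deg (fun k => ψ (φ k)) = deg ψ := by simp [deg]
  rw [h6, h7] at h5
  have h8 : mlt (fun k => ψ (φ k)) (fun k => f (φ k)) ≠ 0 := fun h => h4 (by rw [h, mul_zero])
  have h9 : mlt f ψ ≠ 0 := fun h => h4 (by rw [h, zero_mul])
  rw [hf.eq_of_mlt_deg hψ h9 (le_trans (Nat.le_mul_of_pos_left _ (Nat.pos_of_ne_zero h8)) h5)]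
  exact hψ

theorem deg_res {K : Type} [Group K] [Finite K] (f : G → ℂ) (φ : K →* G) : deg (fun k => f (φ k)) = deg f := by
  simp [deg]

section tower
variable {L V U : Type} [Group L] [Group V] [Group U] [Finite L] [Finite V] [Finite U]

theorem Nrm.prime_over (E : Nrm L V) {p : ℕ} (hp : p.Prime) (h : Nat.card V = p * Nat.card L) {θ : L → ℂ} (hθ : IsIrr θ)
    (hst : E.stab θ = ⊤) {χ : V → ℂ} (hχ : IsIrr χ) (hm : mlt (fun l => χ (E.ι l)) θ ≠ 0) :
    deg χ = deg θ := by
  have hcl : ∀ l, χ (E.ι l) = mlt (fun l => χ (E.ι l)) θ * θ l := by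
    intro l
    have h1 := E.clifford_fun hχ hθ hm l
    have h2 : ∀ x : V, θ (E.a x l) = θ l := fun x => by
      have : x ∈ E.stab θ := by rw [hst]; trivial
      exact this l
    rw [gs_congr h2, gs_const, hst, Subgroup.card_top] at h1
    apply mul_left_cancel₀ (card_ne (G := V))
    rw [h1]; ring
  set e := mlt (fun l => χ (E.ι l)) θ
  have hip : ip (fun l => χ (E.ι l)) (fun l => χ (E.ι l)) = (e ^ 2 : ℕ) := by
    have : (fun l => χ (E.ι l)) = (e : ℂ) • θ := funext hcl
    rw [this, ip_smul_left, ip_smul_right, ip_irr_self hθ]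
    simp [sq]
  rcases E.prime_index hp h hχ with h1 | h1
  · have h2 := h1.eq_of_mlt hθ hm
    rw [← deg_res χ E.ι, h2]
  · exfalso
    have h2 := E.ip_range hp.ne_zero h χ χ h1
    rw [hip, ip_irr_self hχ, one_mul] at h2
    have h4 : p = e ^ 2 := by exact_mod_cast h2
    exact hp.not_isSquare ⟨e, by rw [h4, sq]⟩

theorem tower_ext (E : Nrm L U) (E1 : Nrm L V) (E2 : Nrm V U) (hE : ∀ l, E.ι l = E2.ι (E1.ι l))
    (hV : Nat.card V = 7 * Nat.card L) (hU : Nat.card U = 3 * Nat.card V) {θ : L → ℂ} (hθ : IsIrr θ)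
    (hst : E.stab θ = ⊤) : ∃ α : U → ℂ, IsIrr α ∧ (fun l => α (E.ι l)) = θ := by
  classical
  have hL := Nat.card_pos (α := L)
  have hst1 : E1.stab θ = ⊤ := by
    rw [eq_top_iff]
    intro v _
    rw [E1.mem_stab]
    intro l
    have h1 : E2.ι v ∈ E.stab θ := by rw [hst]; trivial
    rw [← h1 l]
    congr 1
    apply E.inj
    rw [E.ha, hE, hE, E1.ha]; simp
  have key : ∀ α ∈ IrrF U, mlt (fun l => α (E.ι l)) θ = 1 ∨ 3 ∣ mlt (fun l => α (E.ι l)) θ := by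
    intro α hα
    rw [mem_IrrF] at hα
    by_cases h0 : mlt (fun l => α (E.ι l)) θ = 0
    · right; rw [h0]; exact dvd_zero _
    have h1 := mlt_res_trans E2.ι E1.ι hα.isChar hθ
    have h2 : (fun k => α (E2.ι (E1.ι k))) = fun l => α (E.ι l) := by ext l; rw [hE]
    rw [h2] at h1
    obtain ⟨δ, hδ, h4⟩ : ∃ ψ ∈ IrrF V, mlt (fun h => α (E2.ι h)) ψ * mlt (fun k => ψ (E1.ι k)) θ ≠ 0 := by
      by_contra hcon
      push Not at hcon
      rw [Finset.sum_eq_zero hcon] at h1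
      exact h0 h1
    rw [mem_IrrF] at hδ
    have h8 : mlt (fun k => δ (E1.ι k)) θ ≠ 0 := fun h => h4 (by rw [h, mul_zero])
    have h9 : mlt (fun h => α (E2.ι h)) δ ≠ 0 := fun h => h4 (by rw [h, zero_mul])
    have hd := E1.prime_over (by norm_num) hV hθ hst1 hδ h8
    have c1 := E.clifford_deg hα hθ h0
    rw [hst, Subgroup.card_top] at c1
    have c2 := E2.clifford_deg hα hδ h9
    have hU0 := Nat.card_pos (α := U)
    have c3 : deg α = mlt (fun l => α (E.ι l)) θ * deg θ := by
      apply Nat.eq_of_mul_eq_mul_left hU0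
      rw [c1]; ring
    rw [hd, c3, hU] at c2
    have hθp := hθ.deg_pos
    have c4 : Nat.card (E2.stab δ) * mlt (fun l => α (E.ι l)) θ = mlt (fun h => α (E2.ι h)) δ * (3 * Nat.card V) := by
      apply Nat.eq_of_mul_eq_mul_right hθp
      linarith
    have hsq := E2.sum_sq hδ
    have hle := Finset.single_le_sum (f := fun ψ : U → ℂ => mlt (fun l => ψ (E2.ι l)) δ ^ 2) (s := IrrF U)
      (fun _ _ => Nat.zero_le _) (mem_IrrF.mpr hα)
    have hV0 := Nat.card_pos (α := V)
    have hdv : Nat.card V ∣ Nat.card (E2.stab δ) := Dvd.intro_left _ hsq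
    obtain ⟨k, hk⟩ := hdv
    have hk3 : k ∣ 3 := by
      have := Subgroup.card_subgroup_dvd_card (E2.stab δ)
      rw [hk, hU, mul_comm] at this
      exact Nat.dvd_of_mul_dvd_mul_right hV0 this
    have hsq' : (∑ χ ∈ IrrF U, mlt (fun l => χ (E2.ι l)) δ ^ 2) = k := by
      apply Nat.eq_of_mul_eq_mul_right hV0
      rw [hsq, hk, mul_comm]
    rw [hk] at c4
    have c5 : k * mlt (fun l => α (E.ι l)) θ = mlt (fun h => α (E2.ι h)) δ * 3 := by
      apply Nat.eq_of_mul_eq_mul_right hV0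
      linarith
    rcases (Nat.dvd_prime (by norm_num)).mp hk3 with h | h
    · right
      rw [h, one_mul] at c5
      rw [c5]; exact Dvd.intro_left _ rfl
    · left
      rw [hsq', h] at hle
      have : mlt (fun h => α (E2.ι h)) δ < 2 := by
        by_contra hc
        have : 2 ≤ mlt (fun h => α (E2.ι h)) δ := by omega
        have h4 := Nat.pow_le_pow_left this 2
        have := h4.trans hle
        omega
      rw [h] at c5
      omega
  have hsum := E.sum_sq hθ
  have h21 : (∑ χ ∈ IrrF U, mlt (fun l => χ (E.ι l)) θ ^ 2) = 21 := by
    apply Nat.eq_of_mul_eq_mul_right hL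
    rw [hsum, hst, Subgroup.card_top, hU, hV]; ring
  obtain ⟨α, hα, h1⟩ : ∃ α ∈ IrrF U, mlt (fun l => α (E.ι l)) θ = 1 := by
    by_contra hcon
    push Not at hcon
    have : 9 ∣ ∑ χ ∈ IrrF U, mlt (fun l => χ (E.ι l)) θ ^ 2 := by
      apply Finset.dvd_sum
      intro χ hχ
      obtain ⟨k, hk⟩ := (key χ hχ).resolve_left (hcon χ hχ)
      rw [hk]
      exact ⟨k ^ 2, by ring⟩
    rw [h21] at this
    norm_num at this
  rw [mem_IrrF] at hα
  refine ⟨α, hα, (hα.isChar.comp E.ι).eq_of_mlt_deg hθ (by rw [h1]; norm_num) ?_⟩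
  have c1 := E.clifford_deg hα hθ (by rw [h1]; norm_num)
  rw [hst, Subgroup.card_top, h1, one_mul] at c1
  rw [deg_res]
  exact (Nat.eq_of_mul_eq_mul_left Nat.card_pos c1).le
end tower

section main
variable {X S : Type} [Group X] [Finite X] [Group S] [Finite S] {π : X →* S} {CD : Set ℕ}

/-- an extension to the preimage of a Sylow 7 normalizer gives degree `8 θ(1)` -/
theorem Hyp.A2aux (H : Hyp π CD) (P : Sylow 7 S) {θ : π.ker → ℂ} (hθ : IsIrr θ) (hst : (EN π).stab θ = ⊤)
    (B : Subgroup S) (hB : B = Subgroup.normalizer (P : Set S)) (U : Subgroup X) (hU : U = B.comap π)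
    {α : U → ℂ} (hα : IsIrr α) (hr : ∀ l : π.ker, ∀ h, α ⟨l, h⟩ = θ l)
    (hm : ∃ m, m ∉ U ∧ (fun x => α (Dm1 U m x)) ≠ (fun x => α (Dm2 U m x))) : deg θ = 1 := by
  have := H.simple
  have hkU : π.ker ≤ U := hU ▸ MonoidHom.ker_le_comap _ _
  have hDcard : ∀ m, m ∉ U → Nat.card (Dm U m) = 3 * Nat.card π.ker := by
    intro m hm
    have h1 : Dm U m = (Dm B (π m)).comap π := by
      ext d
      rw [Subgroup.mem_comap, mem_Dm, mem_Dm, hU, Subgroup.mem_comap, Subgroup.mem_comap]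
      simp
    rw [h1, card_sub H.surj _ (MonoidHom.ker_le_comap _ _), Subgroup.map_comap_eq_self_of_surjective H.surj, hB,
      Dm_S H.card P (by rw [hU] at hm; rw [← hB]; exact hm)]
  have hUc : Nat.card U = 21 * Nat.card π.ker := by
    rw [hU, card_sub H.surj _ (MonoidHom.ker_le_comap _ _), Subgroup.map_comap_eq_self_of_surjective H.surj,
      hB, card_N7 H.card P]
  have hND : ∀ m, ∀ l : π.ker, (l : X) ∈ Dm U m := by
    intro m l
    rw [mem_Dm]
    exact ⟨hkU l.2, hkU (Subgroup.Normal.conj_mem inferInstance _ l.2 m)⟩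
  let j : ∀ m, π.ker →* Dm U m := fun m => (π.ker.subtype).codRestrict (Dm U m) (hND m)
  have hirr := lem8 U hα (3 * Nat.card π.ker) hDcard (by
      rw [hUc, H.cardX]
      have : 168 * Nat.card π.ker - 21 * Nat.card π.ker = 147 * Nat.card π.ker := by omega
      rw [this]; ring)
    (by
      intro m _
      apply (hα.isChar.comp (Dm1 U m)).irr_of_res (j m)
      have : (fun k => α (Dm1 U m (j m k))) = θ := by
        ext l; exact hr l _
      rw [this]; exact hθ)
    (by
      intro m _
      apply (hα.isChar.comp (Dm2 U m)).irr_of_res (j m)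
      have : (fun k => α (Dm2 U m (j m k))) = θ := by
        ext l
        have h1 : m ∈ (EN π).stab θ := by rw [hst]; trivial
        rw [← h1 l]
        exact hr ((EN π).a m l) _
      rw [this]; exact hθ) hm
  have h1 := deg_ind hα.isChar U.subtype U.subtype_injective
  have h2 : deg α = deg θ := by
    have : deg (fun k : π.ker => α (Subgroup.inclusion hkU k)) = deg θ := by
      congr 1; ext l; exact hr l _
    rw [← this, deg_res]
  rw [hUc, H.cardX, h2] at h1
  have h3 : deg (Ind U.subtype α) = 8 * deg θ := by
    have h0 : 0 < 21 * Nat.card π.ker := by have := Nat.card_pos (α := π.ker); omega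
    apply Nat.eq_of_mul_eq_mul_left h0
    rw [h1]; ring
  have := H.deg8 hirr (by rw [h3]; exact Dvd.intro _ rfl)
  omega
theorem Hyp.A2 (H : Hyp π CD) {θ : π.ker → ℂ} (hθ : IsIrr θ) (hT : Tb π θ = ⊤) : deg θ = 1 := by
  have := H.simple
  have hst : (EN π).stab θ = ⊤ := by
    rw [eq_top_iff]
    intro x _
    rw [← mem_Tb hθ, hT]; trivial
  let P : Sylow 7 S := default
  have hP7 : Nat.card P = 7 := card_P7 H.card P
  obtain ⟨B, hB⟩ : ∃ B, B = Subgroup.normalizer (P : Set S) := ⟨_, rfl⟩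
  obtain ⟨U, hU⟩ : ∃ U, U = B.comap π := ⟨_, rfl⟩
  have hkU : π.ker ≤ U := hU ▸ MonoidHom.ker_le_comap _ _
  have hPB : (P : Subgroup S) ≤ B := by rw [hB]; exact Subgroup.le_normalizer
  have hB21 : Nat.card B = 21 := by rw [hB]; exact card_N7 H.card P
  have hUc : Nat.card U = 21 * Nat.card π.ker := by
    rw [hU, card_sub H.surj _ (MonoidHom.ker_le_comap _ _), Subgroup.map_comap_eq_self_of_surjective H.surj, hB21]
  have hVc : Nat.card ((P : Subgroup S).comap π) = 7 * Nat.card π.ker := by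
    rw [card_sub H.surj _ (MonoidHom.ker_le_comap _ _), Subgroup.map_comap_eq_self_of_surjective H.surj, hP7]
  have hPn : ((P : Subgroup S).subgroupOf B).Normal := by rw [hB]; exact Subgroup.normal_in_normalizer
  have hPi : ((P : Subgroup S).subgroupOf B).index = 3 := by
    have h1 := Subgroup.card_mul_index ((P : Subgroup S).subgroupOf B)
    rw [Nat.card_congr (Subgroup.subgroupOfEquivOfLe hPB).toEquiv, hB21] at h1
    have h2 : Nat.card P = 7 := hP7
    have h3 : Nat.card (P : Subgroup S) = 7 := hP7
    rw [h3] at h1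
    omega
  -- the extension
  let πU : U →* B := (π.comp U.subtype).codRestrict B (fun u => hU.le u.2)
  let V : Subgroup U := ((P : Subgroup S).subgroupOf B).comap πU
  have hVU : Nat.card V = 7 * Nat.card π.ker := by
    rw [← hVc]
    refine Nat.card_congr ⟨fun x => ⟨x.1.1, x.2⟩, fun x => ⟨⟨x.1, ?_⟩, x.2⟩, fun x => rfl, fun x => rfl⟩
    rw [hU]; exact hPB x.2
  let E : Nrm π.ker U := (EN π).res U (fun l => hkU l.2)
  let E2 : Nrm V U := Nrm.ofSub V
  have hLV : ∀ l : π.ker, E.ι l ∈ V := by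
    intro l
    have h1 : πU (E.ι l) = 1 := Subtype.ext l.2
    refine Subgroup.mem_comap.mpr ?_
    rw [h1]; exact Subgroup.one_mem _
  let E1 : Nrm π.ker V := E.res V hLV
  obtain ⟨α, hα, hαθ⟩ := tower_ext E E1 E2 (fun l => rfl) hVU (by rw [hVU, hUc]; ring) hθ (by
    rw [Nrm.stab_res, hst]; rfl)
  have hr : ∀ l : π.ker, ∀ h, α ⟨l, h⟩ = θ l := fun l h => congrFun hαθ l
  -- the linear character
  obtain ⟨c, hc⟩ := exists_prime_orderOf_dvd_card' (G := B) 3 (by rw [hB21]; norm_num)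
  have hc3 : orderOf (c : S) = 3 := by rw [Subgroup.orderOf_coe, hc]
  have hcP : c ∉ (P : Subgroup S).subgroupOf B := by
    intro h
    have h2 := Subgroup.orderOf_dvd_natCard (P : Subgroup S) (x := (c : S)) h
    have h3 : Nat.card (P : Subgroup S) = 7 := hP7
    rw [h3, hc3] at h2
    norm_num at h2
  obtain ⟨l, hl⟩ := exists_lin_prime ((P : Subgroup S).subgroupOf B) (by norm_num : Nat.Prime 3) hPi
  have hlc : l c ≠ 1 := fun h => hcP ((hl c).2.mp h)
  obtain ⟨-, m', hm'⟩ := cent3 H.card hc3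
  obtain ⟨m, rfl⟩ := H.surj m'
  have hl2 : ∀ d : B, (d : S) = (c : S)⁻¹ → l d = l c → False := by
    intro d hd h
    have hd' : d = c⁻¹ := Subtype.ext hd
    subst hd'
    apply hlc
    have h1 : l (c : B)⁻¹ * l c = 1 := by rw [← map_mul, inv_mul_cancel, map_one]
    rw [h] at h1
    calc l c = l c ^ 3 := by rw [pow_succ, pow_two, h1, one_mul]
      _ = 1 := (hl c).1
  have hmB : π m ∉ B := by
    intro h
    refine hl2 ((⟨π m, h⟩ : B) * c * (⟨π m, h⟩ : B)⁻¹) hm' ?_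
    rw [map_mul, map_mul, mul_right_comm, ← map_mul, mul_inv_cancel, map_one, one_mul]
  have hmU : m ∉ U := by rw [hU]; exact hmB
  by_contra hne
  have f1 : (fun x => α (Dm1 U m x)) = (fun x => α (Dm2 U m x)) := by
    by_contra h
    exact hne (H.A2aux P hθ hst B hB U hU hα hr ⟨m, hmU, h⟩)
  let lU : U →* ℂ := l.comp πU
  have hlU : IsIrr (fun u => lU u) := isIrr_lin lU
  have hlk : ∀ l' : π.ker, ∀ h, lU ⟨l', h⟩ = 1 := by
    intro l' h
    have h1 : πU ⟨l', h⟩ = 1 := Subtype.ext l'.2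
    change l (πU ⟨l', h⟩) = 1
    rw [h1, map_one]
  have hlU1 : deg (fun u => lU u) = 1 := by
    have := hlU.isChar.deg_eq
    simp only [map_one] at this
    exact_mod_cast this.symm
  have f2 : (fun x => (α * fun u => lU u) (Dm1 U m x)) = (fun x => (α * fun u => lU u) (Dm2 U m x)) := by
    by_contra h
    refine hne (H.A2aux P hθ hst B hB U hU (hα.mul_lin hlU hlU1) ?_ ⟨m, hmU, h⟩)
    intro l' h
    rw [Pi.mul_apply, hlk, mul_one]; exact hr l' h
  -- alpha vanishes off the kernel in D
  have hD3 : Nat.card (Dm B (π m)) = 3 := by subst hB; exact Dm_S H.card P hmB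
  have hcD : (c : S) ∈ Dm B (π m) := by
    rw [mem_Dm]
    refine ⟨c.2, ?_⟩
    rw [hm']; exact B.inv_mem c.2
  have hDz : Dm B (π m) = Subgroup.zpowers (c : S) := by
    symm
    apply Subgroup.eq_of_le_of_card_ge
    · rw [Subgroup.zpowers_le]; exact hcD
    · rw [hD3, Nat.card_zpowers, hc3]
  have hND : ∀ l : π.ker, (l : X) ∈ Dm U m := by
    intro l
    rw [mem_Dm]
    exact ⟨hkU l.2, hkU (Subgroup.Normal.conj_mem inferInstance _ l.2 m)⟩
  have hDU : Dm U m = (Dm B (π m)).comap π := by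
    ext d
    rw [Subgroup.mem_comap, mem_Dm, mem_Dm, hU, Subgroup.mem_comap, Subgroup.mem_comap]
    simp
  have hDc : Nat.card (Dm U m) = 3 * Nat.card π.ker := by
    rw [hDU, card_sub H.surj _ (MonoidHom.ker_le_comap _ _), Subgroup.map_comap_eq_self_of_surjective H.surj, hD3]
  let E3 : Nrm π.ker (Dm U m) := (EN π).res (Dm U m) hND
  have hvan : ∀ d : Dm U m, d ∉ E3.ι.range → α (Dm1 U m d) = 0 := by
    intro d hd
    have g1 := congrFun f1 d
    have g2 := congrFun f2 d
    simp only [Pi.mul_apply] at g1 g2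
    rw [← g1] at g2
    by_contra h0
    have g3 := mul_left_cancel₀ h0 g2
    have hy : π d ∈ Subgroup.zpowers (c : S) := by
      rw [← hDz]
      exact hDU.le d.2
    have hy1 : π d ≠ 1 := by
      intro h
      exact hd ⟨⟨d, h⟩, rfl⟩
    have hyinv : π m * π d * (π m)⁻¹ = (π d)⁻¹ := by
      obtain ⟨k, hk⟩ := Subgroup.mem_zpowers_iff.mp hy
      rw [← hk, ← conj_zpow, hm', inv_zpow]
    have hyB : π d ∈ B := (mem_Dm.mp (hDz ▸ hy : π d ∈ Dm B (π m))).1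
    let y : B := ⟨π d, hyB⟩
    have q1 : lU (Dm1 U m d) = l y := rfl
    have q2 : lU (Dm2 U m d) = l y⁻¹ := by
      change l (πU _) = _
      congr 1
      apply Subtype.ext
      change π (m * d * m⁻¹) = (π d)⁻¹
      rw [map_mul, map_mul, map_inv, hyinv]
    rw [q1, q2] at g3
    have hy3 : l y = 1 := by
      have h1 : l y⁻¹ * l y = 1 := by rw [← map_mul, inv_mul_cancel, map_one]
      rw [← g3] at h1
      calc l y = l y ^ 3 := by rw [pow_succ, pow_two, h1, one_mul]
        _ = 1 := (hl y).1
    have hcy : (c : S) ∈ Subgroup.zpowers (π d) := by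
      have hz : Subgroup.zpowers (π d) = Subgroup.zpowers (c : S) := by
        apply Subgroup.eq_of_le_of_card_ge
        · rw [Subgroup.zpowers_le]; exact hy
        · rw [Nat.card_zpowers, Nat.card_zpowers]
          have h5 : orderOf (π d) ∣ 3 := by
            have := Subgroup.orderOf_dvd_natCard _ hy
            rwa [Nat.card_zpowers, hc3] at this
          rcases (Nat.dvd_prime (by norm_num)).mp h5 with h | h
          · exact absurd (orderOf_eq_one_iff.mp h) hy1
          · rw [h, hc3]
      rw [hz]; exact Subgroup.mem_zpowers _
    obtain ⟨k, hk⟩ := Subgroup.mem_zpowers_iff.mp hcy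
    have hck : c = y ^ k := Subtype.ext (by rw [← hk]; rfl)
    apply hlc
    have h6 : y ∈ (P : Subgroup S).subgroupOf B := (hl y).2.mp hy3
    exact (hl c).2.mpr (hck ▸ Subgroup.zpow_mem _ h6 k)
  have hiD : IsIrr (fun x => α (Dm1 U m x)) := by
    apply (hα.isChar.comp (Dm1 U m)).irr_of_res E3.ι
    have : (fun k => α (Dm1 U m (E3.ι k))) = θ := by
      ext l; exact hr l _
    rw [this]; exact hθ
  have hfin := E3.ip_range (p := 3) (by norm_num) hDc (fun x => α (Dm1 U m x)) (fun x => α (Dm1 U m x)) hvan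
  have : (fun k => α (Dm1 U m (E3.ι k))) = θ := by
    ext l; exact hr l _
  rw [ip_irr_self hiD] at hfin
  simp only [this] at hfin
  rw [ip_irr_self hθ] at hfin
  norm_num at hfin
end main
end
end CT

open CategoryTheory
set_option linter.unusedSectionVars false
set_option linter.style.haveILetI false

namespace CT
noncomputable section
open ComplexConjugate

variable {G : Type} [Group G] [Finite G]

section main
variable {X S : Type} [Group X] [Finite X] [Group S] [Finite S] {π : X →* S} {CD : Set ℕ}

theorem cnt_lemma {A : Type} (s : Finset A) (m : A → ℕ) (hm : ∀ a ∈ s, m a ≤ 4) : ∃ c1 c2 c3 c4 : ℕ,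
    ∑ a ∈ s, m a ^ 2 = c1 + 4 * c2 + 9 * c3 + 16 * c4 ∧ (s.filter (fun a => ¬ 3 ∣ m a)).card = c1 + c2 + c4 ∧
    (c1 ≠ 0 ↔ ∃ a ∈ s, m a = 1) ∧ (c2 ≠ 0 ↔ ∃ a ∈ s, m a = 2) ∧ (c3 ≠ 0 ↔ ∃ a ∈ s, m a = 3) ∧
    (c4 ≠ 0 ↔ ∃ a ∈ s, m a = 4) := by
  classical
  induction s using Finset.induction_on with
  | empty => exact ⟨0, 0, 0, 0, by simp⟩
  | insert a s ha ih =>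
    obtain ⟨c1, c2, c3, c4, h1, h2, h3, h4, h5, h6⟩ := ih (fun b hb => hm b (Finset.mem_insert_of_mem hb))
    have := hm a (Finset.mem_insert_self _ _)
    have hmem : ∀ k, (∃ b ∈ insert a s, m b = k) ↔ m a = k ∨ ∃ b ∈ s, m b = k := by
      intro k; simp
    have hna : a ∉ s.filter (fun a => ¬ 3 ∣ m a) := fun h => ha (Finset.mem_filter.mp h).1
    simp only [hmem, Finset.sum_insert ha, h1, Finset.filter_insert]
    rw [← h3, ← h4, ← h5, ← h6]
    obtain h | h | h | h | h : m a = 0 ∨ m a = 1 ∨ m a = 2 ∨ m a = 3 ∨ m a = 4 := by omega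
    · refine ⟨c1, c2, c3, c4, ?_⟩
      rw [h, if_neg (by norm_num), h2]
      refine ⟨by ring, rfl, ?_, ?_, ?_, ?_⟩ <;> simp
    · refine ⟨c1 + 1, c2, c3, c4, ?_⟩
      rw [h, if_pos (by norm_num), Finset.card_insert_of_notMem hna, h2]
      refine ⟨by ring, by ring, ?_, ?_, ?_, ?_⟩ <;> simp
    · refine ⟨c1, c2 + 1, c3, c4, ?_⟩
      rw [h, if_pos (by norm_num), Finset.card_insert_of_notMem hna, h2]
      refine ⟨by ring, by ring, ?_, ?_, ?_, ?_⟩ <;> simp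
    · refine ⟨c1, c2, c3 + 1, c4, ?_⟩
      rw [h, if_neg (by norm_num), h2]
      refine ⟨by ring, by ring, ?_, ?_, ?_, ?_⟩ <;> simp
    · refine ⟨c1, c2, c3, c4 + 1, ?_⟩
      rw [h, if_pos (by norm_num), Finset.card_insert_of_notMem hna, h2]
      refine ⟨by ring, by ring, ?_, ?_, ?_, ?_⟩ <;> simp

theorem Hyp.mm_sq_le (H : Hyp π CD) {θ : π.ker → ℂ} (hθ : IsIrr θ) {χ : X → ℂ} (hχ : IsIrr χ) :
    mm π χ θ ^ 2 ≤ Nat.card (Tb π θ) := by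
  rw [← H.sum hθ]
  exact Finset.single_le_sum (f := fun ψ : X → ℂ => mm π ψ θ ^ 2) (s := IrrF X)
      (fun _ _ => Nat.zero_le _) (mem_IrrF.mpr hχ)

theorem Hyp.full_deg (H : Hyp π CD) {θ : π.ker → ℂ} (hθ : IsIrr θ) (hT : Tb π θ = ⊤) {χ : X → ℂ} (hχ : IsIrr χ)
    (hm : mm π χ θ ≠ 0) : deg χ ∈ ({1, 2, 3, 4, 6, 7, 8, 12} : Finset ℕ) := by
  have hθ1 := H.A2 hθ hT
  have hst : (EN π).stab θ = ⊤ := by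
    rw [eq_top_iff]
    intro x _
    rw [← mem_Tb hθ, hT]; trivial
  have ht : Nat.card (Tb π θ) = 168 := by rw [hT, Subgroup.card_top, H.card]
  have h1 := H.cliff hθ hχ hm
  rw [ht, hθ1, mul_one] at h1
  have h2 : deg χ = mm π χ θ := Nat.eq_of_mul_eq_mul_left (by norm_num) h1
  have h3 := H.mm_sq_le hθ hχ
  rw [ht] at h3
  have hz : π.ker ≤ Zc χ := by
    intro l hl
    apply hχ.isChar.mem_Zc
    have h4 := (EN π).clifford_fun hχ hθ hm ⟨l, hl⟩
    have h5 : ∀ x : X, θ ((EN π).a x ⟨l, hl⟩) = θ ⟨l, hl⟩ := fun x => by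
      have : x ∈ (EN π).stab θ := by rw [hst]; trivial
      exact this _
    rw [gs_congr h5, gs_const, hst, Subgroup.card_top] at h4
    have h6 : χ l = mm π χ θ * θ ⟨l, hl⟩ := by
      apply mul_left_cancel₀ (card_ne (G := X))
      refine h4.trans ?_
      ring
    rw [h6, h2, norm_mul, hθ.norm_of_mem_Zc (hθ.lin_Zc hθ1 _), hθ1]
    simp
  have h4 := hχ.deg_dvd_index π.ker hz
  rw [Subgroup.index_ker, MonoidHom.range_eq_top.mpr H.surj, Subgroup.card_top, H.card] at h4
  have h5 : deg χ ≤ 12 := by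
    rw [h2]; by_contra hc
    have : 13 ≤ mm π χ θ := by omega
    have := Nat.pow_le_pow_left this 2
    omega
  generalize deg χ = d at h4 h5
  have := hχ.deg_pos
  interval_cases d <;> revert h4 <;> decide

/-- generic character of the kernel -/
structure Gen (π : X →* S) (θ : π.ker → ℂ) : Prop where
  irr : IsIrr θ
  one : ∃ χ : X → ℂ, IsIrr χ ∧ deg χ = 7 * deg θ
  two : ∃ χ : X → ℂ, IsIrr χ ∧ deg χ = 14 * deg θ
  three : ∃ χ : X → ℂ, IsIrr χ ∧ deg χ = 21 * deg θ
  all : ∀ χ : X → ℂ, IsIrr χ → mm π χ θ ≠ 0 → deg χ = 7 * deg θ ∨ deg χ = 14 * deg θ ∨ deg χ = 21 * deg θ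

theorem Hyp.eight_case (H : Hyp π CD) {θ : π.ker → ℂ} (hθ : IsIrr θ) (ht : Nat.card (Tb π θ) = 8) :
    ∃ χ : X → ℂ, IsIrr χ ∧ mm π χ θ = 2 := by
  have := H.simple
  have hle : ∀ χ : X → ℂ, IsIrr χ → mm π χ θ ≤ 2 := by
    intro χ hχ
    have := H.mm_sq_le hθ hχ
    by_contra hc
    have h3 : 3 ≤ mm π χ θ := by omega
    have := Nat.pow_le_pow_left h3 2
    omega
  obtain ⟨χ, hχ, hm⟩ := (EN π).exists_over hθ
  have hm' : mm π χ θ ≠ 0 := hm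
  by_cases h2 : mm π χ θ = 2
  · exact ⟨χ, hχ, h2⟩
  have h1 : mm π χ θ = 1 := by have := hle χ hχ; omega
  obtain ⟨a, ha, b, hb, hab⟩ := nonab8 H.card (Tb π θ) ht
  obtain ⟨x, hx, rfl⟩ := ha
  obtain ⟨y, hy, rfl⟩ := hb
  have hK : (π.ker.subgroupOf ((EN π).stab θ)).Normal := inferInstance
  obtain ⟨β, hβ, hk, hd⟩ := exists_nonlin (π.ker.subgroupOf ((EN π).stab θ)) (a := ⟨x, hx⟩) (b := ⟨y, hy⟩) (by
    intro h
    rw [Subgroup.mem_subgroupOf, MonoidHom.mem_ker] at h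
    simp only [Subgroup.coe_mul, Subgroup.coe_inv, map_mul, map_inv] at h
    apply hab
    rw [mul_inv_eq_one, mul_inv_eq_iff_eq_mul] at h
    exact h)
  obtain ⟨χ', hχ', hm', -⟩ := (EN π).gal hθ hχ h1 hβ (fun l => hk (Subgroup.mem_subgroupOf.mpr l.2))
  refine ⟨χ', hχ', ?_⟩
  have h3 := hle χ' hχ'
  have h4 : mm π χ' θ = deg β := hm'
  have := hβ.deg_pos
  omega

theorem Hyp.B0 (H : Hyp π CD) {θ : π.ker → ℂ} (hθ : IsIrr θ) : Tb π θ = ⊤ ∨ Gen π θ ∨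
    (∃ χ0 : X → ℂ, IsIrr χ0 ∧ 28 * deg θ ∣ deg χ0 ∧ ∀ χ : X → ℂ, IsIrr χ → mm π χ θ ≠ 0 →
      deg χ = 14 * deg θ ∨ 28 ∣ deg χ ∨ 42 ∣ deg χ) ∨
    (∃ χ0 : X → ℂ, IsIrr χ0 ∧ 42 * deg θ ∣ deg χ0 ∧ ∀ χ : X → ℂ, IsIrr χ → mm π χ θ ≠ 0 →
      deg χ = 14 * deg θ ∨ deg χ = 21 * deg θ ∨ 28 ∣ deg χ ∨ 42 ∣ deg χ) := by
  classical
  by_cases h7 : 7 ∣ Nat.card (Tb π θ)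
  · exact Or.inl (H.A1 hθ h7)
  right
  have hdv : Nat.card (Tb π θ) ∣ 24 := by
    have h1 := H.tdvd θ
    rw [show 168 = 7 * 24 by norm_num] at h1
    exact Nat.Coprime.dvd_of_dvd_mul_left (((Nat.Prime.coprime_iff_not_dvd (by norm_num)).mpr h7).symm) h1
  have hcl : ∀ χ : X → ℂ, IsIrr χ → mm π χ θ ≠ 0 → Nat.card (Tb π θ) * deg χ = 168 * (mm π χ θ * deg θ) :=
    fun χ hχ hm => H.cliff hθ hχ hm
  obtain ⟨χ1, hχ1, hm1⟩ := (EN π).exists_over hθ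
  have hm1' : mm π χ1 θ ≠ 0 := hm1
  have hmem : Nat.card (Tb π θ) ∈ Nat.divisors 24 := Nat.mem_divisors.mpr ⟨hdv, by norm_num⟩
  rw [show Nat.divisors 24 = {1, 2, 3, 4, 6, 8, 12, 24} by decide] at hmem
  have hsm : ∀ χ : X → ℂ, IsIrr χ → mm π χ θ ≤ 4 := by
    intro χ hχ
    have h1 := H.mm_sq_le hθ hχ
    have h2 := Nat.le_of_dvd (by norm_num) hdv
    by_contra hc
    have h3 : 5 ≤ mm π χ θ := by omega
    have := Nat.pow_le_pow_left h3 2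
    omega
  have hcount : 3 ∣ Nat.card (Tb π θ) → ∃ c1 c2 c3 c4 : ℕ,
      Nat.card (Tb π θ) = c1 + 4 * c2 + 9 * c3 + 16 * c4 ∧ c1 + c2 + c4 ≤ 3 ∧
      (c1 ≠ 0 ↔ ∃ a ∈ IrrF X, mm π a θ = 1) ∧ (c2 ≠ 0 ↔ ∃ a ∈ IrrF X, mm π a θ = 2) ∧
      (c3 ≠ 0 ↔ ∃ a ∈ IrrF X, mm π a θ = 3) ∧ (c4 ≠ 0 ↔ ∃ a ∈ IrrF X, mm π a θ = 4) := by
    intro h3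
    obtain ⟨c1, c2, c3, c4, h1, h2, h4⟩ := cnt_lemma (IrrF X) (fun χ => mm π χ θ)
      (fun χ hχ => hsm χ (mem_IrrF.mp hχ))
    refine ⟨c1, c2, c3, c4, ?_, ?_, h4⟩
    · rw [← h1, H.sum hθ]
    · have h5 := H.lemC hθ h3
      rw [← h2]
      convert h5
  simp only [Finset.mem_insert, Finset.mem_singleton] at hmem
  rcases hmem with h | h | h | h | h | h | h | h
  · exfalso
    have h1 := hcl χ1 hχ1 hm1
    rw [h] at h1
    have h2 : deg χ1 = 8 * (21 * (mm π χ1 θ * deg θ)) := by omega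
    have := H.deg8 hχ1 (by rw [h2]; exact Dvd.intro _ rfl)
    omega
  · right; right
    have h1 : ∀ χ : X → ℂ, IsIrr χ → mm π χ θ ≠ 0 → deg χ = 42 * (2 * (mm π χ θ * deg θ)) := by
      intro χ hχ hm
      have := hcl χ hχ hm
      rw [h] at this; omega
    refine ⟨χ1, hχ1, ?_, ?_⟩
    · rw [h1 χ1 hχ1 hm1]; exact ⟨2 * mm π χ1 θ, by ring⟩
    · intro χ hχ hm
      rw [h1 χ hχ hm]; right; right; right; exact Dvd.intro _ rfl
  · exfalso
    have h1 := hcl χ1 hχ1 hm1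
    rw [h] at h1
    have h2 : deg χ1 = 8 * (7 * (mm π χ1 θ * deg θ)) := by omega
    have := H.deg8 hχ1 (by rw [h2]; exact Dvd.intro _ rfl)
    omega
  · right; right
    have h1 : ∀ χ : X → ℂ, IsIrr χ → mm π χ θ ≠ 0 → deg χ = 42 * (mm π χ θ * deg θ) := by
      intro χ hχ hm
      have := hcl χ hχ hm
      rw [h] at this; omega
    refine ⟨χ1, hχ1, ?_, ?_⟩
    · rw [h1 χ1 hχ1 hm1]; exact ⟨mm π χ1 θ, by ring⟩
    · intro χ hχ hm
      rw [h1 χ hχ hm]; right; right; right; exact Dvd.intro _ rfl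
  · right; left
    have h1 : ∀ χ : X → ℂ, IsIrr χ → mm π χ θ ≠ 0 → deg χ = 28 * (mm π χ θ * deg θ) := by
      intro χ hχ hm
      have := hcl χ hχ hm
      rw [h] at this; omega
    refine ⟨χ1, hχ1, ?_, ?_⟩
    · rw [h1 χ1 hχ1 hm1]; exact ⟨mm π χ1 θ, by ring⟩
    · intro χ hχ hm
      rw [h1 χ hχ hm]; right; left; exact Dvd.intro _ rfl
  · right; right
    have h1 : ∀ χ : X → ℂ, IsIrr χ → mm π χ θ ≠ 0 → deg χ = 21 * (mm π χ θ * deg θ) := by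
      intro χ hχ hm
      have := hcl χ hχ hm
      rw [h] at this; omega
    obtain ⟨χ0, hχ0, h0⟩ := H.eight_case hθ h
    refine ⟨χ0, hχ0, ?_, ?_⟩
    · rw [h1 χ0 hχ0 (by rw [h0]; norm_num), h0]; exact ⟨1, by ring⟩
    · intro χ hχ hm
      have h2 := H.mm_sq_le hθ hχ
      rw [h] at h2
      have h3 : mm π χ θ = 1 ∨ mm π χ θ = 2 := by
        have := hsm χ hχ
        interval_cases mm π χ θ <;> omega
      rw [h1 χ hχ hm]
      rcases h3 with h3 | h3
      · right; left; rw [h3, one_mul]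
      · right; right; right; rw [h3]; exact ⟨deg θ, by ring⟩
  · right
    have h1 : ∀ χ : X → ℂ, IsIrr χ → mm π χ θ ≠ 0 → deg χ = 14 * (mm π χ θ * deg θ) := by
      intro χ hχ hm
      have := hcl χ hχ hm
      rw [h] at this; omega
    have h2 : ∀ χ : X → ℂ, IsIrr χ → mm π χ θ ≠ 0 → deg χ = 14 * deg θ ∨ 28 ∣ deg χ ∨ 42 ∣ deg χ := by
      intro χ hχ hm
      have h2 := H.mm_sq_le hθ hχ
      rw [h] at h2
      have h3 : mm π χ θ = 1 ∨ mm π χ θ = 2 ∨ mm π χ θ = 3 := by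
        have := hsm χ hχ
        interval_cases mm π χ θ <;> omega
      rw [h1 χ hχ hm]
      rcases h3 with h3 | h3 | h3
      · left; rw [h3, one_mul]
      · right; left; rw [h3]; exact ⟨deg θ, by ring⟩
      · right; right; rw [h3]; exact ⟨deg θ, by ring⟩
    obtain ⟨c1, c2, c3, c4, q1, q2, q3, q4, q5, q6⟩ := hcount (by rw [h]; norm_num)
    rw [h] at q1
    by_cases hc3 : c3 = 0
    · left
      have hc2 : c2 ≠ 0 := by omega
      obtain ⟨χ, hχ, hm⟩ := q4.mp hc2
      rw [mem_IrrF] at hχ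
      refine ⟨χ, hχ, ?_, h2⟩
      rw [h1 χ hχ (by rw [hm]; norm_num), hm]; exact ⟨1, by ring⟩
    · right
      obtain ⟨χ, hχ, hm⟩ := q5.mp hc3
      rw [mem_IrrF] at hχ
      refine ⟨χ, hχ, ?_, ?_⟩
      · rw [h1 χ hχ (by rw [hm]; norm_num), hm]; exact ⟨1, by ring⟩
      · intro χ hχ hm
        rcases h2 χ hχ hm with h3 | h3
        · exact Or.inl h3
        · exact Or.inr (Or.inr h3)
  · have h1 : ∀ χ : X → ℂ, IsIrr χ → mm π χ θ ≠ 0 → deg χ = 7 * (mm π χ θ * deg θ) := by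
      intro χ hχ hm
      have := hcl χ hχ hm
      rw [h] at this; omega
    obtain ⟨c1, c2, c3, c4, q1, q2, q3, q4, q5, q6⟩ := hcount (by rw [h]; norm_num)
    rw [h] at q1
    by_cases hc3 : c3 = 0
    · right; left
      have hc4 : c4 ≠ 0 := by omega
      have hc1 : c1 = 0 := by omega
      obtain ⟨χ, hχ, hm⟩ := q6.mp hc4
      rw [mem_IrrF] at hχ
      refine ⟨χ, hχ, ?_, ?_⟩
      · rw [h1 χ hχ (by rw [hm]; norm_num), hm]; exact ⟨1, by ring⟩
      · intro χ hχ hm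
        have g1 : mm π χ θ ≠ 1 := fun hh => (q3.mpr ⟨χ, mem_IrrF.mpr hχ, hh⟩) hc1
        have g3 : mm π χ θ ≠ 3 := fun hh => (q5.mpr ⟨χ, mem_IrrF.mpr hχ, hh⟩) hc3
        have g4 : mm π χ θ = 2 ∨ mm π χ θ = 4 := by have := hsm χ hχ; omega
        rw [h1 χ hχ hm]
        rcases g4 with h3 | h3
        · left; rw [h3]; ring
        · right; left; rw [h3]; exact ⟨deg θ, by ring⟩
    · left
      have hc4 : c4 = 0 := by omega
      have hc1 : c1 ≠ 0 := by omega
      have hc2 : c2 ≠ 0 := by omega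
      refine ⟨hθ, ?_, ?_, ?_, ?_⟩
      · obtain ⟨χ, hχ, hm⟩ := q3.mp hc1
        rw [mem_IrrF] at hχ
        exact ⟨χ, hχ, by rw [h1 χ hχ (by rw [hm]; norm_num), hm]; ring⟩
      · obtain ⟨χ, hχ, hm⟩ := q4.mp hc2
        rw [mem_IrrF] at hχ
        exact ⟨χ, hχ, by rw [h1 χ hχ (by rw [hm]; norm_num), hm]; ring⟩
      · obtain ⟨χ, hχ, hm⟩ := q5.mp hc3
        rw [mem_IrrF] at hχ
        exact ⟨χ, hχ, by rw [h1 χ hχ (by rw [hm]; norm_num), hm]; ring⟩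
      · intro χ hχ hm
        have g3 : mm π χ θ ≠ 4 := fun hh => (q6.mpr ⟨χ, mem_IrrF.mpr hχ, hh⟩) hc4
        have g4 : mm π χ θ = 1 ∨ mm π χ θ = 2 ∨ mm π χ θ = 3 := by have := hsm χ hχ; omega
        rw [h1 χ hχ hm]
        rcases g4 with h3 | h3 | h3 <;> rw [h3] <;> omega
end main
end
end CT

open CategoryTheory
set_option linter.unusedSectionVars false
set_option linter.style.haveILetI false

namespace CT
noncomputable section
open ComplexConjugate

variable {G : Type} [Group G] [Finite G]

section main
variable {X S : Type} [Group X] [Finite X] [Group S] [Finite S] {π : X →* S} {CD : Set ℕ}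

theorem Hyp.over (H : Hyp π CD) {χ : X → ℂ} (hχ : IsIrr χ) : ∃ f ∈ CD, f = deg χ ∨ f = 2 * deg χ := by
  rcases H.up χ hχ with h | h
  · exact ⟨_, h, Or.inl rfl⟩
  · exact ⟨_, h, Or.inr rfl⟩

theorem Gen.prime (H : Hyp π CD) {θ : π.ker → ℂ} (h : Gen π θ) : deg θ = 1 ∨ (deg θ).Prime := by
  by_contra! hcon
  obtain ⟨χ1, hχ1, h1⟩ := h.one
  obtain ⟨χ3, hχ3, h3⟩ := h.three
  obtain ⟨f1, hf1, g1⟩ := H.over hχ1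
  obtain ⟨f3, hf3, g3⟩ := H.over hχ3
  obtain ⟨p, hp, k, hk⟩ := Nat.exists_prime_and_dvd hcon.1
  have hk1 : k ≠ 1 := by
    rintro rfl
    rw [mul_one] at hk
    exact hcon.2 (hk ▸ hp)
  have h7 : 7 * p * k = 7 * deg θ := by rw [hk]; ring
  have hpos := h.irr.deg_pos
  have := H.tp2 hf1 hf3 (by norm_num : Nat.Prime 7) hp hk1 (by
      rw [h7]
      rcases g1 with g | g <;> rw [g, h1]
      exact Dvd.intro_left 2 rfl) (by
      rw [h7]
      rcases g3 with g | g <;> rw [g, h3]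
      · exact ⟨3, by ring⟩
      · exact ⟨6, by ring⟩)
  omega

/-- generic prime degrees -/
def RP (π : X →* S) : Set ℕ := {r | r.Prime ∧ ∃ θ, Gen π θ ∧ deg θ = r}

theorem Hyp.B1 (H : Hyp π CD) {f : ℕ} (hf : f ∈ CD) : f ∈ ({1, 2, 3, 4, 6, 7, 8, 12, 14, 21} : Finset ℕ) ∨ 28 ∣ f ∨ 42 ∣ f ∨
    ∃ r ∈ RP π, f = 7 * r ∨ f = 14 * r ∨ f = 21 * r := by
  obtain ⟨χ, hχ, hfχ⟩ := H.down f hf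
  obtain ⟨θ, hθ, hm⟩ := (EN π).exists_under hχ
  have h2 : Nat.Prime 2 := by norm_num
  have h3 : Nat.Prime 3 := by norm_num
  have h7 : Nat.Prime 7 := by norm_num
  have tpa : ∀ f0 ∈ CD, ∀ a b : ℕ, a.Prime → b.Prime → deg θ ≠ 1 → a * b * deg θ ∣ f0 → a * b * deg θ ∣ f → f = f0 :=
    fun f0 h0 a b ha hb hd h1 h2 => H.tp2 hf h0 ha hb hd h2 h1
  rcases H.B0 hθ with hT | hg | ⟨χ0, hχ0, hd0, hall⟩ | ⟨χ0, hχ0, hd0, hall⟩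
  · left
    have h1 := H.full_deg hθ hT hχ hm
    have h16 : f ≠ 16 := by
      rintro rfl
      have := H.tp3 hf H.eight h2 h2 h2 (by norm_num) (by norm_num)
      omega
    have h24 : f ≠ 24 := by
      rintro rfl
      have := H.tp3 hf H.eight h2 h2 h2 (by norm_num) (by norm_num)
      omega
    simp only [Finset.mem_insert, Finset.mem_singleton] at h1 ⊢
    omega
  · have h1 := hg.all χ hχ hm
    rcases hg.prime H with hd | hd
    · rw [hd] at h1
      simp only [Finset.mem_insert, Finset.mem_singleton]
      omega
    · have hr : deg θ ∈ RP π := ⟨hd, θ, hg, rfl⟩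
      have : 28 ∣ f ∨ 42 ∣ f ∨ (f = 7 * deg θ ∨ f = 14 * deg θ ∨ f = 21 * deg θ) := by omega
      rcases this with h | h | h
      · exact Or.inr (Or.inl h)
      · exact Or.inr (Or.inr (Or.inl h))
      · exact Or.inr (Or.inr (Or.inr ⟨_, hr, h⟩))
  · obtain ⟨f0, hf0, g0⟩ := H.over hχ0
    have hd0' : 28 * deg θ ∣ f0 := by
      rcases g0 with g | g <;> rw [g]
      · exact hd0
      · exact hd0.mul_left 2
    have h28 : 28 ∣ f0 := (Dvd.intro _ rfl).trans hd0'
    have h1 := hall χ hχ hm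
    have key : f = 14 * deg θ → deg θ = 1 ∨ f = f0 := by
      intro h
      by_cases hd : deg θ = 1
      · exact Or.inl hd
      · right
        refine tpa f0 hf0 2 7 h2 h7 hd (Dvd.dvd.trans ⟨2, by ring⟩ hd0') (by rw [h])
    by_cases hfe : f = 14 * deg θ
    · rcases key hfe with h | h
      · left; rw [hfe, h]; decide
      · right; left; rw [h]; exact h28
    · have : 28 ∣ f ∨ 42 ∣ f := by omega
      tauto
  · obtain ⟨f0, hf0, g0⟩ := H.over hχ0
    have hd0' : 42 * deg θ ∣ f0 := by
      rcases g0 with g | g <;> rw [g]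
      · exact hd0
      · exact hd0.mul_left 2
    have h42 : 42 ∣ f0 := (Dvd.intro _ rfl).trans hd0'
    have h1 := hall χ hχ hm
    by_cases hfe : f = 14 * deg θ
    · by_cases hd : deg θ = 1
      · left; rw [hfe, hd]; decide
      · right; right; left
        rw [tpa f0 hf0 2 7 h2 h7 hd (Dvd.dvd.trans ⟨3, by ring⟩ hd0') (by rw [hfe])]
        exact h42
    by_cases hfe : f = 21 * deg θ
    · by_cases hd : deg θ = 1
      · left; rw [hfe, hd]; decide
      · right; right; left
        rw [tpa f0 hf0 3 7 h3 h7 hd (Dvd.dvd.trans ⟨2, by ring⟩ hd0') (by rw [hfe])]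
        exact h42
    have : 28 ∣ f ∨ 42 ∣ f := by omega
    tauto

/-- property dagger -/
theorem Hyp.dagger (H : Hyp π CD) {r : ℕ} (hr : r ∈ RP π) {φ : π.ker → ℂ} (hφ : IsIrr φ) (hd : r ∣ deg φ) :
    deg φ = r := by
  obtain ⟨hp, θ, hg, rfl⟩ := hr
  obtain ⟨χ2, hχ2, h2⟩ := hg.two
  obtain ⟨f2, hf2, g2⟩ := H.over hχ2
  have hpos := hφ.deg_pos
  have hbig : ∀ χ0 : X → ℂ, IsIrr χ0 → (28 * deg φ ∣ deg χ0 ∨ 42 * deg φ ∣ deg χ0) → deg φ = deg θ := by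
    intro χ0 hχ0 h
    obtain ⟨f0, hf0, g0⟩ := H.over hχ0
    obtain ⟨k, hk⟩ := hd
    have h14 : 14 * deg φ ∣ deg χ0 := by
      rcases h with h | h
      · exact Dvd.dvd.trans ⟨2, by ring⟩ h
      · exact Dvd.dvd.trans ⟨3, by ring⟩ h
    have hdv : 2 * 7 * deg θ ∣ f0 := by
      have : 2 * 7 * deg θ ∣ 14 * deg φ := ⟨k, by rw [hk]; ring⟩
      rcases g0 with g | g <;> rw [g]
      · exact this.trans h14
      · exact (this.trans h14).mul_left 2
    have he := H.tp2 hf0 hf2 (by norm_num : Nat.Prime 2) (by norm_num : Nat.Prime 7) hp.one_lt.ne' hdv (by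
      rcases g2 with g | g <;> rw [g, h2]
      exact ⟨2, by ring⟩)
    have hge : 28 * deg φ ≤ deg χ0 := by
      rcases h with h | h
      · exact Nat.le_of_dvd hχ0.deg_pos h
      · have := Nat.le_of_dvd hχ0.deg_pos h
        omega
    have h1 : deg φ ≤ deg θ := by omega
    exact le_antisymm h1 (Nat.le_of_dvd hpos ⟨k, hk⟩)
  rcases H.B0 hφ with hT | hg' | ⟨χ0, hχ0, hd0, -⟩ | ⟨χ0, hχ0, hd0, -⟩
  · rw [H.A2 hφ hT] at hd
    exact absurd (Nat.dvd_one.mp hd) hp.one_lt.ne'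
  · rcases hg'.prime H with h | h
    · rw [h] at hd
      exact absurd (Nat.dvd_one.mp hd) hp.one_lt.ne'
    · exact ((Nat.prime_dvd_prime_iff_eq hp h).mp hd).symm
  · exact hbig χ0 hχ0 (Or.inl hd0)
  · exact hbig χ0 hχ0 (Or.inr hd0)

theorem Hyp.bound (H : Hyp π CD) (h3 : ∀ a b c, a ∈ RP π → b ∈ RP π → c ∈ RP π → a < b → b < c → False) :
    CD.ncard ≤ 18 := by
  classical
  have hRfin : (RP π).Finite := by
    apply Set.Finite.subset ((IrrF π.ker).image deg).finite_toSet
    rintro r ⟨-, θ, hg, rfl⟩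
    exact Finset.mem_coe.mpr (Finset.mem_image_of_mem _ (mem_IrrF.mpr hg.irr))
  have hR2 : (RP π).ncard ≤ 2 := by
    by_contra hc
    obtain ⟨a, ha, b, hb, c, hc, hab, hac, hbc⟩ := (Set.two_lt_ncard hRfin).mp (by omega)
    have h1 := h3 a b c ha hb hc
    have h2 := h3 a c b ha hc hb
    have h4 := h3 b a c hb ha hc
    have h5 := h3 b c a hb hc ha
    have h6 := h3 c a b hc ha hb
    have h7 := h3 c b a hc hb ha
    grind
  have s28 : {f | f ∈ CD ∧ 28 ∣ f}.Subsingleton := by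
    rintro a ⟨ha, ha'⟩ b ⟨hb, hb'⟩
    exact H.tp3 ha hb (by norm_num : Nat.Prime 2) (by norm_num : Nat.Prime 2) (by norm_num : Nat.Prime 7) ha' hb'
  have s42 : {f | f ∈ CD ∧ 42 ∣ f}.Subsingleton := by
    rintro a ⟨ha, ha'⟩ b ⟨hb, hb'⟩
    exact H.tp3 ha hb (by norm_num : Nat.Prime 2) (by norm_num : Nat.Prime 3) (by norm_num : Nat.Prime 7) ha' hb'
  have := s28.finite.to_subtype
  have := s42.finite.to_subtype
  have n28 := Set.ncard_le_one_iff_subsingleton.mpr s28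
  have n42 := Set.ncard_le_one_iff_subsingleton.mpr s42
  let A : Finset ℕ := {1, 2, 3, 4, 6, 7, 8, 12, 14, 21}
  have nA : (A : Set ℕ).ncard = 10 := by rw [Set.ncard_coe_finset]; rfl
  let W : Set ℕ := (((((A : Set ℕ) ∪ {f | f ∈ CD ∧ 28 ∣ f}) ∪ {f | f ∈ CD ∧ 42 ∣ f}) ∪ Set.image (fun r => 7 * r) (RP π))
    ∪ Set.image (fun r => 14 * r) (RP π)) ∪ Set.image (fun r => 21 * r) (RP π)
  have hsub : CD ⊆ W := by
    intro f hf
    rcases H.B1 hf with h | h | h | ⟨r, hr, h | h | h⟩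
    · left; left; left; left; left; exact h
    · left; left; left; left; right; exact ⟨hf, h⟩
    · left; left; left; right; exact ⟨hf, h⟩
    · left; left; right; exact ⟨r, hr, h.symm⟩
    · left; right; exact ⟨r, hr, h.symm⟩
    · right; exact ⟨r, hr, h.symm⟩
  have hWfin : W.Finite :=
    (((((A.finite_toSet.union s28.finite).union s42.finite).union (hRfin.image _)).union (hRfin.image _)).union
      (hRfin.image _))
  refine (Set.ncard_le_ncard hsub hWfin).trans ?_
  have i7 := (Set.ncard_image_le (f := fun r => 7 * r) hRfin).trans hR2
  have i14 := (Set.ncard_image_le (f := fun r => 14 * r) hRfin).trans hR2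
  have i21 := (Set.ncard_image_le (f := fun r => 21 * r) hRfin).trans hR2
  refine (Set.ncard_union_le _ _).trans ?_
  refine (Nat.add_le_add_right (Set.ncard_union_le _ _) _).trans ?_
  refine (Nat.add_le_add_right (Nat.add_le_add_right (Set.ncard_union_le _ _) _) _).trans ?_
  refine (Nat.add_le_add_right (Nat.add_le_add_right (Nat.add_le_add_right (Set.ncard_union_le _ _) _) _) _).trans ?_
  refine (Nat.add_le_add_right (Nat.add_le_add_right (Nat.add_le_add_right (Nat.add_le_add_right
    (Set.ncard_union_le _ _) _) _) _) _).trans ?_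
  omega
end main
end
end CT

open CategoryTheory
set_option linter.unusedSectionVars false
set_option linter.style.haveILetI false

namespace CT
noncomputable section
open ComplexConjugate

variable {G : Type} [Group G] [Finite G]

theorem solv_aux (n : ℕ) : ∀ (Γ : Type) [Group Γ] [Finite Γ] (J : Subgroup Γ), Nat.card Γ = n →
    (∀ a ∈ J, ∀ b ∈ J, a * b = b * a) → J.index.Prime → Group.IsSolvable Γ := by
  induction n using Nat.strong_induction_on with
  | _ n ih =>
  intro Γ _ _ J hn hJ hr
  have hJc : ∀ a b : J, a * b = b * a := fun a b => Subtype.ext (hJ a a.2 b b.2)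
  have hJs : Group.IsSolvable J := Group.isSolvable_of_comm hJc
  by_cases hN : J.Normal
  · have hq : Group.IsSolvable (Γ ⧸ J) := by
      have h1 : Nat.card (Γ ⧸ J) = J.index := rfl
      have : Fact (J.index.Prime) := ⟨hr⟩
      have := isCyclic_of_prime_card h1
      let := IsCyclic.commGroup (α := Γ ⧸ J)
      exact Group.isSolvable_of_comm (fun a b => mul_comm a b)
    exact Group.isSolvable_of_ker_le_range J.subtype (QuotientGroup.mk' J) (by simp)
  have hmax : ∀ C : Subgroup Γ, J ≤ C → C = J ∨ C = ⊤ := by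
    intro C hC
    have h1 := Subgroup.relIndex_mul_index hC
    rcases (Nat.dvd_prime hr).mp (Dvd.intro _ h1) with h | h
    · left
      exact le_antisymm (Subgroup.relIndex_eq_one.mp h) hC
    · right
      rw [h] at h1
      have : C.index = 1 := by
        have := hr.pos
        exact Nat.eq_of_mul_eq_mul_left this (by rw [h1, mul_one])
      exact Subgroup.index_eq_one.mp this
  by_cases hZ : Subgroup.center Γ ⊓ J = ⊥
  · obtain ⟨g, hg⟩ : ∃ g, g ∉ J := by
      by_contra! hcon
      rw [(Subgroup.eq_top_iff' J).mpr hcon, Subgroup.index_top] at hr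
      exact absurd hr (by norm_num)
    have hgJ : ∃ y ∈ J, g * y * g⁻¹ ∉ J := by
      by_contra! hcon
      have hn1 : g ∈ Subgroup.normalizer (J : Set Γ) := by
        have : J.map (MulAut.conj g).toMonoidHom = J := by
          apply Subgroup.eq_of_le_of_card_ge
          · rintro _ ⟨y, hy, rfl⟩
            exact hcon y hy
          · rw [Subgroup.card_map_of_injective (MulAut.conj g).injective]
        refine Subgroup.mem_normalizer_iff.mpr fun h => ⟨fun hh => hcon h hh, fun hh => ?_⟩
        rw [← this] at hh
        obtain ⟨y, hy, hy2⟩ := hh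
        have : y = h := by
          have : g * y * g⁻¹ = g * h * g⁻¹ := hy2
          simpa using this
        exact this ▸ hy
      rcases hmax _ (Subgroup.le_normalizer (H := J)) with h | h
      · rw [h] at hn1; exact hg hn1
      · exact hN (Subgroup.normalizer_eq_top_iff.mp h)
    obtain ⟨y, hy, hgy⟩ := hgJ
    have hcard : Nat.card J < J.index := by
      let F : J → Γ ⧸ J := fun j => ((j * g : Γ) : Γ ⧸ J)
      have hF : Function.Injective F := by
        intro a b hab
        have h1 : (a * g : Γ)⁻¹ * (b * g) ∈ J := QuotientGroup.eq.mp hab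
        have hx : (a : Γ)⁻¹ * b ∈ Subgroup.center Γ ⊓ J := by
          refine ⟨?_, J.mul_mem (J.inv_mem a.2) b.2⟩
          have hxJ : (a : Γ)⁻¹ * b ∈ J := J.mul_mem (J.inv_mem a.2) b.2
          have h2 : g⁻¹ * ((a : Γ)⁻¹ * b) * g ∈ J := by
            have : (a * g : Γ)⁻¹ * (b * g) = g⁻¹ * ((a : Γ)⁻¹ * b) * g := by group
            rwa [this] at h1
          have hC : Subgroup.centralizer {(a : Γ)⁻¹ * b} = ⊤ := by
            rcases hmax (Subgroup.centralizer {(a : Γ)⁻¹ * b}) (by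
              intro c hc
              rw [Subgroup.mem_centralizer_singleton_iff]
              exact hJ _ hc _ hxJ) with h | h
            · exfalso
              apply hgy
              rw [← h, Subgroup.mem_centralizer_singleton_iff]
              have h3 := hJ _ hy _ h2
              calc g * y * g⁻¹ * ((a : Γ)⁻¹ * b) = g * (y * (g⁻¹ * ((a : Γ)⁻¹ * b) * g)) * g⁻¹ := by group
                _ = _ := by rw [h3]; group
            · exact h
          refine Subgroup.mem_center_iff.mpr ?_
          intro c
          have : c ∈ Subgroup.centralizer {(a : Γ)⁻¹ * b} := by rw [hC]; trivial
          rw [Subgroup.mem_centralizer_singleton_iff] at this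
          exact this
        rw [hZ, Subgroup.mem_bot, inv_mul_eq_one] at hx
        exact Subtype.ext hx
      have hns : ¬ Function.Surjective F := by
        intro hs
        obtain ⟨j, hj⟩ := hs ((1 : Γ) : Γ ⧸ J)
        have h1 := QuotientGroup.eq.mp hj
        rw [mul_one, mul_inv_rev] at h1
        apply hg
        have := J.mul_mem h1 j.2
        rw [inv_mul_cancel_right] at this
        exact inv_inv g ▸ J.inv_mem this
      have hle := Nat.card_le_card_of_injective F hF
      refine lt_of_le_of_ne hle ?_
      intro he
      exact hns ((Nat.bijective_iff_injective_and_card F).mpr ⟨hF, he⟩).2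
    have : Fact (J.index.Prime) := ⟨hr⟩
    let P : Sylow J.index Γ := default
    have hcop : Nat.Coprime J.index (Nat.card J) :=
      (Nat.Prime.coprime_iff_not_dvd hr).mpr (Nat.not_dvd_of_pos_of_lt Nat.card_pos hcard)
    have hPc : Nat.card P = J.index := by
      rw [P.card_eq_multiplicity, ← Subgroup.card_mul_index J,
        Nat.factorization_mul Nat.card_pos.ne' hr.ne_zero, Finsupp.add_apply, hr.factorization_self,
        Nat.factorization_eq_zero_of_not_dvd ((Nat.Prime.coprime_iff_not_dvd hr).mp hcop), zero_add, pow_one]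
    have hPi : (P : Subgroup Γ).index = Nat.card J := by
      have h1 := Subgroup.card_mul_index (P : Subgroup Γ)
      rw [← Subgroup.card_mul_index J, mul_comm (Nat.card J)] at h1
      have h2 : Nat.card (P : Subgroup Γ) = J.index := hPc
      rw [h2] at h1
      exact Nat.eq_of_mul_eq_mul_left hr.pos h1
    have hs1 : Nat.card (Sylow J.index Γ) = 1 := by
      have h1 := Sylow.card_dvd_index P
      rw [hPi] at h1
      have h2 := Nat.le_of_dvd Nat.card_pos h1
      have h3 := card_sylow_modEq_one J.index Γ
      unfold Nat.ModEq at h3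
      rw [Nat.mod_eq_of_lt (lt_of_le_of_lt h2 hcard), Nat.mod_eq_of_lt hr.one_lt] at h3
      exact h3
    have hPn : (P : Subgroup Γ).Normal := by
      have := (Nat.card_eq_one_iff_unique.mp hs1).1
      exact Sylow.normal_of_subsingleton P
    have hsup : J ⊔ (P : Subgroup Γ) = ⊤ := by
      rw [← Subgroup.index_eq_one]
      have h1 := Subgroup.index_dvd_of_le (le_sup_left : J ≤ J ⊔ (P : Subgroup Γ))
      have h2 := Subgroup.index_dvd_of_le (le_sup_right : (P : Subgroup Γ) ≤ J ⊔ (P : Subgroup Γ))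
      rw [hPi] at h2
      exact Nat.eq_one_of_dvd_coprimes hcop h1 h2
    have hq : Group.IsSolvable (Γ ⧸ (P : Subgroup Γ)) := by
      apply Group.isSolvable_of_surjective (f := (QuotientGroup.mk' (P : Subgroup Γ)).comp J.subtype)
      rw [← MonoidHom.range_eq_top, MonoidHom.range_comp, Subgroup.range_subtype]
      have h1 : (J ⊔ (P : Subgroup Γ)).map (QuotientGroup.mk' (P : Subgroup Γ)) = ⊤ := by
        rw [hsup]; exact Subgroup.map_top_of_surjective _ (QuotientGroup.mk'_surjective _)
      rw [Subgroup.map_sup] at h1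
      rw [← h1, left_eq_sup]
      rintro _ ⟨x, hx, rfl⟩
      have : (QuotientGroup.mk' (P : Subgroup Γ)) x = 1 := (QuotientGroup.eq_one_iff x).mpr hx
      rw [this]; exact Subgroup.one_mem _
    have hPs : Group.IsSolvable (P : Subgroup Γ) := by
      have : Group.IsNilpotent (P : Subgroup Γ) := P.isPGroup'.isNilpotent
      infer_instance
    exact Group.isSolvable_of_ker_le_range (P : Subgroup Γ).subtype (QuotientGroup.mk' (P : Subgroup Γ)) (by simp)
  · set Z := Subgroup.center Γ ⊓ J with hZd
    have hZn : Z.Normal := by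
      refine ⟨fun z hz g => ?_⟩
      have : g * z * g⁻¹ = z := by
        rw [Subgroup.mem_center_iff.mp hz.1 g, mul_inv_cancel_right]
      rw [this]; exact hz
    have hlt : Nat.card (Γ ⧸ Z) < n := by
      rw [← hn, ← Subgroup.card_mul_index Z]
      have h1 : 1 < Nat.card Z := (Subgroup.one_lt_card_iff_ne_bot Z).mpr hZ
      have h2 : Nat.card (Γ ⧸ Z) = Z.index := rfl
      rw [h2]
      have h3 : 0 < Z.index := Nat.pos_of_ne_zero Subgroup.index_ne_zero_of_finite
      nlinarith
    have hq : Group.IsSolvable (Γ ⧸ Z) := by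
      refine ih _ hlt (Γ ⧸ Z) (J.map (QuotientGroup.mk' Z)) rfl ?_ ?_
      · rintro _ ⟨a, ha, rfl⟩ _ ⟨b, hb, rfl⟩
        rw [← map_mul, hJ a ha b hb, map_mul]
      · rw [Subgroup.index_map, QuotientGroup.ker_mk', sup_eq_left.mpr inf_le_right,
          MonoidHom.range_eq_top.mpr (QuotientGroup.mk'_surjective _), Subgroup.index_top, mul_one]
        exact hr
    have hZs : Group.IsSolvable Z := Group.isSolvable_of_comm (fun a b => Subtype.ext (hJ _ a.2.2 _ b.2.2))
    exact Group.isSolvable_of_ker_le_range Z.subtype (QuotientGroup.mk' Z) (by simp)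
end
end CT

open CategoryTheory
set_option linter.unusedSectionVars false
set_option linter.style.haveILetI false

namespace CT
noncomputable section
open ComplexConjugate

variable {G : Type} [Group G] [Finite G]

theorem IsIrr.Zc_of_comm {f : G → ℂ} (hf : IsIrr f) {g : G} (hA : ∀ a, a * g * a⁻¹ * g⁻¹ ∈ kerc f) : g ∈ Zc f := by
  have hf' := hf
  obtain ⟨V, _, _, _, ρ, hρ, hρf⟩ := hf
  have hd : (Module.finrank ℂ V : ℂ) = deg f := by
    rw [deg, ← hρf, Representation.char_one]; simp
  have hker : ∀ a ∈ kerc f, ρ a = 1 := by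
    intro a ha
    have h1 := hf'.norm_of_mem_Zc (kerc_le_Zc f ha)
    have h2 : (deg f : ℝ) = Module.finrank ℂ V := by exact_mod_cast hd.symm
    rw [← hρf] at h1
    obtain ⟨c, hc⟩ := (rep_norm_le ρ a).2 (by rw [h1, hρf, h2])
    have h3 := hf'.mem_kerc.mp ha
    rw [← hρf, Representation.char_one, Representation.character, hc, map_smul, smul_eq_mul,
      LinearMap.trace_one] at h3
    have h4 : (Module.finrank ℂ V : ℂ) ≠ 0 := by
      rw [hd]; exact_mod_cast hf'.deg_pos.ne'
    have : c = 1 := mul_right_cancel₀ h4 (by rw [h3, one_mul])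
    rw [hc, this, one_smul]
  obtain ⟨c, hc⟩ := schur ρ hρ (ρ g) (by
    intro a
    have h1 := hker _ (hA a)
    have h2 : ρ (a * g) = ρ (g * a) := by
      rw [show a * g = a * g * a⁻¹ * g⁻¹ * (g * a) by group, map_mul, h1, one_mul]
    rw [map_mul, map_mul] at h2
    exact h2.symm)
  have hh : ∀ h, f (g * h) = c * f h := by
    intro h
    rw [← hρf, Representation.character, Representation.character, map_mul, hc, smul_mul_assoc, one_mul, map_smul,
      smul_eq_mul]
  refine ⟨c, ?_, hh⟩
  rintro rfl
  have := hh g⁻¹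
  rw [mul_inv_cancel, zero_mul] at this
  exact hf'.one_ne this

theorem IsIrr.lin_of_comm {f : G → ℂ} (hf : IsIrr f) (h : ∀ a b, a * b * a⁻¹ * b⁻¹ ∈ kerc f) : deg f = 1 := by
  have := hf.deg_dvd_index ⊤ (fun g _ => hf.Zc_of_comm (fun a => h a g))
  rw [Subgroup.index_top] at this
  exact Nat.dvd_one.mp this

/-- all constituents are linear -/
def AllLin (f : G → ℂ) : Prop := ∀ l, IsIrr l → mlt f l ≠ 0 → deg l = 1

theorem AllLin.comm {f : G → ℂ} (h : AllLin f) (hf : IsChar f) (a b : G) : f (a * b * a⁻¹ * b⁻¹) = f 1 := by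
  rw [hf.expand]
  simp only [Finset.sum_apply, Pi.smul_apply]
  apply Finset.sum_congr rfl
  intro χ hχ
  by_cases h0 : mlt f χ = 0
  · simp [h0]
  · have hi := mem_IrrF.mp hχ
    rw [hi.mem_kerc.mp (hi.lin_comm (h χ hi h0) a b)]

theorem const_mul_lin {f g φ : G → ℂ} (hf : IsIrr f) (hg : IsChar g) (h : AllLin g) (hφ : IsIrr φ)
    (hm : mlt (f * g) φ ≠ 0) : deg φ = deg f := by
  by_contra hne
  apply hm
  have h1 : ip (f * g) φ = 0 := by
    have e : f * g = ∑ χ ∈ IrrF G, (mlt g χ : ℂ) • (f * χ) := by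
      conv_lhs => rw [hg.expand]
      rw [Finset.mul_sum]
      apply Finset.sum_congr rfl
      intro χ _
      rw [mul_smul_comm]
    rw [e, ip_sum_left]
    apply Finset.sum_eq_zero
    intro χ hχ
    rw [ip_smul_left]
    by_cases h0 : mlt g χ = 0
    · simp [h0]
    · have hi := mem_IrrF.mp hχ
      have h2 := h χ hi h0
      have h3 := hf.mul_lin hi h2
      rw [ip_irr_ne h3 hφ, mul_zero]
      rintro rfl
      apply hne
      have e1 := h3.isChar.deg_eq
      rw [Pi.mul_apply, hf.isChar.deg_eq, hi.isChar.deg_eq, h2] at e1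
      exact_mod_cast (by simpa using e1.symm : (deg (f * χ) : ℂ) = deg f)
  have h2 := (hf.isChar.mul hg).mlt_irr hφ
  rw [h1] at h2
  exact_mod_cast h2.symm

section nrm
variable {L X : Type} [Group L] [Group X] [Finite L] [Finite X] (E : Nrm L X)

theorem Nrm.clifford_idx {χ : X → ℂ} (hχ : IsIrr χ) {θ : L → ℂ} (hθ : IsIrr θ)
    (h : mlt (fun l => χ (E.ι l)) θ ≠ 0) :
    deg χ = mlt (fun l => χ (E.ι l)) θ * ((E.stab θ).index * deg θ) := by
  have h1 := E.clifford_deg hχ hθ h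
  rw [← Subgroup.card_mul_index (E.stab θ)] at h1
  apply Nat.eq_of_mul_eq_mul_left (Nat.card_pos (α := E.stab θ))
  rw [h1]; ring

theorem Nrm.deg_dvd {χ : X → ℂ} (hχ : IsIrr χ) {θ : L → ℂ} (hθ : IsIrr θ)
    (h : mlt (fun l => χ (E.ι l)) θ ≠ 0) : deg θ ∣ deg χ := by
  rw [E.clifford_idx hχ hθ h, ← mul_assoc]; exact dvd_mul_left _ _

theorem Nrm.dich {χ : X → ℂ} (hχ : IsIrr χ) (hr : (deg χ).Prime) :
    AllLin (fun l => χ (E.ι l)) ∨ IsIrr (fun l => χ (E.ι l)) := by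
  by_cases h : IsIrr (fun l => χ (E.ι l))
  · exact Or.inr h
  left
  intro l hl hm
  rcases (Nat.dvd_prime hr).mp (E.deg_dvd hχ hl hm) with h1 | h1
  · exact h1
  · exfalso
    apply h
    rw [(hχ.isChar.comp E.ι).eq_of_mlt_deg hl hm (by rw [deg_res, h1])]
    exact hl

theorem Nrm.Zc_of_stab {χ : X → ℂ} (hχ : IsIrr χ) {θ : L → ℂ} (hθ : IsIrr θ)
    (h : mlt (fun l => χ (E.ι l)) θ ≠ 0) (h1 : deg θ = 1) (hs : E.stab θ = ⊤) (l : L) : E.ι l ∈ Zc χ := by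
  classical
  have e := E.clifford_deg hχ hθ h
  rw [hs, h1, mul_one, Subgroup.card_top, mul_comm] at e
  have e := Nat.eq_of_mul_eq_mul_right Nat.card_pos e
  have hf := hχ.isChar.comp E.ι
  have h2 : χ (E.ι l) = (deg χ : ℂ) * θ l := by
    rw [show χ (E.ι l) = (fun l => χ (E.ι l)) l from rfl, hf.expand]
    simp only [Finset.sum_apply, Pi.smul_apply, smul_eq_mul]
    rw [Finset.sum_eq_single θ]
    · rw [← e]
    · intro ψ hψ hne
      have h3 := hf.deg_expand
      have h4 := mem_IrrF.mp hψ
      have h5 : mlt (fun l => χ (E.ι l)) ψ = 0 := by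
        by_contra h0
        have h6 : mlt (fun l => χ (E.ι l)) θ * deg θ + mlt (fun l => χ (E.ι l)) ψ * deg ψ ≤ deg χ := by
          rw [deg_res] at h3
          rw [h3, ← Finset.sum_pair (f := fun ψ : L → ℂ => mlt (fun l => χ (E.ι l)) ψ * deg ψ) (Ne.symm hne)]
          apply Finset.sum_le_sum_of_subset
          intro x hx
          rcases Finset.mem_insert.mp hx with rfl | hx
          · exact mem_IrrF.mpr hθ
          · rw [Finset.mem_singleton.mp hx]; exact hψ
        rw [h1, mul_one, ← e] at h6
        have := Nat.mul_pos (Nat.pos_of_ne_zero h0) h4.deg_pos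
        omega
      rw [h5]; simp
    · intro h; exact absurd (mem_IrrF.mpr hθ) h
  apply hχ.isChar.mem_Zc
  have := hθ.norm_of_mem_Zc (hθ.lin_Zc h1 l)
  rw [h2, norm_mul, this, h1]; simp

theorem Nrm.lemI {χ : X → ℂ} (hχ : IsIrr χ) (hr : (deg χ).Prime) (hl : AllLin (fun l => χ (E.ι l))) :
    deg χ ∣ E.ι.range.index := by
  obtain ⟨θ, hθ, hm⟩ := E.exists_under hχ
  have h1 := hl θ hθ hm
  have h2 := E.clifford_idx hχ hθ hm
  have hle : E.ι.range ≤ E.stab θ := by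
    rintro _ ⟨l, rfl⟩
    exact E.ι_mem_stab hθ.isChar.isCl l
  rw [h1, mul_one] at h2
  rcases (Nat.dvd_prime hr).mp (Dvd.intro_left _ h2.symm) with h3 | h3
  · apply hχ.deg_dvd_index
    rintro _ ⟨l, rfl⟩
    exact E.Zc_of_stab hχ hθ hm h1 (Subgroup.index_eq_one.mp h3) l
  · rw [← h3]; exact Subgroup.index_dvd_of_le hle

theorem Nrm.mul_dvd {θ ψ φ : X → ℂ} (hψ : IsIrr ψ) (hθ : IsIrr θ) (hφ : IsIrr φ)
    (hm : mlt (θ * ψ) φ ≠ 0) (h1 : IsIrr (fun l => θ (E.ι l))) (h2 : AllLin (fun l => ψ (E.ι l))) :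
    deg θ ∣ deg φ := by
  obtain ⟨η, hη, he⟩ := E.exists_under hφ
  have h3 : deg η = deg θ := by
    rw [← deg_res θ E.ι]
    apply const_mul_lin h1 (hψ.isChar.comp E.ι) h2 hη
    have := mlt_res_trans (G := X) (H := X) (MonoidHom.id X) E.ι (hθ.isChar.mul hψ.isChar) hη
    have e2 : mlt ((fun l => θ (E.ι l)) * (fun l => ψ (E.ι l))) η =
      ∑ ψ' ∈ IrrF X, mlt (θ * ψ) ψ' * mlt (fun k => ψ' (E.ι k)) η := this
    rw [e2]
    have h4 := Finset.single_le_sum (f := fun ψ' : X → ℂ => mlt (θ * ψ) ψ' * mlt (fun k => ψ' (E.ι k)) η)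
      (s := IrrF X) (fun _ _ => Nat.zero_le _) (mem_IrrF.mpr hφ)
    have := Nat.mul_pos (Nat.pos_of_ne_zero hm) (Nat.pos_of_ne_zero he)
    omega
  rw [← h3]; exact E.deg_dvd hφ hη he

/-- the subgroup `K_r` -/
theorem Nrm.exK (hc : ∀ a b : X, a * b * a⁻¹ * b⁻¹ ∈ E.ι.range) {θ ψ : X → ℂ} (hθ : IsIrr θ) (hψ : IsIrr ψ)
    (hr : (deg θ).Prime) (hs : (deg ψ).Prime) (hne : deg θ ≠ deg ψ)
    (h2 : AllLin (fun l => ψ (E.ι l))) {φ : X → ℂ} (hφ : IsIrr φ)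
    (hm : mlt (θ * ψ) φ ≠ 0) : deg θ ∣ deg φ := by
  have : Fact (deg θ).Prime := ⟨hr⟩
  let P : Sylow (deg θ) X := default
  let K : Subgroup X := (P : Subgroup X) ⊔ E.ι.range
  have hAK : E.ι.range ≤ K := le_sup_right
  have hK : K.Normal := by
    refine ⟨fun k hk g => ?_⟩
    have := K.mul_mem (hAK (hc g k)) hk
    rwa [inv_mul_cancel_right] at this
  have hKi : ¬ deg θ ∣ K.index := by
    intro hd
    have h3 := Subgroup.index_dvd_of_le (le_sup_left : (P : Subgroup X) ≤ K)
    exact P.not_dvd_index (hd.trans h3)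
  let EK := Nrm.ofSub K
  have hEK : EK.ι.range = K := Subgroup.range_subtype K
  have hθK : IsIrr (fun l => θ (EK.ι l)) := by
    rcases EK.dich hθ hr with h | h
    · have := EK.lemI hθ hr h
      rw [hEK] at this
      exact absurd this hKi
    · exact h
  refine EK.mul_dvd hψ hθ hφ hm hθK ?_
  rcases EK.dich hψ hs with h | h
  · exact h
  exfalso
  let F := E.res K (fun l => hAK ⟨l, rfl⟩)
  have hFr : F.ι.range = E.ι.range.subgroupOf K := by
    ext x
    constructor
    · rintro ⟨l, rfl⟩; exact ⟨l, rfl⟩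
    · rintro ⟨l, hl⟩; exact ⟨l, Subtype.ext hl⟩
  have h3 := F.lemI h (by rw [deg_res]; exact hs) h2
  rw [deg_res, hFr] at h3
  have h4 : (E.ι.range.subgroupOf K).index = E.ι.range.relIndex K := rfl
  have := E.range_normal
  rw [h4, Subgroup.relIndex_sup_right] at h3
  have h5 := h3.trans (Subgroup.relIndex_dvd_card _ _)
  obtain ⟨n, hn⟩ := IsPGroup.iff_card.mp P.isPGroup'
  have h6 : deg ψ ∣ deg θ ^ n := by rw [← hn]; exact h5
  exact hne ((Nat.prime_dvd_prime_iff_eq hs hr).mp (hs.dvd_of_dvd_pow h6)).symm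

theorem Nrm.lemS (hc : ∀ a b : X, a * b * a⁻¹ * b⁻¹ ∈ E.ι.range) {θ ψ : X → ℂ} (hθ : IsIrr θ) (hψ : IsIrr ψ)
    (hr : (deg θ).Prime) (hs : (deg ψ).Prime) (hne : deg θ ≠ deg ψ)
    (h1 : AllLin (fun l => θ (E.ι l))) (h2 : AllLin (fun l => ψ (E.ι l))) :
    ∃ φ : X → ℂ, IsIrr φ ∧ deg θ * deg ψ ∣ deg φ := by
  have h0 : θ * ψ ≠ 0 := by
    intro h
    have := congrFun h 1
    rw [Pi.mul_apply] at this
    exact (mul_ne_zero hθ.one_ne hψ.one_ne) this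
  obtain ⟨φ, hφ, hm⟩ := (hθ.isChar.mul hψ.isChar).exists_const h0
  refine ⟨φ, hφ, Nat.Coprime.mul_dvd_of_dvd_of_dvd ((Nat.coprime_primes hr hs).mpr hne) ?_ ?_⟩
  · exact E.exK hc hθ hψ hr hs hne h2 hφ hm
  · exact E.exK hc hψ hθ hs hr hne.symm h1 hφ (by rwa [mul_comm])
end nrm
end
end CT

open CategoryTheory
set_option linter.unusedSectionVars false
set_option linter.style.haveILetI false

namespace CT
noncomputable section
open ComplexConjugate

variable {G : Type} [Group G] [Finite G]

/-- divisibility rigidity -/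
def Dag (G : Type) [Group G] [Finite G] (R : Set ℕ) : Prop :=
  ∀ r ∈ R, r.Prime ∧ ∀ φ : G → ℂ, IsIrr φ → r ∣ deg φ → deg φ = r

variable {R : Set ℕ}

theorem Dag.star (hD : Dag G R) {ψ : G → ℂ} (hψ : IsIrr ψ) (hr : deg ψ ∈ R) (L : Subgroup G) [L.Normal] :
    (∀ a b : G, a * b * a⁻¹ * b⁻¹ ∈ L) ∨ AllLin (fun l : L => ψ l) := by
  rcases (Nrm.ofSub L).dich hψ (hD _ hr).1 with h | h
  · exact Or.inr h
  left
  by_contra! hcon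
  obtain ⟨a, b, hab⟩ := hcon
  obtain ⟨β, hβ, hk, hd⟩ := exists_nonlin L hab
  have h1 := (Nrm.ofSub L).gallagher hψ h hβ (fun l => hk l.2)
  have h2 : deg (ψ * β) = deg ψ * deg β := by
    have e1 := h1.isChar.deg_eq
    rw [Pi.mul_apply, hψ.isChar.deg_eq, hβ.isChar.deg_eq] at e1
    exact_mod_cast e1.symm
  have h3 := (hD _ hr).2 _ h1 (Dvd.intro _ h2.symm)
  rw [h2] at h3
  apply hd
  exact Nat.eq_of_mul_eq_mul_left hψ.deg_pos (by rw [h3, mul_one])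

theorem comm_le_iff (L : Subgroup G) : commutator G ≤ L ↔ ∀ a b : G, a * b * a⁻¹ * b⁻¹ ∈ L := by
  rw [commutator_def, Subgroup.commutator_le]
  constructor
  · intro h a b; exact h a (Subgroup.mem_top _) b (Subgroup.mem_top _)
  · intro h a _ b _; exact h a b

theorem Dag.contra (hD : Dag G R) {φ : G → ℂ} (hφ : IsIrr φ) {r s : ℕ} (hr : r ∈ R) (hs : s ∈ R) (hne : r ≠ s)
    (hd : r * s ∣ deg φ) : False := by
  have h1 := (hD r hr).2 φ hφ ((Dvd.intro _ rfl).trans hd)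
  have h2 := (hD s hs).2 φ hφ ((Dvd.intro_left _ rfl).trans hd)
  exact hne (h1.symm.trans h2)

theorem Dag.np1 (hD : Dag G R) {θ ψ : G → ℂ} (hθ : IsIrr θ) (hψ : IsIrr ψ) (hr : deg θ ∈ R) (hs : deg ψ ∈ R)
    (hne : deg θ ≠ deg ψ) (h1 : AllLin (fun l : commutator G => θ l)) (h2 : AllLin (fun l : commutator G => ψ l)) : False := by
  obtain ⟨φ, hφ, hd⟩ := (Nrm.ofSub (commutator G)).lemS (by
    have : (Nrm.ofSub (commutator G)).ι.range = commutator G := Subgroup.range_subtype _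
    rw [this]; exact (comm_le_iff _).mp le_rfl) hθ hψ (hD _ hr).1 (hD _ hs).1 hne h1 h2
  exact hD.contra hφ hr hs hne hd

theorem Dag.np2 (hD : Dag G R) (hp : ¬ commutator G ≤ ⁅commutator G, commutator G⁆) {θ ψ : G → ℂ} (hθ : IsIrr θ) (hψ : IsIrr ψ)
    (hr : deg θ ∈ R) (hs : deg ψ ∈ R)
    (hne : deg θ ≠ deg ψ) (h1 : ¬ AllLin (fun l : commutator G => θ l)) (h2 : ¬ AllLin (fun l : commutator G => ψ l)) : False := by
  have a1 : IsIrr (fun l : commutator G => θ l) := ((Nrm.ofSub (commutator G)).dich hθ (hD _ hr).1).resolve_left h1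
  have a2 : IsIrr (fun l : commutator G => ψ l) := ((Nrm.ofSub (commutator G)).dich hψ (hD _ hs).1).resolve_left h2
  rw [comm_le_iff] at hp
  have b1 := (hD.star hθ hr ⁅commutator G, commutator G⁆).resolve_left hp
  have b2 := (hD.star hψ hs ⁅commutator G, commutator G⁆).resolve_left hp
  have d1 : deg (fun l : commutator G => θ l) = deg θ := deg_res θ (commutator G).subtype
  have d2 : deg (fun l : commutator G => ψ l) = deg ψ := deg_res ψ (commutator G).subtype
  have hle : ⁅commutator G, commutator G⁆ ≤ commutator G := Subgroup.commutator_le_left _ _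
  let E := (Nrm.ofSub ⁅commutator G, commutator G⁆).res (commutator G) (fun l => hle l.2)
  obtain ⟨φ, hφ, hd⟩ := E.lemS (by
    intro a b
    exact ⟨⟨a * b * a⁻¹ * b⁻¹, Subgroup.commutator_mem_commutator a.2 b.2⟩, Subtype.ext rfl⟩) a1 a2
    (by rw [d1]; exact (hD _ hr).1) (by rw [d2]; exact (hD _ hs).1) (by rwa [d1, d2]) b1 b2
  obtain ⟨χ, hχ, hm⟩ := (Nrm.ofSub (commutator G)).exists_over hφ
  rw [d1, d2] at hd
  exact hD.contra hχ hr hs hne (hd.trans ((Nrm.ofSub (commutator G)).deg_dvd hχ hφ hm))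

theorem Dag.perfect (hD : Dag G R) {θ₁ θ₂ θ₃ : G → ℂ} (h1 : IsIrr θ₁) (h2 : IsIrr θ₂) (h3 : IsIrr θ₃)
    (d1 : deg θ₁ ∈ R) (d2 : deg θ₂ ∈ R) (d3 : deg θ₃ ∈ R) (h12 : deg θ₁ ≠ deg θ₂) (h13 : deg θ₁ ≠ deg θ₃)
    (h23 : deg θ₂ ≠ deg θ₃) : commutator G ≤ ⁅commutator G, commutator G⁆ := by
  by_contra hp
  by_cases a1 : AllLin (fun l : commutator G => θ₁ l) <;> by_cases a2 : AllLin (fun l : commutator G => θ₂ l) <;>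
    by_cases a3 : AllLin (fun l : commutator G => θ₃ l)
  · exact hD.np1 h1 h2 d1 d2 h12 a1 a2
  · exact hD.np1 h1 h2 d1 d2 h12 a1 a2
  · exact hD.np1 h1 h3 d1 d3 h13 a1 a3
  · exact hD.np2 hp h2 h3 d2 d3 h23 a2 a3
  · exact hD.np1 h2 h3 d2 d3 h23 a2 a3
  · exact hD.np2 hp h1 h3 d1 d3 h13 a1 a3
  · exact hD.np2 hp h1 h2 d1 d2 h12 a1 a2
  · exact hD.np2 hp h1 h2 d1 d2 h12 a1 a2

theorem kerc_contra (hp : commutator G ≤ ⁅commutator G, commutator G⁆) {θ : G → ℂ} (hθ : IsIrr θ) (hd : deg θ ≠ 1)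
    (h : ∀ a ∈ commutator G, ∀ b ∈ commutator G, a * b * a⁻¹ * b⁻¹ ∈ kerc θ) : False := by
  apply hd
  apply hθ.lin_of_comm
  rw [← comm_le_iff]
  refine hp.trans ?_
  rw [Subgroup.commutator_le]
  exact h

theorem Dag.irrE (hD : Dag G R) (hp : commutator G ≤ ⁅commutator G, commutator G⁆) {θ : G → ℂ} (hθ : IsIrr θ)
    (hr : deg θ ∈ R) : IsIrr (fun l : commutator G => θ l) := by
  refine ((Nrm.ofSub (commutator G)).dich hθ (hD _ hr).1).resolve_left fun h => ?_
  apply kerc_contra hp hθ (hD _ hr).1.ne_one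
  intro a ha b hb
  rw [hθ.mem_kerc]
  exact h.comm (hθ.isChar.comp (commutator G).subtype) ⟨a, ha⟩ ⟨b, hb⟩

theorem solv_triv {Q : Type} [Group Q] (hs : Group.IsSolvable Q) (D : Subgroup Q) (hD : D ≤ ⁅D, D⁆) : D = ⊥ := by
  obtain ⟨n, hn⟩ := hs.solvable
  have : ∀ n, D ≤ derivedSeries Q n := by
    intro n
    induction n with
    | zero => simp
    | succ n ih =>
      rw [derivedSeries_succ]
      exact hD.trans (Subgroup.commutator_mono ih ih)
  rw [eq_bot_iff, ← hn]; exact this n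

theorem Dag.starstar (hD : Dag G R) (hp : commutator G ≤ ⁅commutator G, commutator G⁆) {θ : G → ℂ} (hθ : IsIrr θ)
    (hr : deg θ ∈ R) (L : Subgroup G) [L.Normal] (hL : ¬ commutator G ≤ L) : L ≤ Zc θ := by
  have ha := (hD.star hθ hr L).resolve_left (by rwa [← comm_le_iff])
  obtain ⟨l, hl, hm⟩ := (Nrm.ofSub L).exists_under hθ
  have h1 := ha l hl hm
  have h2 := (Nrm.ofSub L).clifford_idx hθ hl hm
  have hpr := (hD _ hr).1
  rw [h1, mul_one] at h2
  rcases (Nat.dvd_prime hpr).mp (Dvd.intro_left _ h2.symm) with h3 | h3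
  · intro z hz
    exact (Nrm.ofSub L).Zc_of_stab hθ hl hm h1 (Subgroup.index_eq_one.mp h3) ⟨z, hz⟩
  exfalso
  have hm1 : mlt (fun k => θ ((Nrm.ofSub L).ι k)) l = 1 := by
    apply Nat.eq_of_mul_eq_mul_right hpr.pos
    rw [one_mul, ← h3, ← h2, h3]
  set J := (Nrm.ofSub L).stab l with hJ
  have hLJ : ∀ k : L, (k : G) ∈ J := fun k => (Nrm.ofSub L).ι_mem_stab hl.isChar.isCl k
  have hcom : ∀ a b : J, a * b * a⁻¹ * b⁻¹ ∈ L.subgroupOf J := by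
    by_contra! hcon
    obtain ⟨a, b, hab⟩ := hcon
    obtain ⟨β, hβ, hk, hd⟩ := exists_nonlin (L.subgroupOf J) hab
    obtain ⟨χ, hχ, _, hdχ⟩ := (Nrm.ofSub L).gal hl hθ hm1 hβ (fun k => hk k.2)
    have h4 := (hD _ hr).2 χ hχ (Dvd.intro _ hdχ.symm)
    rw [hdχ] at h4
    exact hd (Nat.eq_of_mul_eq_mul_left hpr.pos (by rw [h4, mul_one]))
  have hs : Group.IsSolvable (G ⧸ L) := by
    refine solv_aux _ (G ⧸ L) (J.map (QuotientGroup.mk' L)) rfl ?_ ?_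
    · rintro _ ⟨a, ha, rfl⟩ _ ⟨b, hb, rfl⟩
      have h5 : a * b * a⁻¹ * b⁻¹ ∈ L := hcom ⟨a, ha⟩ ⟨b, hb⟩
      have h6 := (QuotientGroup.eq_one_iff _).mpr h5
      have h7 : (QuotientGroup.mk' L) (a * b * a⁻¹ * b⁻¹) = 1 := h6
      rw [map_mul, map_mul, map_mul, map_inv, map_inv, mul_inv_eq_one, mul_inv_eq_iff_eq_mul] at h7
      exact h7
    · rw [Subgroup.index_map, QuotientGroup.ker_mk', sup_eq_left.mpr (fun k hk => hLJ ⟨k, hk⟩),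
          MonoidHom.range_eq_top.mpr (QuotientGroup.mk'_surjective _), Subgroup.index_top, mul_one, h3]
      exact hpr
  have h8 := solv_triv hs ((commutator G).map (QuotientGroup.mk' L)) (by
    rw [← Subgroup.map_commutator]
    exact Subgroup.map_mono hp)
  apply hL
  rw [Subgroup.map_eq_bot_iff, QuotientGroup.ker_mk'] at h8
  exact h8

theorem not_le_Zc (hp : commutator G ≤ ⁅commutator G, commutator G⁆) {θ : G → ℂ} (hθ : IsIrr θ)
    (hd : deg θ ≠ 1) : ¬ commutator G ≤ Zc θ := fun h =>
  kerc_contra hp hθ hd (fun a _ b hb => hθ.comm_mem_kerc (h hb) a)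

theorem Dag.Zc_eq (hD : Dag G R) (hp : commutator G ≤ ⁅commutator G, commutator G⁆) {θ ψ : G → ℂ} (hθ : IsIrr θ)
    (hψ : IsIrr ψ) (hr : deg θ ∈ R) (hs : deg ψ ∈ R) : Zc θ = Zc ψ := by
  have n1 := hθ.isChar.isCl.Zc_normal
  have n2 := hψ.isChar.isCl.Zc_normal
  exact le_antisymm (hD.starstar hp hψ hs _ (not_le_Zc hp hθ (hD _ hr).1.ne_one))
    (hD.starstar hp hθ hr _ (not_le_Zc hp hψ (hD _ hs).1.ne_one))
end
end CT

open CategoryTheory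
set_option linter.unusedSectionVars false
set_option linter.style.haveILetI false

namespace CT
noncomputable section
open ComplexConjugate

variable {G : Type} [Group G] [Finite G]

theorem ip_supp (f h : G → ℂ) (K : Subgroup G) (c : ℂ) (hf : ∀ g, g ∉ K → f g = 0)
    (hc : ∀ g ∈ K, f g * conj (h g) = c) : ip f h * K.index = c := by
  have h1 : gs (fun g => f g * conj (h g)) = Nat.card K * c := by
    rw [gs_inj (fun k : K => (k : G)) Subtype.val_injective]
    · rw [← gs_const]
      exact gs_congr (fun k => hc k k.2)
    · intro z hz
      rw [hf z, zero_mul]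
      intro hk
      exact hz ⟨⟨z, hk⟩, rfl⟩
  rw [ip, h1, ← Subgroup.card_mul_index K]
  have : (Nat.card K : ℂ) ≠ 0 := by exact_mod_cast Nat.card_pos.ne'
  have h2 : (K.index : ℂ) ≠ 0 := by exact_mod_cast Subgroup.index_ne_zero_of_finite
  push_cast
  field_simp

theorem pgroup_deg {r : ℕ} (hr : r.Prime) (hG : IsPGroup r G) {f : G → ℂ} (hf : IsIrr f) : deg f = 1 ∨ r ∣ deg f := by
  have : Fact r.Prime := ⟨hr⟩
  obtain ⟨n, hn⟩ := IsPGroup.iff_card.mp hG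
  have h1 := hf.deg_dvd_index ⊥ bot_le
  rw [Subgroup.index_bot, hn] at h1
  obtain ⟨k, hk, h2⟩ := (Nat.dvd_prime_pow hr).mp h1
  rcases Nat.eq_zero_or_pos k with rfl | hk0
  · left; rw [h2, pow_zero]
  · right; rw [h2]; exact dvd_pow_self r hk0.ne'

theorem const_Zc {f l : G → ℂ} (hf : IsChar f) (hl : IsIrr l) (h1 : deg l = 1) (hm : mlt f l ≠ 0) {z : G} {c : ℂ}
    (hz : ∀ g, f (z * g) = c * f g) : c * conj (l z) = 1 := by
  have h2 : ip f l = c * conj (l z) * ip f l := by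
    have e : gs (fun g => f g * conj (l g)) = c * conj (l z) * gs (fun g => f g * conj (l g)) := by
      calc gs (fun g => f g * conj (l g)) = gs (fun g => f (Equiv.mulLeft z g) * conj (l (Equiv.mulLeft z g))) :=
            (gs_equiv (Equiv.mulLeft z) (fun g => f g * conj (l g))).symm
        _ = gs (fun g => c * conj (l z) * (f g * conj (l g))) := by
            apply gs_congr
            intro g
            rw [Equiv.coe_mulLeft, hz, hl.lin_mul h1, map_mul]; ring
        _ = _ := gs_mul _ _
    unfold ip
    rw [mul_left_comm, ← e]
  have h3 : ip f l ≠ 0 := by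
    rw [hf.mlt_irr hl]; exact_mod_cast hm
  exact (mul_right_cancel₀ h3 (by rw [one_mul]; exact h2)).symm

theorem case_alpha {r : ℕ} (hr : r.Prime) {f : G → ℂ} (hf : IsChar f) (hd : deg f = r) (K : Subgroup G) [K.Normal]
    (hK : ∀ z ∈ K, ∀ g, f (z * g) = f z / f 1 * f g) (h0 : ∀ g, g ∉ K → f g = 0) (hc : ∀ a b, f (a * b * a⁻¹ * b⁻¹) = f 1)
    (hne : K ≠ ⊤) : ∃ v, v ∉ K ∧ ∀ p, p ∈ Subgroup.zpowers v ⊔ K := by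
  have hf1 : f 1 = r := by rw [hf.deg_eq, hd]
  have hr0 : (r : ℂ) ≠ 0 := by exact_mod_cast hr.ne_zero
  obtain ⟨l, hl, hm⟩ := hf.exists_const (by
    intro h; rw [h] at hf1; exact hr0 hf1.symm)
  have hl1 : deg l = 1 := hl.lin_of_comm (fun a b => ker_of_const hf hl hm (hc a b))
  have h1 : ip f l * K.index = r := by
    apply ip_supp f l K _ h0
    intro g hg
    have := const_Zc hf hl hl1 hm (hK g hg)
    rw [hf1] at this
    field_simp at this
    exact this
  rw [hf.mlt_irr hl] at h1
  have h2 : mlt f l * K.index = r := by exact_mod_cast h1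
  have hKi : K.index = r := by
    rcases (Nat.dvd_prime hr).mp (Dvd.intro_left _ h2) with h | h
    · exact absurd (Subgroup.index_eq_one.mp h) hne
    · exact h
  obtain ⟨v, hv⟩ : ∃ v, v ∉ K := by
    by_contra! h
    exact hne ((Subgroup.eq_top_iff' K).mpr h)
  refine ⟨v, hv, fun p => ?_⟩
  have : Fact r.Prime := ⟨hr⟩
  have h3 := mem_zpowers_of_prime_card (G := G ⧸ K) (p := r) hKi (g := (v : G ⧸ K)) (g' := (p : G ⧸ K))
    (by rwa [Ne, QuotientGroup.eq_one_iff])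
  obtain ⟨k, hk⟩ := h3
  rw [Subgroup.mem_sup_of_normal_right]
  refine ⟨v ^ k, ⟨k, rfl⟩, (v ^ k)⁻¹ * p, ?_, by group⟩
  apply QuotientGroup.eq.mp
  exact hk

theorem chain {r : ℕ} (hr : r.Prime) (K C J : Subgroup G) (hKC : K ≤ C) (hKJ : K ≤ J) {a b : G} (ha : a ∉ K) (haC : a ∈ C)
    (haJ : a ∈ J) (hb : b ∉ C) (hbJ : b ∈ J) (hi : K.index = r ^ 2) : J = ⊤ := by
  have h1 : K.relIndex (J ⊓ C) * (J ⊓ C).index = r ^ 2 := by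
    rw [Subgroup.relIndex_mul_index (le_inf hKJ hKC), hi]
  have h2 := Subgroup.relIndex_mul_index (inf_le_left : J ⊓ C ≤ J)
  rw [← h2] at h1
  have n1 : K.relIndex (J ⊓ C) ≠ 1 := fun h => ha (Subgroup.relIndex_eq_one.mp h ⟨haJ, haC⟩)
  have n2 : (J ⊓ C).relIndex J ≠ 1 := fun h => hb (Subgroup.relIndex_eq_one.mp h hbJ).2
  have key : ∀ x, x ≠ 1 → x ∣ r ^ 2 → r ∣ x := by
    intro x hx hd
    obtain ⟨k, _, rfl⟩ := (Nat.dvd_prime_pow hr).mp hd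
    rcases Nat.eq_zero_or_pos k with rfl | hk
    · exact absurd (pow_zero _) hx
    · exact dvd_pow_self r hk.ne'
  obtain ⟨x, hx⟩ := key _ n1 (Dvd.intro _ h1)
  obtain ⟨y, hy⟩ := key ((J ⊓ C).relIndex J) n2 ⟨K.relIndex (J ⊓ C) * J.index, by rw [← h1]; ring⟩
  rw [hx, hy] at h1
  have h3 : x * y * J.index = 1 := by
    apply Nat.eq_of_mul_eq_mul_left (pow_pos hr.pos 2)
    rw [mul_one]; nth_rewrite 2 [← h1]; ring
  exact Subgroup.index_eq_one.mp (Nat.dvd_one.mp (Dvd.intro_left _ h3))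

/-- commutator subgroup-type set -/
def Wsub (V : Subgroup G) (q : G) (h : ∀ p x, q * x * q⁻¹ * x⁻¹ ∈ V → p * (q * x * q⁻¹ * x⁻¹) * p⁻¹ ∈ V) : Subgroup G where
  carrier := {p | q * p * q⁻¹ * p⁻¹ ∈ V}
  one_mem' := by simp
  mul_mem' := by
    intro x y hx hy
    have := V.mul_mem hx (h x y hy)
    simp only [Set.mem_setOf_eq]
    convert this using 1; group
  inv_mem' := by
    intro x hx
    have := V.inv_mem (h x⁻¹ x hx)
    simp only [Set.mem_setOf_eq]
    convert this using 1; group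

theorem mem_Wsub {V : Subgroup G} {q : G} {h : ∀ p x, q * x * q⁻¹ * x⁻¹ ∈ V → p * (q * x * q⁻¹ * x⁻¹) * p⁻¹ ∈ V} {p : G} :
    p ∈ Wsub V q h ↔ q * p * q⁻¹ * p⁻¹ ∈ V := Iff.rfl

theorem case_beta {r : ℕ} (hr : r.Prime) (hG : IsPGroup r G) {f : G → ℂ} (hf : IsChar f) (hd : deg f = r)
    (K D : Subgroup G) [D.Normal] (hK : ∀ z, z ∈ K ↔ z ∈ Zc f) (hcK : ∀ a b : G, a * b * a⁻¹ * b⁻¹ ∈ K)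
    (hD : ∀ z ∈ K, ∀ g, g * z * g⁻¹ * z⁻¹ ∈ D) {a b : G} (hab : f (a * b * a⁻¹ * b⁻¹) ≠ f 1) (p q : G) :
    p * q * p⁻¹ * q⁻¹ ∈ Subgroup.zpowers (a * b * a⁻¹ * b⁻¹) ⊔ D := by
  have hirr : IsIrr f := by
    by_contra hn
    apply hab
    apply AllLin.comm _ hf
    intro l hl hm
    rcases pgroup_deg hr hG hl with h | h
    · exact h
    · exfalso
      apply hn
      rw [hf.eq_of_mlt_deg hl hm (by rw [hd]; exact Nat.le_of_dvd hl.deg_pos h)]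
      exact hl
  have hf1 : f 1 = r := by rw [hf.deg_eq, hd]
  have hr0 : (r : ℂ) ≠ 0 := by exact_mod_cast hr.ne_zero
  have hvan : ∀ g, g ∉ K → f g = 0 := by
    intro g hg
    have : ∃ a, a * g * a⁻¹ * g⁻¹ ∉ kerc f := by
      by_contra! h
      exact hg ((hK g).mpr (hirr.Zc_of_comm h))
    obtain ⟨c, hc⟩ := this
    have h1 := hirr.Zc_apply ((hK _).mp (hcK c g)) g
    rw [inv_mul_cancel_right, hf.isCl] at h1
    rw [hirr.mem_kerc] at hc
    by_contra h0
    apply hc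
    have h2 : f (c * g * c⁻¹ * g⁻¹) / f 1 = 1 := (mul_right_cancel₀ h0 (by rw [one_mul]; exact h1)).symm
    rwa [div_eq_one_iff_eq hirr.one_ne] at h2
  have hKi : K.index = r ^ 2 := by
    have := ip_supp f f K (r ^ 2 : ℂ) hvan (by
      intro g hg
      have := hirr.norm_of_mem_Zc ((hK g).mp hg)
      rw [Complex.mul_conj, Complex.normSq_eq_norm_sq, this, hd]
      push_cast; rfl)
    rw [ip_irr_self hirr, one_mul] at this
    exact_mod_cast this
  have hn := hf.isCl.kerc_normal
  have hKk : ∀ z ∈ K, ∀ g, g * z * g⁻¹ * z⁻¹ ∈ kerc f := fun z hz g => hirr.comm_mem_kerc ((hK z).mp hz) g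
  have hinv : ∀ (V : Subgroup G) (x y : G), x * y * x⁻¹ * y⁻¹ ∈ V → y * x * y⁻¹ * x⁻¹ ∈ V := by
    intro V x y h
    have := V.inv_mem h
    convert this using 1; group
  set V := Subgroup.zpowers (a * b * a⁻¹ * b⁻¹) ⊔ D with hV
  have hDV : D ≤ V := le_sup_right
  have hvV : a * b * a⁻¹ * b⁻¹ ∈ V := (le_sup_left : _ ≤ V) (Subgroup.mem_zpowers _)
  have hw : ∀ q p x : G, q * x * q⁻¹ * x⁻¹ ∈ V → p * (q * x * q⁻¹ * x⁻¹) * p⁻¹ ∈ V := by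
    intro q p x hx
    have := V.mul_mem (hDV (hD _ (hcK q x) p)) hx
    rwa [inv_mul_cancel_right] at this
  have hall : ∀ x y : G, x * y * x⁻¹ * y⁻¹ ∉ kerc f → ∀ u, u * x * u⁻¹ * x⁻¹ ∈ V → u * y * u⁻¹ * y⁻¹ ∈ V →
      ∀ p, u * p * u⁻¹ * p⁻¹ ∈ V := by
    intro x y hxy u h1 h2 p
    have := chain hr K (Wsub (kerc f) x (fun p z hz => hn.conj_mem _ hz p)) (Wsub V u (hw u)) (a := x) (b := y)
      (fun z hz => hKk z hz x) (fun z hz => hDV (hD z hz u))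
      (fun hx => hxy (hinv _ _ _ (hKk x hx y))) (by rw [mem_Wsub]; simp [Subgroup.one_mem]) h1 hxy h2 hKi
    have h3 : p ∈ Wsub V u (hw u) := by rw [this]; trivial
    exact h3
  have hab' : a * b * a⁻¹ * b⁻¹ ∉ kerc f := by rwa [hirr.mem_kerc]
  have e1 := hall a b hab' a (by simp [Subgroup.one_mem]) hvV
  have e2 := hall a b hab' b (hinv _ _ _ hvV) (by simp [Subgroup.one_mem])
  exact hall a b hab' p (hinv _ _ _ (e1 p)) (hinv _ _ _ (e2 p)) q
end
end CT

open CategoryTheory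
set_option linter.unusedSectionVars false
set_option linter.style.haveILetI false

namespace CT
noncomputable section
open ComplexConjugate

variable {G : Type} [Group G] [Finite G]

variable {X S : Type} [Group X] [Group S] [Finite X] [Finite S] {π : X →* S} {CD : Set ℕ}

theorem Hyp.camina (H : Hyp π CD) {x : X} (hx : orderOf (π x) = 7) {z : π.ker} (hz : z ∈ commutator π.ker) :
    IsConj x (x * z) := by
  have h7 : Nat.Prime 7 := by norm_num
  have hπx : π x ≠ 1 := by
    intro h; rw [h, orderOf_one] at hx; omega
  set T := (Subgroup.zpowers (π x)).comap π with hT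
  have hkT : π.ker ≤ T := by
    intro k hk
    rw [hT, Subgroup.mem_comap, MonoidHom.mem_ker.mp hk]; exact Subgroup.one_mem _
  have hxT : x ∈ T := Subgroup.mem_zpowers (π x)
  have hcard : Nat.card T = 7 * Nat.card π.ker := by
    rw [card_sub H.surj T hkT, hT, Subgroup.map_comap_eq_self_of_surjective H.surj, Nat.card_zpowers, hx]
  let E : Nrm π.ker T := (EN π).res T (fun l => hkT l.2)
  have hzT : (z : X) ∈ T := hkT z.2
  have key : ∀ ψ : T → ℂ, IsIrr ψ → ψ ⟨x * z, T.mul_mem hxT hzT⟩ = ψ ⟨x, hxT⟩ := by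
    intro ψ hψ
    rcases E.prime_index h7 hcard hψ with h | h
    · have hst : x ∈ (EN π).stab (fun l => ψ (E.ι l)) := by
        intro l
        have e : E.ι ((EN π).a x l) = (⟨x, hxT⟩ : T) * E.ι l * (⟨x, hxT⟩ : T)⁻¹ := Subtype.ext ((EN π).ha x l)
        simp only [e]
        exact hψ.isChar.isCl _ _
      have h2 := (mem_Tb h).mpr hst
      have h3 : 7 ∣ Nat.card (Tb π (fun l => ψ (E.ι l))) := by
        rw [← hx]
        exact (Subgroup.orderOf_dvd_natCard _ h2)
      have h4 := H.A2 h (H.A1 h h3)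
      rw [deg_res] at h4
      have h5 : (⟨x * z, T.mul_mem hxT hzT⟩ : T) = ⟨x, hxT⟩ * E.ι z := rfl
      have h6 : ψ (E.ι z) = 1 := by
        have h7 : commutator π.ker ≤ kerc (fun l => ψ (E.ι l)) :=
          (comm_le_iff _).mpr (fun a b => h.lin_comm (by rw [deg_res]; exact h4) a b)
        have h8 := h.mem_kerc.mp (h7 hz)
        simp only [map_one] at h8
        rw [h8, hψ.isChar.deg_eq, h4]; simp
      rw [h5, hψ.lin_mul h4, h6, mul_one]
    · have hr : ∀ y : T, π y ≠ 1 → ψ y = 0 := by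
        intro y hy
        apply h
        rintro ⟨l, rfl⟩
        exact hy l.2
      rw [hr ⟨x, hxT⟩ hπx, hr]
      have : π z = 1 := z.2
      rw [map_mul, this, mul_one]; exact hπx
  apply conj_of_irr
  intro χ hχ
  have e := (hχ.isChar.comp T.subtype).expand
  have e1 := congrFun e ⟨x, hxT⟩
  have e2 := congrFun e ⟨x * z, T.mul_mem hxT hzT⟩
  have e3 : χ x = _ := e1
  have e4 : χ (x * z) = _ := e2
  rw [e3, e4]
  simp only [Finset.sum_apply, Pi.smul_apply]
  apply Finset.sum_congr rfl
  intro ψ hψ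
  rw [key ψ (mem_IrrF.mp hψ)]

theorem Hyp.frat (H : Hyp π CD) {r : ℕ} (hr : r.Prime) (h7 : r ≠ 7) (A Y : Subgroup X) [Y.Normal]
    (hA : A.map π = ⊤) {v : X} {z : π.ker} (hz : z ∈ commutator π.ker) (hzv : (z : X) = v)
    {n : ℕ} (hvr : v ^ (r ^ n) = 1) (hvY : v ∉ Y)
    (hv : ∀ a ∈ A, a * v * a⁻¹ ∈ Subgroup.zpowers v ⊔ Y) : False := by
  have p7 : Nat.Prime 7 := by norm_num
  have : Fact (Nat.Prime 7) := ⟨p7⟩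
  have hq : ∀ a ∈ A, ∃ k : ℤ, (a : X ⧸ Y) * v * (a : X ⧸ Y)⁻¹ = (v : X ⧸ Y) ^ k := by
    intro a ha
    obtain ⟨w, ⟨k, rfl⟩, y, hy, hwy⟩ := Subgroup.mem_sup_of_normal_right.mp (hv a ha)
    refine ⟨k, ?_⟩
    have h1 : ((v ^ k * y : X) : X ⧸ Y) = ((v ^ k : X) : X ⧸ Y) := by
      rw [QuotientGroup.mk_mul, (QuotientGroup.eq_one_iff y).mpr hy, mul_one]
    have h2 : ((a * v * a⁻¹ : X) : X ⧸ Y) = ((v ^ k : X) : X ⧸ Y) := by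
      rw [← h1]; exact congrArg _ hwy.symm
    exact h2
  have hcm : ∀ a ∈ A, ∀ b ∈ A, ((b * a : X) : X ⧸ Y) * v * ((b * a : X) : X ⧸ Y)⁻¹ =
      ((a * b : X) : X ⧸ Y) * v * ((a * b : X) : X ⧸ Y)⁻¹ := by
    intro a ha b hb
    obtain ⟨k, hk⟩ := hq a ha
    obtain ⟨m, hm⟩ := hq b hb
    have g1 : ∀ (c w : X ⧸ Y) (i : ℤ), c * w ^ i * c⁻¹ = (c * w * c⁻¹) ^ i := fun c w i => (conj_zpow).symm
    have c1 : ((b * a : X) : X ⧸ Y) * v * ((b * a : X) : X ⧸ Y)⁻¹ = (b : X ⧸ Y) * ((a : X ⧸ Y) * v * (a : X ⧸ Y)⁻¹) * (b : X ⧸ Y)⁻¹ := by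
      rw [QuotientGroup.mk_mul]; group
    have c2 : ((a * b : X) : X ⧸ Y) * v * ((a * b : X) : X ⧸ Y)⁻¹ = (a : X ⧸ Y) * ((b : X ⧸ Y) * v * (b : X ⧸ Y)⁻¹) * (a : X ⧸ Y)⁻¹ := by
      rw [QuotientGroup.mk_mul]; group
    rw [c1, c2, hk, hm, g1, g1, hk, hm, ← zpow_mul, ← zpow_mul, mul_comm]
  set C : Subgroup X := (Subgroup.centralizer {(v : X ⧸ Y)}).comap (QuotientGroup.mk' Y) with hC
  have memC : ∀ x : X, x ∈ C ↔ (x : X ⧸ Y) * v = v * x := by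
    intro x
    rw [hC, Subgroup.mem_comap, Subgroup.mem_centralizer_singleton_iff]; rfl
  have hAC : ⁅A, A⁆ ≤ C := by
    rw [Subgroup.commutator_le]
    intro a ha b hb
    change a * b * a⁻¹ * b⁻¹ ∈ C
    rw [memC]
    have h1 := hcm a⁻¹ (A.inv_mem ha) b⁻¹ (A.inv_mem hb)
    have e : ((a * b * a⁻¹ * b⁻¹ : X) : X ⧸ Y) = ((b⁻¹ * a⁻¹ : X) : X ⧸ Y)⁻¹ * ((a⁻¹ * b⁻¹ : X) : X ⧸ Y) := by
      rw [← QuotientGroup.mk_inv, ← QuotientGroup.mk_mul]; congr 1; group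
    have hh : ∀ u w t : X ⧸ Y, u * t * u⁻¹ = w * t * w⁻¹ → u⁻¹ * w * t = t * (u⁻¹ * w) := by
      intro u w t h
      calc u⁻¹ * w * t = u⁻¹ * (w * t * w⁻¹) * w := by group
        _ = u⁻¹ * (u * t * u⁻¹) * w := by rw [h]
        _ = _ := by group
    rw [e]
    exact hh _ _ _ h1
  have hmap : ⁅A, A⁆.map π = ⊤ := by
    rw [Subgroup.map_commutator, hA, ← commutator_def]
    have := H.simple
    exact not_comm H.card
  obtain ⟨s, hs⟩ := exists_prime_orderOf_dvd_card' (G := S) 7 (by rw [H.card]; norm_num)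
  obtain ⟨x0, hx0, rfl⟩ : s ∈ ⁅A, A⁆.map π := by rw [hmap]; trivial
  obtain ⟨j, m, hm, hjm⟩ := Nat.exists_eq_pow_mul_and_not_dvd (orderOf_pos x0).ne' 7 (by norm_num)
  have hm7 : Nat.Coprime 7 m := (Nat.Prime.coprime_iff_not_dvd p7).mpr hm
  have hx1 : (x0 ^ m) ^ (7 ^ j) = 1 := by
    rw [← pow_mul, mul_comm, ← hjm, pow_orderOf_eq_one]
  have hx2 : orderOf (π (x0 ^ m)) = 7 := by
    rw [map_pow, Nat.Coprime.orderOf_pow, hs]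
    rw [hs]; exact hm7
  have hx3 : x0 ^ m ∈ C := C.pow_mem (hAC hx0) m
  have hcon := H.camina hx2 hz
  rw [hzv] at hcon
  have h1 : (x0 ^ m * v) ^ (7 ^ j) = 1 := by
    obtain ⟨c, hc⟩ := isConj_iff.mp hcon
    rw [← hc, conj_pow, hx1]; group
  have hcomm : Commute ((x0 ^ m : X) : X ⧸ Y) (v : X ⧸ Y) := (memC _).mp hx3
  have h2 : (v : X ⧸ Y) ^ (7 ^ j) = 1 := by
    have h3 : (((x0 ^ m * v) ^ (7 ^ j) : X) : X ⧸ Y) = 1 := by rw [h1]; rfl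
    rw [QuotientGroup.mk_pow, QuotientGroup.mk_mul, hcomm.mul_pow, ← QuotientGroup.mk_pow, hx1, QuotientGroup.mk_one, one_mul] at h3
    exact h3
  have h3 : (v : X ⧸ Y) ^ (r ^ n) = 1 := by
    rw [← QuotientGroup.mk_pow, hvr]; rfl
  have hcop : Nat.Coprime (7 ^ j) (r ^ n) := Nat.Coprime.pow _ _ ((Nat.coprime_primes p7 hr).mpr h7.symm)
  have h4 : orderOf (v : X ⧸ Y) = 1 :=
    Nat.eq_one_of_dvd_coprimes hcop (orderOf_dvd_of_pow_eq_one h2) (orderOf_dvd_of_pow_eq_one h3)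
  rw [orderOf_eq_one_iff] at h4
  exact hvY ((QuotientGroup.eq_one_iff v).mp h4)
end
end CT

open CategoryTheory
set_option linter.unusedSectionVars false
set_option linter.style.haveILetI false

namespace CT
noncomputable section
open ComplexConjugate

variable {G : Type} [Group G] [Finite G]

variable {X S : Type} [Group X] [Group S] [Finite X] [Finite S] {π : X →* S} {CD : Set ℕ}

theorem Hyp.dag (H : Hyp π CD) : Dag π.ker (RP π) := fun _ hr => ⟨hr.1, fun _ hφ hd => H.dagger hr hφ hd⟩

theorem Zc_iff {f : G → ℂ} (hf : IsIrr f) {z : G} : z ∈ Zc f ↔ ‖f z‖ = deg f :=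
  ⟨fun h => hf.norm_of_mem_Zc h, fun h => hf.isChar.mem_Zc h⟩

theorem Hyp.final (H : Hyp π CD) {r s : ℕ} (hr : r ∈ RP π) (hs : s ∈ RP π) (hlt : s < r) (h7 : r ≠ 7)
    (hp : commutator π.ker ≤ ⁅commutator π.ker, commutator π.ker⁆) : False := by
  have hD := H.dag
  have hr' := hr
  have hs' := hs
  obtain ⟨hrp, θ, hgθ, hdθ⟩ := hr
  obtain ⟨hsp, ψ, hgψ, hdψ⟩ := hs
  have hθ := hgθ.irr
  have hψ := hgψ.irr
  have hθR : deg θ ∈ RP π := by rw [hdθ]; exact hr'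
  have hψR : deg ψ ∈ RP π := by rw [hdψ]; exact hs'
  have : Fact r.Prime := ⟨hrp⟩
  let N := π.ker
  let EE : Subgroup X := (commutator N).map N.subtype
  have hEEn : EE.Normal := ConjAct.normal_of_characteristic_of_normal
  let P : Sylow r EE := default
  let P0 : Subgroup X := (P : Subgroup EE).map EE.subtype
  let A : Subgroup X := Subgroup.normalizer (P0 : Set X)
  have hEEk : EE ≤ π.ker := by
    rintro _ ⟨y, _, rfl⟩; exact y.2
  have hAtop : A.map π = ⊤ := by
    have h1 : A ⊔ EE = ⊤ := Sylow.normalizer_sup_eq_top P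
    have h2 := congrArg (Subgroup.map π) h1
    rw [Subgroup.map_sup, (Subgroup.map_eq_bot_iff EE).mpr hEEk, sup_bot_eq, Subgroup.map_top_of_surjective _ H.surj] at h2
    exact h2
  have hP0E : P0 ≤ EE := by
    rintro _ ⟨y, _, rfl⟩; exact y.2
  let PN : Subgroup N := P0.subgroupOf N
  have hPNE : PN ≤ commutator N := by
    intro y hy
    obtain ⟨w, hw, hwy⟩ := hP0E hy
    have : w = y := Subtype.ext hwy
    exact this ▸ hw
  have hP0p : ∀ y ∈ P0, ∃ k, y ^ (r ^ k) = 1 := by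
    rintro _ ⟨y, hy, rfl⟩
    obtain ⟨k, hk⟩ := P.isPGroup' ⟨y, hy⟩
    refine ⟨k, ?_⟩
    have := congrArg (fun t : P => ((t : EE) : X)) hk
    simpa using this
  have hPNp : IsPGroup r PN := by
    intro y
    obtain ⟨k, hk⟩ := hP0p _ y.2
    exact ⟨k, Subtype.ext (Subtype.ext (by simpa using hk))⟩
  have hrel : ¬ r ∣ PN.relIndex (commutator N) := by
    have h1 : PN.relIndex (commutator N) = P0.relIndex EE := Subgroup.relIndex_comap P0 N.subtype (commutator N)
    have h2 : P0.relIndex EE = (P : Subgroup EE).index := by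
      have : P0.subgroupOf EE = (P : Subgroup EE) := Subgroup.comap_map_eq_self_of_injective EE.subtype_injective _
      rw [Subgroup.relIndex, this]
    rw [h1, h2]; exact P.not_dvd_index
  -- conjugation
  have hAN : ∀ a ∈ A, ∀ y ∈ PN, (EN π).a a y ∈ PN := by
    intro a ha y hy
    exact (Subgroup.mem_normalizer_iff.mp ha y).mp hy
  -- commutators of P lie in Z
  have hPZ : ∀ p ∈ PN, ∀ q ∈ PN, p * q * p⁻¹ * q⁻¹ ∈ Zc θ := by
    intro p hp' q hq
    rw [hD.Zc_eq hp hθ hψ hθR hψR]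
    apply kerc_le_Zc
    rw [hψ.mem_kerc]
    have hc := hψ.isChar.comp PN.subtype
    have hal : AllLin (fun l => ψ (PN.subtype l)) := by
      intro l hl hm
      rcases pgroup_deg hrp hPNp hl with h | h
      · exact h
      · exfalso
        have h1 := Nat.le_of_dvd hl.deg_pos h
        have h2 := hc.mlt_mul_deg_le hl
        rw [deg_res, hdψ] at h2
        have h3 := Nat.pos_of_ne_zero hm
        nlinarith
    exact hal.comm hc ⟨p, hp'⟩ ⟨q, hq⟩
  have hcjR : ∀ (x : X) {φ : N → ℂ}, IsIrr φ → deg φ = r → IsIrr ((EN π).cj x φ) ∧ deg ((EN π).cj x φ) = r := by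
    intro x φ hφ hd
    exact ⟨(EN π).cj_irr x hφ, by rw [(EN π).deg_cj, hd]⟩
  have hfin : ∀ (Y : Subgroup N) (v : N), (∀ x : X, ∀ y ∈ Y, (EN π).a x y ∈ Y) → v ∈ PN → v ∉ Y →
      (∀ a ∈ A, (EN π).a a v ∈ Subgroup.zpowers v ⊔ Y) → False := by
    intro Y v hYn hvP hvY hva
    have hYX : (Y.map N.subtype).Normal := by
      refine ⟨?_⟩
      rintro _ ⟨y, hy, rfl⟩ g
      exact ⟨(EN π).a g y, hYn g y hy, rfl⟩
    obtain ⟨k, hk⟩ := hP0p _ hvP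
    refine H.frat hrp h7 A (Y.map N.subtype) hAtop (hPNE hvP) rfl hk ?_ ?_
    · rintro ⟨y, hy, hyv⟩
      have : y = v := Subtype.ext hyv
      exact hvY (this ▸ hy)
    · intro a ha
      have h1 := Subgroup.mem_map_of_mem N.subtype (hva a ha)
      rw [Subgroup.map_sup, MonoidHom.map_zpowers] at h1
      exact h1
  have hd1 : deg (fun l => θ (PN.subtype l)) = r := by rw [deg_res, hdθ]
  have hZn := hθ.isChar.isCl.Zc_normal
  by_cases hα : ∀ a ∈ PN, ∀ b ∈ PN, a * b * a⁻¹ * b⁻¹ ∈ kerc θ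
  · -- case alpha
    have hE := hD.irrE hp hθ hθR
    have hdE : deg (fun l : commutator N => θ l) = r := by
      have := deg_res θ (commutator N).subtype
      rw [hdθ] at this; exact this
    have hPi : (PN.subgroupOf (commutator N)).index = PN.relIndex (commutator N) := rfl
    obtain ⟨v, hv, hall⟩ := case_alpha hrp (hθ.isChar.comp PN.subtype) hd1 ((Zc θ).subgroupOf PN)
      (fun z hz g => hθ.Zc_apply hz g) (by
        intro g hg
        have hb := hE.burnside (PN.subgroupOf (commutator N)) ⟨g, hPNE g.2⟩ (by
          intro a ha
          rw [hE.mem_kerc]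
          exact hθ.mem_kerc.mp (hα a ha g g.2)) (by
          rw [hdE, Nat.coprime_comm, Nat.Prime.coprime_iff_not_dvd hrp, hPi]; exact hrel)
        rcases hb with h | h
        · exact h
        · exfalso
          apply hg
          have h2 := hE.norm_of_mem_Zc h
          rw [hdE] at h2
          exact (Zc_iff hθ).mpr (by rw [hdθ]; exact h2))
      (fun a b => hθ.mem_kerc.mp (hα a a.2 b b.2)) (by
        intro htop
        have hle : PN ≤ Zc θ := Subgroup.subgroupOf_eq_top.mp htop
        have h1 := hE.deg_dvd_index (PN.subgroupOf (commutator N)) (by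
          intro z hz
          rw [Zc_iff hE, hdE, ← hdθ]
          exact (Zc_iff hθ).mp (hle hz))
        rw [hdE, hPi] at h1
        exact hrel h1)
    refine hfin (Zc θ) v ?_ v.2 hv ?_
    · intro x y hy
      have h1 := hcjR x hθ hdθ
      rw [hD.Zc_eq hp hθ h1.1 hθR (by rw [h1.2]; exact hr')] at hy
      have h2 := (Zc_iff h1.1).mp hy
      rw [Zc_iff hθ, hdθ, ← h1.2]
      exact h2
    · intro a ha
      have h1 := Subgroup.mem_map_of_mem PN.subtype (hall ⟨_, hAN a ha v v.2⟩)
      rw [Subgroup.map_sup, MonoidHom.map_zpowers] at h1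
      rw [Subgroup.subgroupOf_map_subtype] at h1
      have hle : Subgroup.zpowers (v : N) ⊔ (Zc θ ⊓ PN) ≤ Subgroup.zpowers (v : N) ⊔ Zc θ := sup_le_sup le_rfl inf_le_left
      exact hle h1
  · -- case beta
    push Not at hα
    obtain ⟨a0, ha0, b0, hb0, hab⟩ := hα
    let D : Subgroup N := ⨅ φ : {φ : N → ℂ // IsIrr φ ∧ deg φ = r}, kerc φ.1
    have memD : ∀ y : N, y ∈ D ↔ ∀ φ : N → ℂ, IsIrr φ → deg φ = r → y ∈ kerc φ := by
      intro y
      rw [Subgroup.mem_iInf]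
      exact ⟨fun h φ h1 h2 => h ⟨φ, h1, h2⟩, fun h φ => h φ.1 φ.2.1 φ.2.2⟩
    have hDx : ∀ x : X, ∀ y ∈ D, (EN π).a x y ∈ D := by
      intro x y hy
      rw [memD] at hy ⊢
      intro φ hφ hd
      have h1 := hcjR x hφ hd
      have h2 := h1.1.mem_kerc.mp (hy _ h1.1 h1.2)
      rw [hφ.mem_kerc]
      unfold Nrm.cj at h2
      rw [map_one] at h2
      exact h2
    have hDn : D.Normal := by
      refine ⟨fun y hy g => ?_⟩
      have := hDx g y hy
      exact this
    have hDZ : ∀ z ∈ Zc θ, ∀ g, g * z * g⁻¹ * z⁻¹ ∈ D := by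
      intro z hz g
      rw [memD]
      intro φ hφ hd
      rw [hD.Zc_eq hp hθ hφ hθR (by rw [hd]; exact hr')] at hz
      exact hφ.comm_mem_kerc hz g
    have key := fun p q => case_beta hrp hPNp (hθ.isChar.comp PN.subtype) hd1 ((Zc θ).subgroupOf PN) (D.subgroupOf PN)
      (fun z => by
        constructor
        · intro hz
          obtain ⟨c, hc, h⟩ := mem_Zc_def.mp (Subgroup.mem_subgroupOf.mp hz)
          exact mem_Zc_def.mpr ⟨c, hc, fun g => h g⟩
        · intro hz
          obtain ⟨c, hc, h⟩ := mem_Zc_def.mp hz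
          rw [Subgroup.mem_subgroupOf, Zc_iff hθ]
          have hn : ‖c‖ = 1 := by
            obtain ⟨n, hn⟩ : ∃ n, z ^ n = 1 ∧ n ≠ 0 := ⟨orderOf z, pow_orderOf_eq_one z, (orderOf_pos z).ne'⟩
            have hpow : ∀ m : ℕ, θ (PN.subtype (z ^ m)) = c ^ m * θ 1 := by
              intro m
              induction m with
              | zero => simp
              | succ m ih =>
                rw [pow_succ', h, ih, pow_succ']; ring
            have h2 := hpow n
            rw [hn.1, map_one] at h2
            have h3 : c ^ n = 1 := (mul_right_cancel₀ hθ.one_ne (by rw [one_mul]; exact h2)).symm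
            exact Complex.norm_eq_one_of_pow_eq_one h3 hn.2
          have h1 := h 1
          simp only [mul_one, map_one] at h1
          have h2 : θ (z : N) = c * θ 1 := h1
          rw [h2, norm_mul, hn, one_mul, hθ.isChar.deg_eq]; simp)
      (fun a b => hPZ a a.2 b b.2) (fun z hz g => hDZ z hz g) (a := ⟨a0, ha0⟩) (b := ⟨b0, hb0⟩)
      (fun h => hab (hθ.mem_kerc.mpr h)) p q
    have hvP : a0 * b0 * a0⁻¹ * b0⁻¹ ∈ PN :=
      PN.mul_mem (PN.mul_mem (PN.mul_mem ha0 hb0) (PN.inv_mem ha0)) (PN.inv_mem hb0)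
    refine hfin D (a0 * b0 * a0⁻¹ * b0⁻¹) hDx hvP (fun h => hab ((memD _).mp h θ hθ hdθ)) ?_
    intro a ha
    have h1 := Subgroup.mem_map_of_mem PN.subtype (key ⟨_, hAN a ha a0 ha0⟩ ⟨_, hAN a ha b0 hb0⟩)
    rw [Subgroup.map_sup, MonoidHom.map_zpowers, Subgroup.subgroupOf_map_subtype] at h1
    have hle : Subgroup.zpowers (a0 * b0 * a0⁻¹ * b0⁻¹) ⊔ (D ⊓ PN) ≤ Subgroup.zpowers (a0 * b0 * a0⁻¹ * b0⁻¹) ⊔ D :=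
      sup_le_sup le_rfl inf_le_left
    rw [map_mul, map_mul, map_mul, map_inv, map_inv]
    exact hle h1

theorem Hyp.three (H : Hyp π CD) (a b c : ℕ) (ha : a ∈ RP π) (hb : b ∈ RP π) (hc : c ∈ RP π) (hab : a < b)
    (hbc : b < c) : False := by
  have hp : commutator π.ker ≤ ⁅commutator π.ker, commutator π.ker⁆ := by
    have ha' := ha
    have hb' := hb
    have hc' := hc
    obtain ⟨_, θ₁, g1, rfl⟩ := ha'
    obtain ⟨_, θ₂, g2, rfl⟩ := hb'
    obtain ⟨_, θ₃, g3, rfl⟩ := hc'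
    exact H.dag.perfect g1.irr g2.irr g3.irr ha hb hc hab.ne (hab.trans hbc).ne hbc.ne
  by_cases h : b = 7
  · exact H.final hc ha (hab.trans hbc) (by omega) hp
  · exact H.final hb ha hab h hp
end
end CT

/-- If `G` satisfies the two-prime hypothesis and has normal subgroups `N ≤ M` with
`M/N ≅ PSL₂(7)` and the centralizer of `M/N` in `G/N` trivial, then `|cd(G)| ≤ 18`. -/
theorem cd_bound_psl2_7
    (F : Type) [Field F] [Fintype F] (hF : Fintype.card F = 7)
    (G : Type) [Group G] [Finite G] (hG : TwoPrimeHypothesis G)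
    (N M : Subgroup G) [N.Normal] [M.Normal] (hNM : N ≤ M)
    (hiso : Nonempty ((M.map (QuotientGroup.mk' N)) ≃* PSL2 F))
    (hcent : Subgroup.centralizer ((M.map (QuotientGroup.mk' N)) : Set (G ⧸ N)) = ⊥) :
    (charDegrees G).ncard ≤ 18 := by
  have H := CT.hyp_of F hF hG N M hNM hiso hcent
  exact H.bound H.three
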